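/- arXiv:1702.01307 — 4 statements merged into one kernel-verified Lean document; each statement's English description precedes it below -/
import Mathlib

section
/- Let K be a compact connected subset of ℝ². If ε < δ are positive reals and the sets K^ε, K^δ are its closed neighborhoods, then L(K^δ \ K)/δ − πδ ≤ L(K^ε \ K)/ε − πε. -/
open Metric MeasureTheory Set

noncomputable abbrev Plane := EuclideanSpace ℝ (Fin 2)

namespace NagyProof

def dx (S : Finset (ℤ × ℤ)) : Finset (ℤ × ℤ) := S ∪ S.image (fun p => (p.1 + 1, p.2))
def dy (S : Finset (ℤ × ℤ)) : Finset (ℤ × ℤ) := S ∪ S.image (fun p => (p.1, p.2 + 1))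

def DConn (S : Finset (ℤ × ℤ)) : Prop :=
  ∀ R : ℤ × ℤ → ℤ × ℤ → Prop, (∀ a b, R a b → R b a) → (∀ a b c, R a b → R b c → R a c) →
    (∀ a ∈ S, ∀ b ∈ S, |a.1 - b.1| ≤ 1 → |a.2 - b.2| ≤ 1 → R a b) →
    ∀ a ∈ S, ∀ b ∈ S, R a b

lemma mem_dx {S : Finset (ℤ × ℤ)} {p : ℤ × ℤ} :
    p ∈ dx S ↔ p ∈ S ∨ (p.1 - 1, p.2) ∈ S := by
  unfold dx
  simp only [Finset.mem_union, Finset.mem_image]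
  constructor
  · rintro (h | ⟨q, hq, rfl⟩)
    · exact Or.inl h
    · right; simpa using hq
  · rintro (h | h)
    · exact Or.inl h
    · right; exact ⟨_, h, by ext <;> simp⟩

lemma mem_dy {S : Finset (ℤ × ℤ)} {p : ℤ × ℤ} :
    p ∈ dy S ↔ p ∈ S ∨ (p.1, p.2 - 1) ∈ S := by
  unfold dy
  simp only [Finset.mem_union, Finset.mem_image]
  constructor
  · rintro (h | ⟨q, hq, rfl⟩)
    · exact Or.inl h
    · right; simpa using hq
  · rintro (h | h)
    · exact Or.inl h
    · right; exact ⟨_, h, by ext <;> simp⟩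

lemma dx_dy (S : Finset (ℤ × ℤ)) : dx (dy S) = dy (dx S) := by
  ext p; simp only [mem_dx, mem_dy]; tauto

lemma DConn.dx {S : Finset (ℤ × ℤ)} (h : DConn S) : DConn (dx S) := by
  intro R hs ht ha
  have h0 := h R hs ht (fun a haS b hbS => ha a (mem_dx.2 (Or.inl haS)) b (mem_dx.2 (Or.inl hbS)))
  have h1 : ∀ a ∈ NagyProof.dx S, ∃ b ∈ S, R a b := by
    intro a haS
    rcases mem_dx.1 haS with h | h
    · exact ⟨a, h, h0 a h a h⟩
    · exact ⟨_, h, ha _ haS _ (mem_dx.2 (Or.inl h)) (by simp) (by simp)⟩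
  intro a haS b hbS
  obtain ⟨a', ha', haa⟩ := h1 a haS
  obtain ⟨b', hb', hbb⟩ := h1 b hbS
  exact ht _ _ _ haa (ht _ _ _ (h0 _ ha' _ hb') (hs _ _ hbb))

lemma DConn.dy {S : Finset (ℤ × ℤ)} (h : DConn S) : DConn (dy S) := by
  intro R hs ht ha
  have h0 := h R hs ht (fun a haS b hbS => ha a (mem_dy.2 (Or.inl haS)) b (mem_dy.2 (Or.inl hbS)))
  have h1 : ∀ a ∈ NagyProof.dy S, ∃ b ∈ S, R a b := by
    intro a haS
    rcases mem_dy.1 haS with h | h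
    · exact ⟨a, h, h0 a h a h⟩
    · exact ⟨_, h, ha _ haS _ (mem_dy.2 (Or.inl h)) (by simp) (by simp)⟩
  intro a haS b hbS
  obtain ⟨a', ha', haa⟩ := h1 a haS
  obtain ⟨b', hb', hbb⟩ := h1 b hbS
  exact ht _ _ _ haa (ht _ _ _ (h0 _ ha' _ hb') (hs _ _ hbb))

/-- vertices of the union of squares, as a graph. -/
def cornerRel (S : Finset (ℤ × ℤ)) (u v : ℤ × ℤ) : Prop :=
  (u ∈ dx S ∧ v = (u.1, u.2 + 1)) ∨ (u ∈ S ∧ (u.1, u.2 - 1) ∉ S ∧ v = (u.1 + 1, u.2))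

def cornerGraph (S : Finset (ℤ × ℤ)) : SimpleGraph (dx (dy S)) :=
  SimpleGraph.fromRel (fun u v => cornerRel S u.1 v.1)

lemma card_edges (S : Finset (ℤ × ℤ)) :
    Nat.card (cornerGraph S).edgeSet + S.card ≤ (dx S).card + (dy S).card := by
  classical
  set T := S.image (fun p : ℤ × ℤ => (p.1, p.2 + 1)) with hT
  have hTc : T.card = S.card := Finset.card_image_of_injective _ (by
    rintro ⟨a, b⟩ ⟨c, d⟩ h; simpa using h)
  have h1 : (dy S).card = S.card + (S \ T).card := by
    rw [← hTc]
    have : dy S = T ∪ (S \ T) := by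
      unfold dy; rw [Finset.union_sdiff_self_eq_union, Finset.union_comm]
    rw [this, Finset.card_union_of_disjoint Finset.disjoint_sdiff]
  set F : Finset (Sym2 (ℤ × ℤ)) := (dx S).image (fun u => s(u, (u.1, u.2 + 1))) ∪
    (S \ T).image (fun u => s(u, (u.1 + 1, u.2))) with hF
  have hFc : F.card ≤ (dx S).card + (S \ T).card :=
    (Finset.card_union_le _ _).trans (add_le_add Finset.card_image_le Finset.card_image_le)
  have hrel : ∀ u v, cornerRel S u v → s(u, v) ∈ F := by
    rintro u v (⟨h, rfl⟩ | ⟨h, h', rfl⟩)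
    · exact Finset.mem_union_left _ (Finset.mem_image_of_mem _ h)
    · refine Finset.mem_union_right _ (Finset.mem_image.2 ⟨u, ?_, rfl⟩)
      rw [Finset.mem_sdiff]
      refine ⟨h, fun hu => h' ?_⟩
      obtain ⟨q, hq, rfl⟩ := Finset.mem_image.1 hu
      simpa using hq
  have hmem : ∀ e ∈ (cornerGraph S).edgeSet, Sym2.map Subtype.val e ∈ F := by
    intro e
    induction e with
    | _ u v =>
      intro h
      rw [SimpleGraph.mem_edgeSet, cornerGraph, SimpleGraph.fromRel_adj] at h
      rw [Sym2.map_mk]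
      rcases h.2 with h | h
      · exact hrel _ _ h
      · have := hrel _ _ h
        rwa [Sym2.eq_swap] at this
  have hle : Nat.card (cornerGraph S).edgeSet ≤ F.card := by
    have hFF : Nat.card {x // x ∈ F} = F.card := by simp
    rw [← hFF]
    refine Nat.card_le_card_of_injective (fun e => (⟨_, hmem e.1 e.2⟩ : {x // x ∈ F})) ?_
    intro a b hab
    have := congrArg Subtype.val hab
    exact Subtype.ext (Sym2.map.injective Subtype.val_injective this)
  omega

lemma reach (S : Finset (ℤ × ℤ)) (hS : DConn S) :
    (cornerGraph S).Preconnected := by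
  classical
  let R : ℤ × ℤ → ℤ × ℤ → Prop := fun u v =>
    ∃ (hu : u ∈ dx (dy S)) (hv : v ∈ dx (dy S)), (cornerGraph S).Reachable ⟨u, hu⟩ ⟨v, hv⟩
  have hs : ∀ a b, R a b → R b a := fun a b ⟨h1, h2, h⟩ => ⟨h2, h1, h.symm⟩
  have ht : ∀ a b c, R a b → R b c → R a c :=
    fun a b c ⟨h1, h2, h⟩ ⟨_, h4, h'⟩ => ⟨h1, h4, h.trans h'⟩
  have hrel : ∀ u v, u ∈ dx (dy S) → v ∈ dx (dy S) → cornerRel S u v → R u v := by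
    intro u v hu hv h
    refine ⟨hu, hv, SimpleGraph.Adj.reachable ?_⟩
    rw [cornerGraph, SimpleGraph.fromRel_adj]
    refine ⟨?_, Or.inl h⟩
    intro h'
    have h'' : u = v := congrArg Subtype.val h'
    subst h''
    rcases h with ⟨_, h⟩ | ⟨_, _, h⟩
    · have := congrArg Prod.snd h; simp at this
    · have := congrArg Prod.fst h; simp at this
  have c00 : ∀ x y, (x, y) ∈ S → (x, y) ∈ dx (dy S) := by
    intro x y h; simp [mem_dx, mem_dy, h]
  have c10 : ∀ x y, (x, y) ∈ S → (x + 1, y) ∈ dx (dy S) := by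
    intro x y h; simp [mem_dx, mem_dy, h]
  have c01 : ∀ x y, (x, y) ∈ S → (x, y + 1) ∈ dx (dy S) := by
    intro x y h; simp [mem_dx, mem_dy, h]
  have c11 : ∀ x y, (x, y) ∈ S → (x + 1, y + 1) ∈ dx (dy S) := by
    intro x y h; simp [mem_dx, mem_dy, h]
  have left : ∀ x y, (x, y) ∈ S → R (x, y) (x, y + 1) := fun x y h =>
    hrel _ _ (c00 x y h) (c01 x y h) (Or.inl ⟨by simp [mem_dx, h], rfl⟩)
  have right : ∀ x y, (x, y) ∈ S → R (x + 1, y) (x + 1, y + 1) := fun x y h =>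
    hrel _ _ (c10 x y h) (c11 x y h) (Or.inl ⟨by simp [mem_dx, h], rfl⟩)
  obtain ⟨m, hm⟩ : ∃ m : ℤ, ∀ p ∈ S, m ≤ p.2 := by
    obtain ⟨m, hm⟩ := (S.image Prod.snd).bddBelow
    exact ⟨m, fun p hp => hm (by simpa using ⟨p.1, hp⟩)⟩
  have bot : ∀ n : ℕ, ∀ x y, (x, y) ∈ S → y - m ≤ n → R (x, y) (x + 1, y) := by
    intro n
    induction n with
    | zero =>
      intro x y h hy
      refine hrel _ _ (c00 x y h) (c10 x y h) (Or.inr ⟨h, fun h' => ?_, rfl⟩)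
      have := hm _ h'
      simp at this hy; omega
    | succ n ih =>
      intro x y h hy
      by_cases h' : (x, y - 1) ∈ S
      · have e := ih x (y - 1) h' (by push_cast at hy; omega)
        have l := left _ _ h'
        have r := right _ _ h'
        simp only [sub_add_cancel] at l r
        exact ht _ _ _ (hs _ _ l) (ht _ _ _ e r)
      · exact hrel _ _ (c00 x y h) (c10 x y h) (Or.inr ⟨h, h', rfl⟩)
  have bot' : ∀ x y, (x, y) ∈ S → R (x, y) (x + 1, y) := fun x y h =>
    bot (y - m).toNat x y h (Int.self_le_toNat _)
  have corner : ∀ x y, (x, y) ∈ S → ∀ i j : ℤ, (i = 0 ∨ i = 1) → (j = 0 ∨ j = 1) →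
      R (x, y) (x + i, y + j) := by
    rintro x y h i j (rfl | rfl) (rfl | rfl)
    · simpa using ht _ _ _ (left x y h) (hs _ _ (left x y h))
    · simpa using left x y h
    · simpa using bot' x y h
    · exact ht _ _ _ (bot' x y h) (right x y h)
  have hall := hS R hs ht (by
    rintro ⟨x, y⟩ ha ⟨x', y'⟩ hb h1 h2
    simp only [abs_le] at h1 h2
    have e1 := corner x y ha (max x x' - x) (max y y' - y) (by omega) (by omega)
    have e2 := corner x' y' hb (max x x' - x') (max y y' - y') (by omega) (by omega)
    simp only [add_sub_cancel] at e1 e2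
    exact ht _ _ _ e1 (hs _ _ e2))
  have hto : ∀ v ∈ dx (dy S), ∃ s ∈ S, R s v := by
    rintro ⟨x, y⟩ hv
    rw [mem_dx, mem_dy, mem_dy] at hv
    rcases hv with (h | h) | (h | h)
    · exact ⟨_, h, by simpa using corner _ _ h 0 0 (by simp) (by simp)⟩
    · exact ⟨_, h, by simpa using corner _ _ h 0 1 (by simp) (by simp)⟩
    · exact ⟨_, h, by simpa using corner _ _ h 1 0 (by simp) (by simp)⟩
    · exact ⟨_, h, by simpa using corner _ _ h 1 1 (by simp) (by simp)⟩
  rintro ⟨u, hu⟩ ⟨v, hv⟩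
  obtain ⟨s, hs1, hs2⟩ := hto u hu
  obtain ⟨t, ht1, ht2⟩ := hto v hv
  obtain ⟨_, _, h⟩ := ht _ _ _ (hs _ _ hs2) (ht _ _ _ (hall s hs1 t ht1) ht2)
  exact h

lemma unit_step (S : Finset (ℤ × ℤ)) (hS : DConn S) :
    (dx (dy S)).card + S.card ≤ (dx S).card + (dy S).card + 1 := by
  classical
  rcases S.eq_empty_or_nonempty with rfl | ⟨p, hp⟩
  · simp [dx, dy]
  have hc : (cornerGraph S).Connected :=
    { preconnected := reach S hS
      nonempty := ⟨⟨p, by simp [mem_dx, mem_dy, hp]⟩⟩ }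
  have h1 := hc.card_vert_le_card_edgeSet_add_one
  have h2 := card_edges S
  rw [Nat.card_eq_fintype_card, Fintype.card_coe] at h1
  omega

lemma dx_iter_dy (i : ℕ) (S : Finset (ℤ × ℤ)) : dx^[i] (dy S) = dy (dx^[i] S) := by
  induction i generalizing S with
  | zero => rfl
  | succ i ih => rw [Function.iterate_succ_apply, dx_dy, ih, Function.iterate_succ_apply]

lemma DConn.iter {S : Finset (ℤ × ℤ)} (h : DConn S) (i j : ℕ) :
    DConn (NagyProof.dy^[j] (NagyProof.dx^[i] S)) := by
  have h1 : DConn (NagyProof.dx^[i] S) := by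
    induction i with
    | zero => exact h
    | succ i ih => rw [Function.iterate_succ_apply']; exact ih.dx
  induction j with
  | zero => exact h1
  | succ i ih => rw [Function.iterate_succ_apply']; exact ih.dy

lemma row_step (S : Finset (ℤ × ℤ)) (hS : DConn S) (m : ℕ) :
    (dy^[m] (dx S)).card + S.card ≤ (dx S).card + (dy^[m] S).card + m := by
  induction m with
  | zero => simp
  | succ m ih =>
    have := unit_step (dy^[m] S) (hS.iter 0 m)
    have e : dx (dy^[m] S) = dy^[m] (dx S) := by
      clear ih this
      induction m with
      | zero => rfl
      | succ m ih => rw [Function.iterate_succ_apply', dx_dy, ih, Function.iterate_succ_apply']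
    rw [dx_dy, e, ← Function.iterate_succ_apply' dy, ← Function.iterate_succ_apply' dy] at this
    simp only [Nat.succ_eq_add_one] at this
    omega

lemma grid_step (S : Finset (ℤ × ℤ)) (hS : DConn S) (n m : ℕ) :
    (dy^[m] (dx^[n] S)).card + S.card ≤ (dx^[n] S).card + (dy^[m] S).card + n * m := by
  induction n with
  | zero => simp [add_comm]
  | succ n ih =>
    have := row_step (dx^[n] S) (hS.iter n 0) m
    rw [← Function.iterate_succ_apply' dx] at this
    simp only [Nat.succ_eq_add_one] at this
    rw [add_mul]
    omega

lemma mem_dx_iter {n : ℕ} {S : Finset (ℤ × ℤ)} {p : ℤ × ℤ} :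
    p ∈ dx^[n] S ↔ ∃ k : ℕ, k ≤ n ∧ (p.1 - k, p.2) ∈ S := by
  induction n generalizing p with
  | zero => simp
  | succ n ih =>
    rw [Function.iterate_succ_apply', mem_dx, ih, ih]
    constructor
    · rintro (⟨k, hk, h⟩ | ⟨k, hk, h⟩)
      · exact ⟨k, by omega, h⟩
      · exact ⟨k + 1, by omega, by convert h using 2; push_cast; ring⟩
    · rintro ⟨k, hk, h⟩
      rcases Nat.lt_or_ge n k with h' | h'
      · right; exact ⟨k - 1, by omega, by convert h using 2; push_cast [show 1 ≤ k by omega]; ring⟩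
      · left; exact ⟨k, h', h⟩

lemma mem_dy_iter {n : ℕ} {S : Finset (ℤ × ℤ)} {p : ℤ × ℤ} :
    p ∈ dy^[n] S ↔ ∃ k : ℕ, k ≤ n ∧ (p.1, p.2 - k) ∈ S := by
  induction n generalizing p with
  | zero => simp
  | succ n ih =>
    rw [Function.iterate_succ_apply', mem_dy, ih, ih]
    constructor
    · rintro (⟨k, hk, h⟩ | ⟨k, hk, h⟩)
      · exact ⟨k, by omega, h⟩
      · exact ⟨k + 1, by omega, by convert h using 2; push_cast; ring⟩
    · rintro ⟨k, hk, h⟩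
      rcases Nat.lt_or_ge n k with h' | h'
      · right; exact ⟨k - 1, by omega, by convert h using 2; push_cast [show 1 ≤ k by omega]; ring⟩
      · left; exact ⟨k, h', h⟩

end NagyProof

namespace NagyProof
open scoped Pointwise Topology
open Filter

noncomputable def cell (n : ℕ) (z : ℂ) : ℤ × ℤ := (⌊(n : ℝ) * z.re⌋, ⌊(n : ℝ) * z.im⌋)

lemma cell_preimage (n : ℕ) (hn : 0 < n) (p : ℤ × ℤ) :
    cell n ⁻¹' {p} = Complex.measurableEquivRealProd ⁻¹'
      (Ico ((p.1 : ℝ) / n) ((p.1 + 1) / n) ×ˢ Ico ((p.2 : ℝ) / n) ((p.2 + 1) / n)) := by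
  have hn' : (0 : ℝ) < n := by exact_mod_cast hn
  ext z
  simp only [mem_preimage, mem_singleton_iff, cell, Prod.ext_iff, Int.floor_eq_iff, mem_prod,
    mem_Ico, Complex.measurableEquivRealProd_apply, div_le_iff₀ hn', lt_div_iff₀ hn']
  simp only [mul_comm]

lemma measurableSet_cell (n : ℕ) (hn : 0 < n) (p : ℤ × ℤ) : MeasurableSet (cell n ⁻¹' {p}) := by
  rw [cell_preimage n hn]
  exact Complex.measurableEquivRealProd.measurable (measurableSet_Ico.prod measurableSet_Ico)

lemma volume_cell (n : ℕ) (hn : 0 < n) (p : ℤ × ℤ) :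
    volume (cell n ⁻¹' {p}) = ENNReal.ofReal (1 / (n : ℝ) ^ 2) := by
  have hn' : (0 : ℝ) < n := by exact_mod_cast hn
  rw [cell_preimage n hn, Complex.volume_preserving_equiv_real_prod.measure_preimage
    (measurableSet_Ico.prod measurableSet_Ico).nullMeasurableSet, Measure.volume_eq_prod,
    Measure.prod_prod, Real.volume_Ico, Real.volume_Ico, ← ENNReal.ofReal_mul]
  · congr 1; field_simp; ring
  · field_simp; simp

lemma volume_cells (n : ℕ) (hn : 0 < n) (S : Finset (ℤ × ℤ)) :
    volume.real (cell n ⁻¹' (S : Set (ℤ × ℤ))) = S.card / (n : ℝ) ^ 2 := by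
  rw [measureReal_def, ← sum_measure_preimage_singleton S (fun p _ => measurableSet_cell n hn p)]
  simp only [volume_cell n hn, Finset.sum_const, nsmul_eq_mul]
  rw [ENNReal.toReal_mul, ENNReal.toReal_ofReal (by positivity)]
  simp [div_eq_mul_inv]

lemma volume_cells_ne_top (n : ℕ) (hn : 0 < n) (S : Finset (ℤ × ℤ)) :
    volume (cell n ⁻¹' (S : Set (ℤ × ℤ))) ≠ ⊤ := by
  rw [← sum_measure_preimage_singleton S (fun p _ => measurableSet_cell n hn p)]
  simp only [volume_cell n hn, Finset.sum_const, nsmul_eq_mul]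
  exact ENNReal.mul_ne_top (by simp) (by simp)

lemma cell_finite (n : ℕ) (M : Set ℂ) (hM : IsCompact M) : (cell n '' M).Finite := by
  obtain ⟨C, hC⟩ := hM.isBounded.exists_norm_le
  refine ((finite_Icc (-⌈(n : ℝ) * C⌉) ⌈(n : ℝ) * C⌉).prod
    (finite_Icc (-⌈(n : ℝ) * C⌉) ⌈(n : ℝ) * C⌉)).subset ?_
  have key : ∀ x : ℝ, |x| ≤ C → ⌊(n : ℝ) * x⌋ ∈ Icc (-⌈(n : ℝ) * C⌉) ⌈(n : ℝ) * C⌉ := by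
    intro x hx
    rw [abs_le] at hx
    have hn : (0 : ℝ) ≤ n := n.cast_nonneg
    constructor
    · rw [← Int.floor_neg]
      exact Int.floor_mono (by nlinarith)
    · exact (Int.floor_mono (mul_le_mul_of_nonneg_left hx.2 hn)).trans (Int.floor_le_ceil _)
  rintro _ ⟨z, hz, rfl⟩
  exact ⟨key _ ((Complex.abs_re_le_norm z).trans (hC z hz)),
    key _ ((Complex.abs_im_le_norm z).trans (hC z hz))⟩

lemma abs_floor_sub_le (x y : ℝ) (h : |x - y| < 1) : |⌊x⌋ - ⌊y⌋| ≤ 1 := by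
  rw [abs_lt] at h
  have h1 := Int.floor_le x
  have h2 := Int.lt_floor_add_one x
  have h3 := Int.floor_le y
  have h4 := Int.lt_floor_add_one y
  rw [abs_le]
  constructor
  · have : (⌊y⌋ : ℝ) < ⌊x⌋ + 2 := by linarith
    have : ⌊y⌋ < ⌊x⌋ + 2 := by exact_mod_cast this
    omega
  · have : (⌊x⌋ : ℝ) < ⌊y⌋ + 2 := by linarith
    have : ⌊x⌋ < ⌊y⌋ + 2 := by exact_mod_cast this
    omega

lemma cell_conn (n : ℕ) (hn : 0 < n) (M : Set ℂ) (hM : IsPreconnected M) (S : Finset (ℤ × ℤ))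
    (hS : (S : Set (ℤ × ℤ)) = cell n '' M) : DConn S := by
  have hn' : (0 : ℝ) < n := by exact_mod_cast hn
  intro R hs ht ha
  have hmem : ∀ z ∈ M, cell n z ∈ S := by
    intro z hz
    rw [← Finset.mem_coe, hS]; exact ⟨z, hz, rfl⟩
  have key : ∀ z ∈ M, ∀ w ∈ M, R (cell n z) (cell n w) := by
    intro z hz w hw
    refine hM.induction₂ (fun z w => R (cell n z) (cell n w)) ?_ ?_ ?_ hz hw
    · intro z hz
      have hb : Metric.ball z (1 / n) ∈ 𝓝[M] z :=
        mem_nhdsWithin_of_mem_nhds (Metric.ball_mem_nhds _ (by positivity))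
      filter_upwards [hb, self_mem_nhdsWithin] with w hw hwM
      rw [Metric.mem_ball, dist_comm, dist_eq_norm, lt_div_iff₀ hn'] at hw
      refine ha _ (hmem z hz) _ (hmem w hwM) (abs_floor_sub_le _ _ ?_) (abs_floor_sub_le _ _ ?_)
      · rw [← mul_sub, abs_mul, abs_of_pos hn', mul_comm]
        refine lt_of_le_of_lt (mul_le_mul_of_nonneg_right ?_ hn'.le) hw
        simpa using Complex.abs_re_le_norm (z - w)
      · rw [← mul_sub, abs_mul, abs_of_pos hn', mul_comm]
        refine lt_of_le_of_lt (mul_le_mul_of_nonneg_right ?_ hn'.le) hw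
        simpa using Complex.abs_im_le_norm (z - w)
    · intro x y z _ _ _ h1 h2; exact ht _ _ _ h1 h2
    · intro x y _ _ h; exact hs _ _ h
  intro a haS b hbS
  rw [← Finset.mem_coe, hS] at haS hbS
  obtain ⟨z, hz, rfl⟩ := haS
  obtain ⟨w, hw, rfl⟩ := hbS
  exact key z hz w hw

/-- The segment from `0` to `a`. -/
def sg (a : ℂ) : Set ℂ := (fun t : ℝ => (t : ℂ) * a) '' Icc 0 1

lemma sg_compact (a : ℂ) : IsCompact (sg a) :=
  isCompact_Icc.image (by fun_prop)

lemma sg_conn (a : ℂ) : IsConnected (sg a) :=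
  (isConnected_Icc zero_le_one).image _ (by fun_prop)

lemma add_conn {A B : Set ℂ} (hA : IsConnected A) (hB : IsConnected B) : IsConnected (A + B) := by
  rw [← image2_add, ← image_uncurry_prod]
  exact (hA.prod hB).image _ (by unfold Function.uncurry; fun_prop)

lemma floor_add_mem (n : ℕ) (x t : ℝ) (ht : t ∈ Icc (0 : ℝ) 1) :
    ∃ k : ℕ, k ≤ n ∧ ⌊(n : ℝ) * (x + t)⌋ - k = ⌊(n : ℝ) * x⌋ := by
  have hn : (0 : ℝ) ≤ n := n.cast_nonneg
  have h1 : ⌊(n : ℝ) * x⌋ ≤ ⌊(n : ℝ) * (x + t)⌋ := Int.floor_mono (by nlinarith [ht.1])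
  have h2 : ⌊(n : ℝ) * (x + t)⌋ ≤ ⌊(n : ℝ) * x⌋ + n := by
    rw [← Int.floor_add_natCast]
    exact Int.floor_mono (by nlinarith [ht.2])
  exact ⟨(⌊(n : ℝ) * (x + t)⌋ - ⌊(n : ℝ) * x⌋).toNat, by omega, by omega⟩

lemma floor_close (n : ℕ) (hn : 0 < n) (x y : ℝ) (k : ℕ) (h : ⌊(n : ℝ) * y⌋ - k = ⌊(n : ℝ) * x⌋) :
    |y - (x + k / n)| ≤ 1 / n := by
  have hn' : (0 : ℝ) < n := by exact_mod_cast hn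
  have h1 := Int.floor_le ((n : ℝ) * x)
  have h2 := Int.lt_floor_add_one ((n : ℝ) * x)
  have h3 := Int.floor_le ((n : ℝ) * y)
  have h4 := Int.lt_floor_add_one ((n : ℝ) * y)
  have h5 : (⌊(n : ℝ) * y⌋ : ℝ) - k = ⌊(n : ℝ) * x⌋ := by exact_mod_cast h
  have : |(n : ℝ) * y - (n * x + k)| ≤ 1 := by rw [abs_le]; constructor <;> linarith
  have e : y - (x + k / n) = ((n : ℝ) * y - (n * x + k)) / n := by field_simp
  rw [e, abs_div, abs_of_pos hn']
  gcongr

lemma grid_ineq (M : Set ℂ) (hM : IsCompact M) (hc : IsConnected M) (n : ℕ) (hn : 0 < n) :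
    volume.real (M + sg 1 + sg Complex.I) + volume.real M ≤
      volume.real (cthickening (2 / n) (M + sg 1)) +
      volume.real (cthickening (2 / n) (M + sg Complex.I)) + 1 := by
  have hn' : (0 : ℝ) < n := by exact_mod_cast hn
  obtain ⟨S, hS⟩ := (cell_finite n M hM).exists_finset_coe
  have hconn := cell_conn n hn M hc.isPreconnected S hS
  have hg := grid_step S hconn n n
  have hmem : ∀ z ∈ M, cell n z ∈ S := by
    intro z hz
    rw [← Finset.mem_coe, hS]; exact ⟨z, hz, rfl⟩
  have h1 : volume.real M ≤ S.card / (n : ℝ) ^ 2 := by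
    rw [← volume_cells n hn]
    exact measureReal_mono (fun z hz => hmem z hz) (volume_cells_ne_top n hn S)
  have h2 : volume.real (M + sg 1 + sg Complex.I) ≤ (dy^[n] (dx^[n] S)).card / (n : ℝ) ^ 2 := by
    rw [← volume_cells n hn]
    refine measureReal_mono ?_ (volume_cells_ne_top n hn _)
    rintro _ ⟨_, ⟨z, hz, _, ⟨s, hs, rfl⟩, rfl⟩, _, ⟨t, ht, rfl⟩, rfl⟩
    obtain ⟨k, hk, ek⟩ := floor_add_mem n z.re s hs
    obtain ⟨l, hl, el⟩ := floor_add_mem n z.im t ht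
    rw [mem_preimage, Finset.mem_coe, mem_dy_iter]
    refine ⟨l, hl, ?_⟩
    rw [mem_dx_iter]
    refine ⟨k, hk, ?_⟩
    have := hmem z hz
    simp only [cell] at this ⊢
    convert this using 2
    · rw [← ek]; simp
    · rw [← el]; simp
  have h3 : ((dx^[n] S).card : ℝ) / (n : ℝ) ^ 2 ≤ volume.real (cthickening (2 / n) (M + sg 1)) := by
    rw [← volume_cells n hn]
    refine measureReal_mono ?_
      (hM.add (sg_compact 1)).isBounded.cthickening.measure_lt_top.ne
    intro w hw
    rw [mem_preimage, Finset.mem_coe, mem_dx_iter] at hw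
    obtain ⟨k, hk, hw⟩ := hw
    rw [← Finset.mem_coe, hS] at hw
    obtain ⟨z, hz, e⟩ := hw
    simp only [cell, Prod.ext_iff] at e
    have a1 := floor_close n hn z.re w.re k e.1.symm
    have a2 := floor_close n hn z.im w.im 0 (by simpa using e.2.symm)
    refine mem_cthickening_of_dist_le w (z + ((k / n : ℝ) : ℂ) * 1) _ _
      (add_mem_add hz ⟨k / n, ⟨by positivity, ?_⟩, rfl⟩) ?_
    · rw [div_le_one hn']; exact_mod_cast hk
    · rw [dist_eq_norm]
      refine (Complex.norm_le_abs_re_add_abs_im _).trans ?_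
      have : (2 : ℝ) / n = 1 / n + 1 / n := by ring
      rw [this]
      refine add_le_add ?_ ?_
      · simpa using a1
      · simpa using a2
  have h4 : ((dy^[n] S).card : ℝ) / (n : ℝ) ^ 2 ≤
      volume.real (cthickening (2 / n) (M + sg Complex.I)) := by
    rw [← volume_cells n hn]
    refine measureReal_mono ?_
      (hM.add (sg_compact _)).isBounded.cthickening.measure_lt_top.ne
    intro w hw
    rw [mem_preimage, Finset.mem_coe, mem_dy_iter] at hw
    obtain ⟨k, hk, hw⟩ := hw
    rw [← Finset.mem_coe, hS] at hw
    obtain ⟨z, hz, e⟩ := hw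
    simp only [cell, Prod.ext_iff] at e
    have a1 := floor_close n hn z.re w.re 0 (by simpa using e.1.symm)
    have a2 := floor_close n hn z.im w.im k e.2.symm
    refine mem_cthickening_of_dist_le w (z + ((k / n : ℝ) : ℂ) * Complex.I) _ _
      (add_mem_add hz ⟨k / n, ⟨by positivity, ?_⟩, rfl⟩) ?_
    · rw [div_le_one hn']; exact_mod_cast hk
    · rw [dist_eq_norm]
      refine (Complex.norm_le_abs_re_add_abs_im _).trans ?_
      have : (2 : ℝ) / n = 1 / n + 1 / n := by ring
      rw [this]
      refine add_le_add ?_ ?_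
      · simpa using a1
      · simpa using a2
  have hg' : ((dy^[n] (dx^[n] S)).card : ℝ) + S.card ≤
      (dx^[n] S).card + (dy^[n] S).card + (n : ℝ) * n := by exact_mod_cast hg
  have h5 : ((dy^[n] (dx^[n] S)).card : ℝ) / (n : ℝ) ^ 2 + S.card / (n : ℝ) ^ 2 ≤
      (dx^[n] S).card / (n : ℝ) ^ 2 + (dy^[n] S).card / (n : ℝ) ^ 2 + 1 := by
    have : (1 : ℝ) = (n : ℝ) * n / (n : ℝ) ^ 2 := by field_simp
    rw [this, ← add_div, ← add_div, ← add_div]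
    gcongr
  linarith

lemma tendsto_real_cthickening {M : Set ℂ} (hM : IsCompact M) :
    Tendsto (fun r => volume.real (cthickening r M)) (𝓝 0) (𝓝 (volume.real M)) :=
  (ENNReal.tendsto_toReal hM.measure_lt_top.ne).comp (tendsto_measure_cthickening_of_isCompact hM)

lemma unit_ineq (M : Set ℂ) (hM : IsCompact M) (hc : IsConnected M) :
    volume.real (M + sg 1 + sg Complex.I) + volume.real M ≤
      volume.real (M + sg 1) + volume.real (M + sg Complex.I) + 1 := by
  have h0 : Tendsto (fun n : ℕ => (2 : ℝ) / n) atTop (𝓝 0) := tendsto_const_div_atTop_nhds_zero_nat 2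
  have h1 := (tendsto_real_cthickening (hM.add (sg_compact 1))).comp h0
  have h2 := (tendsto_real_cthickening (hM.add (sg_compact Complex.I))).comp h0
  refine ge_of_tendsto ((h1.add h2).add_const 1) ?_
  filter_upwards [eventually_gt_atTop 0] with n hn
  exact grid_ineq M hM hc n hn

/-- The determinant of two plane vectors. -/
def dt (a b : ℂ) : ℝ := a.re * b.im - a.im * b.re

/-- The linear map sending `1, I` to `a, b`. -/
noncomputable def tmap (a b : ℂ) : ℂ →ₗ[ℝ] ℂ :=
  Complex.reLm.smulRight a + Complex.imLm.smulRight b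

lemma tmap_apply (a b z : ℂ) : tmap a b z = (z.re : ℂ) * a + (z.im : ℂ) * b := by
  simp [tmap]

lemma det_tmap (a b : ℂ) : LinearMap.det (tmap a b) = dt a b := by
  rw [← LinearMap.det_toMatrix Complex.basisOneI, Matrix.det_fin_two]
  simp [LinearMap.toMatrix_apply, tmap_apply, dt]
  ring

lemma tmap_sg (a b c : ℂ) : tmap a b '' sg c = sg (tmap a b c) := by
  unfold sg
  rw [image_image]
  refine image_congr fun t _ => ?_
  simp [tmap_apply]; ring

end NagyProof

namespace NagyProof
open scoped Pointwise Topology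
open Filter

lemma two_ineq_of_ne (M : Set ℂ) (hM : IsCompact M) (hc : IsConnected M) (a b : ℂ)
    (hab : dt a b ≠ 0) :
    volume.real (M + sg a + sg b) + volume.real M ≤
      volume.real (M + sg a) + volume.real (M + sg b) + |dt a b| := by
  have hdet : LinearMap.det (tmap a b) ≠ 0 := by rwa [det_tmap]
  let e := (LinearMap.equivOfDetNeZero (tmap a b) hdet).toContinuousLinearEquiv
  have he : ∀ z, e z = tmap a b z := fun z => rfl
  set M' := e.symm '' M with hM'
  have h1 : M = tmap a b '' M' := by
    rw [hM', image_image]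
    have : ∀ z, tmap a b (e.symm z) = z := fun z => by rw [← he]; simp
    simp [this]
  have hT1 : tmap a b 1 = a := by simp [tmap_apply]
  have hTI : tmap a b Complex.I = b := by simp [tmap_apply]
  have hvol : ∀ A : Set ℂ, volume.real (tmap a b '' A) = |dt a b| * volume.real A := by
    intro A
    rw [measureReal_def, Measure.addHaar_image_linearMap, det_tmap, ENNReal.toReal_mul,
      ENNReal.toReal_ofReal (abs_nonneg _), measureReal_def]
  have hu := unit_ineq M' (hM.image e.symm.continuous) (hc.image _ e.symm.continuous.continuousOn)
  have ea : M + sg a = tmap a b '' (M' + sg 1) := by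
    rw [image_add, tmap_sg, hT1, ← h1]
  have eb : M + sg b = tmap a b '' (M' + sg Complex.I) := by
    rw [image_add, tmap_sg, hTI, ← h1]
  have eab : M + sg a + sg b = tmap a b '' (M' + sg 1 + sg Complex.I) := by
    rw [image_add, tmap_sg, hTI, ← ea]
  rw [eab, ea, eb, hvol, hvol, hvol]
  conv_lhs => rw [h1, hvol]
  have := mul_le_mul_of_nonneg_left hu (abs_nonneg (dt a b))
  linarith

lemma zero_mem_sg (a : ℂ) : (0 : ℂ) ∈ sg a := ⟨0, by simp, by simp⟩

lemma subset_add_sg (M : Set ℂ) (a : ℂ) : M ⊆ M + sg a := fun z hz =>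
  ⟨z, hz, 0, zero_mem_sg a, by simp⟩

lemma two_ineq_self (M : Set ℂ) (hM : IsCompact M) (a : ℂ) :
    volume.real (M + sg a + sg a) + volume.real M ≤
      volume.real (M + sg a) + volume.real (M + sg a) := by
  have hMa := hM.add (sg_compact a)
  have hMaa := hMa.add (sg_compact a)
  have h1 := measureReal_sdiff (μ := volume) (subset_add_sg M a) hM.isClosed.measurableSet
    hMa.measure_lt_top.ne
  have h2 := measureReal_sdiff (μ := volume) (subset_add_sg (M + sg a) a)
    hMa.isClosed.measurableSet hMaa.measure_lt_top.ne
  have h3 : volume.real ((M + sg a + sg a) \ (M + sg a)) ≤ volume.real ((M + sg a) \ M) := by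
    have : (M + sg a + sg a) \ (M + sg a) ⊆ a +ᵥ ((M + sg a) \ M) := by
      rintro _ ⟨⟨_, ⟨z, hz, _, ⟨s, hs, rfl⟩, rfl⟩, _, ⟨t, ht, rfl⟩, rfl⟩, hn⟩
      simp only at hn
      refine ⟨z + (s : ℂ) * a + (t : ℂ) * a - a, ⟨?_, ?_⟩, by simp⟩
      · refine ⟨z, hz, _, ⟨s + t - 1, ⟨?_, ?_⟩, rfl⟩, by push_cast; ring⟩
        · by_contra hlt
          push Not at hlt
          refine hn ⟨z, hz, _, ⟨s + t, ⟨by linarith [hs.1, ht.1], by linarith⟩, rfl⟩, ?_⟩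
          push_cast; ring
        · linarith [hs.2, ht.2]
      · intro hz'
        exact hn ⟨_, hz', _, ⟨1, by simp, rfl⟩, by push_cast; ring⟩
    refine (measureReal_mono this ?_).trans_eq ?_
    · rw [measure_vadd]
      exact (measure_mono sdiff_subset).trans_lt hMa.measure_lt_top |>.ne
    · rw [measureReal_def, measure_vadd, measureReal_def]
  linarith

lemma two_ineq (M : Set ℂ) (hM : IsCompact M) (hc : IsConnected M) (a b : ℂ)
    (hab : dt a b ≠ 0 ∨ a = b) :
    volume.real (M + sg a + sg b) + volume.real M ≤
      volume.real (M + sg a) + volume.real (M + sg b) + |dt a b| := by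
  rcases hab with h | rfl
  · exact two_ineq_of_ne M hM hc a b h
  · have := two_ineq_self M hM a
    have := abs_nonneg (dt a a)
    linarith

/-- partial zonogon -/
def zon (v : ℕ → ℂ) (k : ℕ) : Set ℂ := ∑ i ∈ Finset.range k, sg (v i)

lemma zon_succ (v : ℕ → ℂ) (k : ℕ) : zon v (k + 1) = zon v k + sg (v k) :=
  Finset.sum_range_succ _ _

lemma zon_zero (v : ℕ → ℂ) : zon v 0 = 0 := rfl

lemma zon_compact (v : ℕ → ℂ) (k : ℕ) : IsCompact (zon v k) := by
  induction k with
  | zero => exact isCompact_singleton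
  | succ k ih => rw [zon_succ]; exact ih.add (sg_compact _)

lemma zon_conn (v : ℕ → ℂ) (k : ℕ) : IsConnected (zon v k) := by
  induction k with
  | zero => exact isConnected_singleton
  | succ k ih => rw [zon_succ]; exact add_conn ih (sg_conn _)

lemma delta_ineq (v : ℕ → ℂ) (k : ℕ) (a : ℂ) (hv : ∀ j < k, dt a (v j) ≠ 0 ∨ a = v j)
    (M : Set ℂ) (hM : IsCompact M) (hc : IsConnected M) :
    volume.real (M + zon v k + sg a) - volume.real (M + zon v k) ≤
      volume.real (M + sg a) - volume.real M + ∑ j ∈ Finset.range k, |dt a (v j)| := by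
  induction k with
  | zero => simp [zon_zero]
  | succ k ih =>
    have h1 := ih (fun j hj => hv j (by omega))
    have h2 := two_ineq (M + zon v k) (hM.add (zon_compact v k)) (add_conn hc (zon_conn v k)) a (v k)
      (hv k (by omega))
    rw [Finset.sum_range_succ, zon_succ, ← add_assoc, add_right_comm _ (sg (v k)) (sg a)]
    linarith

lemma second_diff (v : ℕ → ℂ) (N : ℕ)
    (hv : ∀ i < N, ∀ j < N, dt (v i) (v j) ≠ 0 ∨ v i = v j)
    (M : Set ℂ) (hM : IsCompact M) (hc : IsConnected M) :
    volume.real (M + zon v N + zon v N) - volume.real (M + zon v N) ≤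
      volume.real (M + zon v N) - volume.real M +
        ∑ i ∈ Finset.range N, ∑ j ∈ Finset.range N, |dt (v i) (v j)| := by
  have key : ∀ k ≤ N, volume.real (M + zon v N + zon v k) - volume.real (M + zon v N) ≤
      volume.real (M + zon v k) - volume.real M +
        ∑ i ∈ Finset.range k, ∑ j ∈ Finset.range N, |dt (v i) (v j)| := by
    intro k hk
    induction k with
    | zero => simp [zon_zero]
    | succ k ih =>
      have h1 := ih (by omega)
      have h2 := delta_ineq v N (v k) (fun j hj => hv k (by omega) j hj) (M + zon v k)
        (hM.add (zon_compact v k)) (add_conn hc (zon_conn v k))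
      rw [Finset.sum_range_succ, zon_succ, ← add_assoc (M + zon v N), ← add_assoc M (zon v k)]
      rw [add_right_comm M (zon v k) (zon v N)] at h2
      linarith
  exact key N le_rfl

lemma concave_seq (G : ℕ → ℝ) (C : ℝ) (h : ∀ k, G (k + 2) - G (k + 1) ≤ G (k + 1) - G k + C)
    (p q : ℕ) (hp : 0 < p) (hpq : p ≤ q) :
    p * (G q - G 0 - C * q ^ 2 / 2) ≤ q * (G p - G 0 - C * p ^ 2 / 2) := by
  have h1 : ∀ m : ℕ, (m : ℝ) * (G (m + 1) - G m - C * m - C / 2) ≤ G m - G 0 - C * m ^ 2 / 2 := by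
    intro m
    induction m with
    | zero => simp
    | succ m ih =>
      have h2 := mul_le_mul_of_nonneg_left (h m) (by positivity : (0 : ℝ) ≤ (m + 1 : ℝ))
      push_cast
      rw [show m + 1 + 1 = m + 2 from rfl]
      nlinarith
  induction q, hpq using Nat.le_induction with
  | base => exact le_rfl
  | succ q hq ih =>
    have hq0 : (0 : ℝ) < q := by exact_mod_cast (by omega : 0 < q)
    have hp0 : (0 : ℝ) < p := by exact_mod_cast hp
    have h2 := h1 q
    set g := G q - G 0 - C * q ^ 2 / 2 with hg
    set g' := G (q + 1) - G 0 - C * ((q + 1 : ℕ) : ℝ) ^ 2 / 2 with hg'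
    set gp := G p - G 0 - C * p ^ 2 / 2
    have h3 : (q : ℝ) * g' ≤ (q + 1) * g := by
      have : g' - g = G (q + 1) - G q - C * q - C / 2 := by
        rw [hg, hg']; push_cast; ring
      rw [← this] at h2
      linarith
    have h4 : (q : ℝ) * (p * g') ≤ q * ((q + 1 : ℕ) * gp) := by
      push_cast
      calc (q : ℝ) * (p * g') = p * (q * g') := by ring
        _ ≤ p * ((q + 1) * g) := by gcongr
        _ = (q + 1) * (p * g) := by ring
        _ ≤ (q + 1) * (q * gp) := by gcongr
        _ = _ := by ring
    exact le_of_mul_le_mul_left h4 hq0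

lemma iter_ball (Z M : Set ℂ) (c : ℂ) (r R : ℝ) (hr : 0 ≤ r) (hR : 0 ≤ R)
    (h1 : closedBall c r ⊆ Z) (h2 : Z ⊆ closedBall c R) (m : ℕ) :
    M + closedBall (m * c) (m * r) ⊆ (fun A => A + Z)^[m] M ∧
      (fun A => A + Z)^[m] M ⊆ M + closedBall (m * c) (m * R) := by
  induction m with
  | zero => simp
  | succ m ih =>
    rw [Function.iterate_succ_apply']
    have e : ∀ s : ℝ, 0 ≤ s → M + closedBall (((m + 1 : ℕ) : ℂ) * c) ((m + 1 : ℕ) * s) =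
        M + closedBall (m * c) (m * s) + closedBall c s := by
      intro s hs
      rw [add_assoc, closedBall_add_closedBall (by positivity) hs]
      push_cast; congr 2 <;> ring
    rw [e r hr, e R hR]
    exact ⟨add_subset_add ih.1 h1, add_subset_add ih.2 h2⟩

lemma iter_compact_conn (Z M : Set ℂ) (hZ : IsCompact Z) (hZ' : IsConnected Z) (hM : IsCompact M)
    (hc : IsConnected M) (m : ℕ) :
    IsCompact ((fun A => A + Z)^[m] M) ∧ IsConnected ((fun A => A + Z)^[m] M) := by
  induction m with
  | zero => exact ⟨hM, hc⟩
  | succ m ih =>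
    rw [Function.iterate_succ_apply']
    exact ⟨ih.1.add hZ, add_conn ih.2 hZ'⟩

/-- The zonogon version of the main inequality. -/
lemma zon_main (v : ℕ → ℂ) (N : ℕ) (hv : ∀ i < N, ∀ j < N, dt (v i) (v j) ≠ 0 ∨ v i = v j)
    (c : ℂ) (r R : ℝ) (hr : 0 ≤ r) (hR : 0 ≤ R)
    (h1 : closedBall c r ⊆ zon v N) (h2 : zon v N ⊆ closedBall c R)
    (M : Set ℂ) (hM : IsCompact M) (hc : IsConnected M) (p q : ℕ) (hp : 0 < p) (hpq : p ≤ q)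
    (C : ℝ) (hC : ∑ i ∈ Finset.range N, ∑ j ∈ Finset.range N, |dt (v i) (v j)| ≤ C) :
    p * (volume.real (cthickening (q * r) M) - volume.real M - C * q ^ 2 / 2) ≤
      q * (volume.real (cthickening (p * R) M) - volume.real M - C * p ^ 2 / 2) := by
  set G : ℕ → ℝ := fun m => volume.real ((fun A => A + zon v N)^[m] M) with hG
  have hcc := iter_compact_conn (zon v N) M (zon_compact v N) (zon_conn v N) hM hc
  have hdiff : ∀ k, G (k + 2) - G (k + 1) ≤ G (k + 1) - G k + C := by
    intro k
    have := second_diff v N hv _ (hcc k).1 (hcc k).2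
    simp only [hG, Function.iterate_succ_apply']
    linarith
  have hcs := concave_seq G C hdiff p q hp hpq
  have hG0 : G 0 = volume.real M := rfl
  have hball : ∀ (x : ℂ) (s : ℝ), 0 ≤ s →
      volume.real (M + closedBall x s) = volume.real (cthickening s M) := by
    intro x s hs
    rw [hM.add_closedBall hs, measureReal_def, measure_vadd, measureReal_def]
  have hq : volume.real (cthickening (q * r) M) ≤ G q := by
    rw [← hball (q * c) _ (by positivity)]
    exact measureReal_mono (iter_ball _ M c r R hr hR h1 h2 q).1 (hcc q).1.measure_lt_top.ne
  have hp' : G p ≤ volume.real (cthickening (p * R) M) := by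
    rw [← hball (p * c) _ (by positivity)]
    exact measureReal_mono (iter_ball _ M c r R hr hR h1 h2 p).2
      (hM.add (isCompact_closedBall _ _)).measure_lt_top.ne
  rw [hG0] at hcs
  have hp0 : (0 : ℝ) ≤ p := by positivity
  have hq0 : (0 : ℝ) ≤ q := by positivity
  have a1 := mul_le_mul_of_nonneg_left hq hp0
  have a2 := mul_le_mul_of_nonneg_left hp' hq0
  linarith

end NagyProof

namespace NagyProof
open scoped Pointwise Topology
open Filter

/-- unit vector at angle `k π / N`. -/
noncomputable def om (N k : ℕ) : ℂ :=
  ⟨Real.cos (k * (Real.pi / N)), Real.sin (k * (Real.pi / N))⟩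

/-- real inner product -/
def ip (w z : ℂ) : ℝ := w.re * z.re + w.im * z.im

lemma integral_abs_cos (θ : ℝ) : ∫ x in (0 : ℝ)..Real.pi, |Real.cos (x - θ)| = 2 := by
  rw [intervalIntegral.integral_comp_sub_right (fun x => |Real.cos x|) θ]
  have hper : Function.Periodic (fun x => |Real.cos x|) Real.pi := by
    intro x; simp [Real.cos_add_pi]
  have h := hper.intervalIntegral_add_eq (0 - θ) (-(Real.pi / 2))
  rw [show 0 - θ + Real.pi = Real.pi - θ by ring,
    show -(Real.pi / 2) + Real.pi = Real.pi / 2 by ring] at h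
  rw [h]
  have : ∫ x in (-(Real.pi / 2))..(Real.pi / 2), |Real.cos x| =
      ∫ x in (-(Real.pi / 2))..(Real.pi / 2), Real.cos x := by
    refine intervalIntegral.integral_congr fun x hx => ?_
    rw [uIcc_of_le (by linarith [Real.pi_pos])] at hx
    exact abs_of_nonneg (Real.cos_nonneg_of_mem_Icc hx)
  rw [this, integral_cos]
  simp; norm_num

lemma abs_cos_lip (x y : ℝ) : |(|Real.cos x| - |Real.cos y|)| ≤ |x - y| :=
  (abs_abs_sub_abs_le_abs_sub _ _).trans (by
    have := Real.abs_cos_sub_cos_le x y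
    exact this)

lemma riemann (N : ℕ) (hN : 0 < N) (θ : ℝ) :
    |∑ k ∈ Finset.range N, |Real.cos (k * (Real.pi / N) - θ)| - 2 * N / Real.pi| ≤ Real.pi := by
  have hN' : (0 : ℝ) < N := by exact_mod_cast hN
  have hpi := Real.pi_pos
  set d := Real.pi / N with hd
  have hd0 : 0 < d := by positivity
  set f : ℝ → ℝ := fun x => |Real.cos (x - θ)| with hf
  have hfc : Continuous f := by fun_prop
  have hint : ∀ a b : ℝ, IntervalIntegrable f volume a b := fun a b => hfc.intervalIntegrable a b
  have hsum : ∑ k ∈ Finset.range N, ∫ x in ((k : ℝ) * d)..(((k + 1 : ℕ) : ℝ) * d), f x = 2 := by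
    rw [intervalIntegral.sum_integral_adjacent_intervals (a := fun k : ℕ => (k : ℝ) * d)
      (fun k _ => hint _ _)]
    have : (N : ℝ) * d = Real.pi := by rw [hd]; field_simp
    simp only [this, Nat.cast_zero, zero_mul]
    exact integral_abs_cos θ
  have hk : ∀ k : ℕ, |(∫ x in ((k : ℝ) * d)..(((k + 1 : ℕ) : ℝ) * d), f x) - d * f (k * d)| ≤
      d * d := by
    intro k
    have e1 : ((k + 1 : ℕ) : ℝ) * d - k * d = d := by push_cast; ring
    have e : d * f (k * d) = ∫ x in ((k : ℝ) * d)..(((k + 1 : ℕ) : ℝ) * d), f (k * d) := by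
      rw [intervalIntegral.integral_const, e1, smul_eq_mul]
    rw [e, ← intervalIntegral.integral_sub (hint _ _) (by simp)]
    have := intervalIntegral.norm_integral_le_of_norm_le_const (C := d)
      (f := fun x => f x - f (k * d)) (a := (k : ℝ) * d) (b := ((k + 1 : ℕ) : ℝ) * d) ?_
    · rw [e1, abs_of_pos hd0] at this
      exact this
    · intro x hx
      rw [uIoc_of_le (by linarith)] at hx
      refine (abs_cos_lip _ _).trans ?_
      rw [show x - θ - (k * d - θ) = x - k * d by ring, abs_of_nonneg (by linarith [hx.1])]
      linarith [hx.2]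
  have h1 : |2 - d * ∑ k ∈ Finset.range N, f (k * d)| ≤ N * (d * d) := by
    rw [← hsum, Finset.mul_sum, ← Finset.sum_sub_distrib]
    refine (Finset.abs_sum_le_sum_abs _ _).trans ((Finset.sum_le_sum fun k _ => hk k).trans ?_)
    simp
  have h2 : ∑ k ∈ Finset.range N, f (k * d) - 2 * N / Real.pi =
      -((2 - d * ∑ k ∈ Finset.range N, f (k * d)) / d) := by
    have h3 : 2 * (N : ℝ) / Real.pi = 2 / d := by rw [hd]; field_simp
    rw [h3]; field_simp; ring_nf
  rw [h2, abs_neg, abs_div, abs_of_pos hd0, div_le_iff₀ hd0]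
  refine h1.trans_eq ?_
  rw [hd]; field_simp

lemma ip_sum (N : ℕ) (hN : 0 < N) (w : ℂ) :
    (2 * N / Real.pi - Real.pi) * ‖w‖ ≤ ∑ k ∈ Finset.range N, |ip w (om N k)| ∧
    ∑ k ∈ Finset.range N, |ip w (om N k)| ≤ (2 * N / Real.pi + Real.pi) * ‖w‖ := by
  have e : ∑ k ∈ Finset.range N, |ip w (om N k)| =
      (∑ k ∈ Finset.range N, |Real.cos (k * (Real.pi / N) - w.arg)|) * ‖w‖ := by
    rw [Finset.sum_mul]
    refine Finset.sum_congr rfl fun k _ => ?_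
    rw [show |Real.cos (k * (Real.pi / N) - w.arg)| * ‖w‖ =
      |Real.cos (k * (Real.pi / N) - w.arg) * ‖w‖| by rw [abs_mul, abs_norm]]
    congr 1
    rw [Real.cos_sub, ip, om]
    simp only
    have h1 := Complex.norm_mul_cos_arg w
    have h2 := Complex.norm_mul_sin_arg w
    calc w.re * Real.cos (k * (Real.pi / N)) + w.im * Real.sin (k * (Real.pi / N))
        = ‖w‖ * Real.cos w.arg * Real.cos (k * (Real.pi / N)) +
          ‖w‖ * Real.sin w.arg * Real.sin (k * (Real.pi / N)) := by rw [h1, h2]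
      _ = _ := by ring
  have h := abs_le.1 (riemann N hN w.arg)
  rw [e]
  constructor
  · exact mul_le_mul_of_nonneg_right (by linarith [h.1]) (norm_nonneg _)
  · exact mul_le_mul_of_nonneg_right (by linarith [h.2]) (norm_nonneg _)

lemma norm_om (N k : ℕ) : ‖om N k‖ = 1 := by
  rw [Complex.norm_def, Complex.normSq_apply, om]
  simp only
  rw [← sq, ← sq, Real.cos_sq_add_sin_sq, Real.sqrt_one]

lemma ip_le (w z : ℂ) : ip w z ≤ ‖w‖ * ‖z‖ := by
  have h := Complex.abs_re_le_norm (w * (starRingEnd ℂ) z)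
  rw [norm_mul, Complex.norm_conj] at h
  have e : (w * (starRingEnd ℂ) z).re = ip w z := by simp [ip]
  rw [e] at h
  exact (le_abs_self _).trans h

lemma ip_self (w : ℂ) : ip w w = ‖w‖ ^ 2 := by
  rw [Complex.sq_norm, Complex.normSq_apply, ip]

lemma ip_sum_right (w : ℂ) (s : Finset ℕ) (f : ℕ → ℂ) :
    ip w (∑ k ∈ s, f k) = ∑ k ∈ s, ip w (f k) := by
  simp [ip, Finset.mul_sum, Finset.sum_add_distrib]

lemma ip_smul (w z : ℂ) (t : ℝ) : ip w (t * z) = t * ip w z := by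
  simp [ip]; ring

lemma ip_sub (w y z : ℂ) : ip w (y - z) = ip w y - ip w z := by
  simp [ip]; ring

/-- sides of the zonogon -/
noncomputable def vec (s : ℝ) (N k : ℕ) : ℂ := (s : ℂ) * om N k

noncomputable def ctr (s : ℝ) (N : ℕ) : ℂ := ∑ k ∈ Finset.range N, ((1 / 2 : ℝ) : ℂ) * vec s N k

lemma zon_upper (s : ℝ) (hs : 0 < s) (N : ℕ) (hN : 0 < N) :
    zon (vec s N) N ⊆ closedBall (ctr s N) (s * (2 * N / Real.pi + Real.pi) / 2) := by
  have hpi := Real.pi_pos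
  intro z hz
  rw [zon, Set.mem_finsetSum] at hz
  obtain ⟨g, hg, rfl⟩ := hz
  have hg' : ∀ k ∈ Finset.range N, ∃ t : ℝ, t ∈ Icc (0 : ℝ) 1 ∧ (t : ℂ) * vec s N k = g k :=
    fun k hk => hg hk
  rw [mem_closedBall, dist_eq_norm]
  set u := ∑ i ∈ Finset.range N, g i - ctr s N with hu
  have h1 : ip u u ≤ (s / 2) * ∑ k ∈ Finset.range N, |ip u (om N k)| := by
    have hu' : ip u u = ∑ k ∈ Finset.range N, ip u (g k - ((1 / 2 : ℝ) : ℂ) * vec s N k) := by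
      rw [← ip_sum_right, Finset.sum_sub_distrib]; rfl
    rw [hu', Finset.mul_sum]
    refine Finset.sum_le_sum fun k hk => ?_
    obtain ⟨t, ht, e⟩ := hg' k hk
    have : g k - ((1 / 2 : ℝ) : ℂ) * vec s N k = (((t - 1 / 2) * s : ℝ) : ℂ) * om N k := by
      rw [← e, vec]; push_cast; ring
    rw [this, ip_smul]
    refine (le_abs_self _).trans ?_
    rw [abs_mul]
    refine mul_le_mul_of_nonneg_right ?_ (abs_nonneg _)
    rw [abs_mul, abs_of_pos hs]
    have : |t - 1 / 2| ≤ 1 / 2 := by rw [abs_le]; constructor <;> linarith [ht.1, ht.2]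
    nlinarith
  have h2 := mul_le_mul_of_nonneg_left (ip_sum N hN u).2 (by positivity : 0 ≤ s / 2)
  rw [ip_self] at h1
  rcases (norm_nonneg u).eq_or_lt with h0 | h0
  · rw [← h0]; positivity
  · refine le_of_mul_le_mul_right ?_ h0
    nlinarith

lemma sg_convex (a : ℂ) : Convex ℝ (sg a) := by
  have : sg a = (LinearMap.toSpanSingleton ℝ ℂ a) '' Icc 0 1 := by
    ext z; simp [sg]
  rw [this]
  exact (convex_Icc 0 1).linear_image _

lemma zon_lower (s : ℝ) (hs : 0 < s) (N : ℕ) (hN : 0 < N) :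
    closedBall (ctr s N) (s * (2 * N / Real.pi - Real.pi) / 2) ⊆ zon (vec s N) N := by
  intro x hx
  by_contra hxn
  have hconv : Convex ℝ (zon (vec s N) N) := convex_sum _ fun i _ => sg_convex _
  obtain ⟨f, u, h1, h2⟩ := geometric_hahn_banach_closed_point hconv
    (zon_compact _ _).isClosed hxn
  set w : ℂ := ⟨f 1, f Complex.I⟩ with hw
  have hf : ∀ z, f z = ip w z := by
    intro z
    have : z = z.re • (1 : ℂ) + z.im • Complex.I := by simp
    conv_lhs => rw [this]
    rw [map_add, map_smul, map_smul, ip]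
    simp [hw]; ring
  let t : ℕ → ℝ := fun k => if 0 ≤ ip w (om N k) then 1 else 0
  have hz : ∑ k ∈ Finset.range N, (t k : ℂ) * vec s N k ∈ zon (vec s N) N := by
    rw [zon, Set.mem_finsetSum]
    refine ⟨fun k => (t k : ℂ) * vec s N k, fun {k} _ => ⟨t k, ?_, rfl⟩, rfl⟩
    simp only [t]; split_ifs <;> simp
  have h3 := h1 _ hz
  rw [hf] at h3
  rw [hf] at h2
  have h4 : ip w (∑ k ∈ Finset.range N, (t k : ℂ) * vec s N k) - ip w (ctr s N) =
      (s / 2) * ∑ k ∈ Finset.range N, |ip w (om N k)| := by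
    rw [ctr, ip_sum_right, ip_sum_right, ← Finset.sum_sub_distrib, Finset.mul_sum]
    refine Finset.sum_congr rfl fun k _ => ?_
    rw [ip_smul, ip_smul, vec, ip_smul]
    simp only [t]
    split_ifs with h
    · rw [abs_of_nonneg h]; ring
    · rw [abs_of_neg (not_le.1 h)]; ring
  have h5 := mul_le_mul_of_nonneg_left (ip_sum N hN w).1 (by positivity : 0 ≤ s / 2)
  have h6 : ip w x - ip w (ctr s N) ≤ ‖w‖ * (s * (2 * N / Real.pi - Real.pi) / 2) := by
    rw [← ip_sub]
    refine (ip_le _ _).trans (mul_le_mul_of_nonneg_left ?_ (norm_nonneg _))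
    rw [← dist_eq_norm]; exact hx
  linarith

lemma dt_vec (s : ℝ) (N j k : ℕ) :
    dt (vec s N j) (vec s N k) = s ^ 2 * ip (Complex.I * om N j) (om N k) := by
  simp [dt, vec, ip]; ring

lemma vec_det_sum (s : ℝ) (N : ℕ) (hN : 0 < N) :
    ∑ i ∈ Finset.range N, ∑ j ∈ Finset.range N, |dt (vec s N i) (vec s N j)| ≤
      s ^ 2 * (N * (2 * N / Real.pi + Real.pi)) := by
  have : ∀ i ∈ Finset.range N, ∑ j ∈ Finset.range N, |dt (vec s N i) (vec s N j)| ≤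
      s ^ 2 * (2 * N / Real.pi + Real.pi) := by
    intro i _
    have h := (ip_sum N hN (Complex.I * om N i)).2
    rw [norm_mul, norm_om, Complex.norm_I, mul_one, mul_one] at h
    simp only [dt_vec, abs_mul]
    rw [← Finset.mul_sum, abs_of_nonneg (sq_nonneg s)]
    exact mul_le_mul_of_nonneg_left h (sq_nonneg s)
  refine (Finset.sum_le_sum this).trans_eq ?_
  simp; ring

lemma vec_ne (s : ℝ) (hs : 0 < s) (N : ℕ) :
    ∀ i < N, ∀ j < N, dt (vec s N i) (vec s N j) ≠ 0 ∨ vec s N i = vec s N j := by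
  intro i hi j hj
  by_cases hij : i = j
  · right; rw [hij]
  left
  have hN' : (0 : ℝ) < N := by exact_mod_cast (by omega : 0 < N)
  have hpi := Real.pi_pos
  have e : dt (vec s N i) (vec s N j) = s ^ 2 * Real.sin (((j : ℝ) - i) * (Real.pi / N)) := by
    rw [sub_mul, Real.sin_sub]
    simp [dt, vec, om]; ring
  rw [e]
  refine mul_ne_zero (by positivity) ?_
  have key : ∀ a b : ℕ, a < b → b < N → 0 < Real.sin (((b : ℝ) - a) * (Real.pi / N)) := by
    intro a b hab hb
    have h1 : (a : ℝ) < b := by exact_mod_cast hab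
    have h2 : (b : ℝ) < N := by exact_mod_cast hb
    have h3 : (0 : ℝ) ≤ a := by positivity
    apply Real.sin_pos_of_pos_of_lt_pi
    · exact mul_pos (by linarith) (by positivity)
    · calc ((b : ℝ) - a) * (Real.pi / N) < N * (Real.pi / N) := by
            apply mul_lt_mul_of_pos_right (by linarith) (by positivity)
        _ = Real.pi := by field_simp
  rcases lt_or_gt_of_ne hij with h | h
  · exact (key i j h hj).ne'
  · have := key j i h hi
    rw [show ((j : ℝ) - i) * (Real.pi / N) = -(((i : ℝ) - j) * (Real.pi / N)) by ring, Real.sin_neg]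
    linarith

lemma cplx_step (M : Set ℂ) (hM : IsCompact M) (hc : IsConnected M) (ε δ : ℝ) (hε : 0 < ε)
    (hεδ : ε < δ) (N : ℕ) (hN : 0 < 2 / Real.pi - Real.pi / N) (hN0 : 0 < N) :
    volume.real (cthickening δ M) - volume.real M -
        2 * (2 / Real.pi + Real.pi / N) / (2 / Real.pi - Real.pi / N) ^ 2 *
          (⌈δ / ε * N⌉₊ / N * ε) ^ 2 ≤
      (⌈δ / ε * N⌉₊ / N) * (volume.real (cthickening
        (ε + ε * ((2 / Real.pi + Real.pi / N) / (2 / Real.pi - Real.pi / N) - 1)) M) -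
        volume.real M -
        2 * (2 / Real.pi + Real.pi / N) / (2 / Real.pi - Real.pi / N) ^ 2 * ε ^ 2) := by
  have hpi := Real.pi_pos
  have hN' : (0 : ℝ) < N := by exact_mod_cast hN0
  set α := 2 / Real.pi - Real.pi / N with hα
  set β := 2 / Real.pi + Real.pi / N with hβ
  have hβ0 : 0 < β := by positivity
  have eA : 2 * N / Real.pi - Real.pi = N * α := by rw [hα]; field_simp
  have eB : 2 * N / Real.pi + Real.pi = N * β := by rw [hβ]; field_simp
  set q := ⌈δ / ε * N⌉₊ with hq
  have hqle : δ / ε * N ≤ q := Nat.le_ceil _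
  have hNq : N ≤ q := by
    have h1 : (1 : ℝ) ≤ δ / ε := by rw [le_div_iff₀ hε]; linarith
    have : (N : ℝ) ≤ q := by nlinarith
    exact_mod_cast this
  set h := ε / N with hh
  have hh0 : 0 < h := by positivity
  set s := 2 * h / (N * α) with hs
  have hs0 : 0 < s := by positivity
  have er : s * (2 * N / Real.pi - Real.pi) / 2 = h := by rw [eA, hs]; field_simp
  have eR : s * (2 * N / Real.pi + Real.pi) / 2 = h * (β / α) := by rw [eB, hs]; field_simp
  have hl := zon_lower s hs0 N hN0
  have hu := zon_upper s hs0 N hN0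
  rw [er] at hl
  rw [eR] at hu
  have hm := zon_main (vec s N) N (vec_ne s hs0 N) (ctr s N) h (h * (β / α)) hh0.le (by positivity)
    hl hu M hM hc N q hN0 hNq _ (vec_det_sum s N hN0)
  have eC : s ^ 2 * (N * (2 * N / Real.pi + Real.pi)) = 4 * β / α ^ 2 * h ^ 2 := by
    rw [eB, hs]; field_simp; ring
  rw [eC] at hm
  have e1 : (N : ℝ) * (h * (β / α)) = ε + ε * (β / α - 1) := by rw [hh]; field_simp; ring
  rw [e1] at hm
  have h7 : δ ≤ q * h := by
    rw [hh]
    calc δ = δ / ε * N * (ε / N) := by field_simp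
      _ ≤ q * (ε / N) := by gcongr
  have h8 : volume.real (cthickening δ M) ≤ volume.real (cthickening (q * h) M) :=
    measureReal_mono (cthickening_mono h7 M) hM.isBounded.cthickening.measure_lt_top.ne
  set X := volume.real (cthickening (ε + ε * (β / α - 1)) M)
  have h9 : volume.real (cthickening (q * h) M) - volume.real M -
      4 * β / α ^ 2 * h ^ 2 * q ^ 2 / 2 ≤
      (q / N) * (X - volume.real M - 4 * β / α ^ 2 * h ^ 2 * N ^ 2 / 2) := by
    rw [div_mul_eq_mul_div (q : ℝ) (N : ℝ), le_div_iff₀ hN']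
    linarith
  have e2 : 4 * β / α ^ 2 * h ^ 2 * q ^ 2 / 2 = 2 * β / α ^ 2 * (q / N * ε) ^ 2 := by
    rw [hh]; field_simp; ring
  have e3 : 4 * β / α ^ 2 * h ^ 2 * N ^ 2 / 2 = 2 * β / α ^ 2 * ε ^ 2 := by
    rw [hh]; field_simp; ring
  rw [e2, e3] at h9
  linarith

lemma cplx_main (M : Set ℂ) (hM : IsCompact M) (hc : IsConnected M) (ε δ : ℝ) (hε : 0 < ε)
    (hεδ : ε < δ) :
    volume.real (cthickening δ M) - volume.real M - Real.pi * δ ^ 2 ≤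
      (δ / ε) * (volume.real (cthickening ε M) - volume.real M - Real.pi * ε ^ 2) := by
  have hpi := Real.pi_pos
  have t0 : Tendsto (fun N : ℕ => Real.pi / (N : ℝ)) atTop (𝓝 0) :=
    tendsto_const_div_atTop_nhds_zero_nat _
  have tα : Tendsto (fun N : ℕ => 2 / Real.pi - Real.pi / (N : ℝ)) atTop (𝓝 (2 / Real.pi)) := by
    simpa using t0.const_sub (2 / Real.pi)
  have tβ : Tendsto (fun N : ℕ => 2 / Real.pi + Real.pi / (N : ℝ)) atTop (𝓝 (2 / Real.pi)) := by
    simpa using t0.const_add (2 / Real.pi)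
  have hne : 2 / Real.pi ≠ 0 := by positivity
  have tq : Tendsto (fun N : ℕ => (⌈δ / ε * N⌉₊ : ℝ) / N) atTop (𝓝 (δ / ε)) :=
    (tendsto_nat_ceil_mul_div_atTop (div_pos (hε.trans hεδ) hε).le).comp tendsto_natCast_atTop_atTop
  have tκ : Tendsto (fun N : ℕ => 2 * (2 / Real.pi + Real.pi / (N : ℝ)) /
      (2 / Real.pi - Real.pi / N) ^ 2) atTop (𝓝 Real.pi) := by
    have := (tβ.const_mul 2).div (tα.pow 2) (pow_ne_zero 2 hne)
    have e : 2 * (2 / Real.pi) / (2 / Real.pi) ^ 2 = Real.pi := by field_simp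
    rw [e] at this
    exact this
  have tr : Tendsto (fun N : ℕ => ε * ((2 / Real.pi + Real.pi / (N : ℝ)) /
      (2 / Real.pi - Real.pi / N) - 1)) atTop (𝓝 0) := by
    have := ((tβ.div tα hne).sub_const 1).const_mul ε
    simpa [hne] using this
  have tX : Tendsto (fun N : ℕ => volume.real (cthickening (ε + ε * ((2 / Real.pi +
      Real.pi / (N : ℝ)) / (2 / Real.pi - Real.pi / N) - 1)) M)) atTop
      (𝓝 (volume.real (cthickening ε M))) := by
    have h1 := (tendsto_real_cthickening (hM.cthickening (r := ε))).comp tr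
    refine h1.congr' ?_
    filter_upwards [tα.eventually (lt_mem_nhds (by positivity : 0 < 2 / Real.pi))] with N hN
    have : 0 ≤ ε * ((2 / Real.pi + Real.pi / (N : ℝ)) / (2 / Real.pi - Real.pi / N) - 1) := by
      refine mul_nonneg hε.le ?_
      rw [sub_nonneg, le_div_iff₀ hN]
      have : 0 ≤ Real.pi / (N : ℝ) := by positivity
      linarith
    simp only [Function.comp]
    rw [cthickening_cthickening this hε.le, add_comm]
  have tL := (tκ.mul ((tq.mul_const ε).pow 2)).const_sub
    (volume.real (cthickening δ M) - volume.real M)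
  have tR := tq.mul ((tX.sub_const (volume.real M)).sub (tκ.mul_const (ε ^ 2)))
  have e : δ / ε * ε = δ := by field_simp
  rw [e] at tL
  refine le_of_tendsto_of_tendsto tL tR ?_
  filter_upwards [tα.eventually (lt_mem_nhds (by positivity : 0 < 2 / Real.pi)),
    eventually_gt_atTop 0] with N hN hN0
  exact cplx_step M hM hc ε δ hε hεδ N hN hN0

end NagyProof


/-- For a nonempty compact connected `K ⊆ ℝ²` and `0 < ε < δ`,
`L(K^δ \ K)/δ − πδ ≤ L(K^ε \ K)/ε − πε`. -/
theorem stmt_5 (K : Set Plane) (hK : IsCompact K) (hKconn : IsConnected K)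
    (ε δ : ℝ) (hε : 0 < ε) (hεδ : ε < δ) :
    (volume (cthickening δ K \ K)).toReal / δ - Real.pi * δ ≤
      (volume (cthickening ε K \ K)).toReal / ε - Real.pi * ε := by
  have hδ : 0 < δ := hε.trans hεδ
  let φ : ℂ ≃ₗᵢ[ℝ] Plane := Complex.orthonormalBasisOneI.repr
  have hmp : MeasurePreserving φ volume volume := φ.measurePreserving
  set M : Set ℂ := φ ⁻¹' K with hMdef
  have hMim : M = φ.symm '' K := by
    rw [hMdef]; exact (φ.toEquiv.image_symm_eq_preimage K).symm
  have hM : IsCompact M := by rw [hMim]; exact hK.image φ.symm.continuous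
  have hc : IsConnected M := by
    rw [hMim]; exact hKconn.image _ φ.symm.continuous.continuousOn
  have hcth : ∀ r : ℝ, φ ⁻¹' (cthickening r K) = cthickening r M := by
    intro r
    have hK' : K = φ '' M := (Set.image_preimage_eq K φ.surjective).symm
    ext z
    rw [mem_preimage, mem_cthickening_iff, mem_cthickening_iff, hK',
      Metric.infEDist_image φ.isometry]
  have hvol : ∀ r : ℝ, 0 ≤ r → (volume (cthickening r K \ K)).toReal =
      volume.real (cthickening r M) - volume.real M := by
    intro r hr
    rw [← hmp.measure_preimage ((isClosed_cthickening.measurableSet.diff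
      hK.isClosed.measurableSet).nullMeasurableSet), preimage_sdiff, hcth, ← measureReal_def]
    exact measureReal_sdiff (self_subset_cthickening M) hM.isClosed.measurableSet
      hM.isBounded.cthickening.measure_lt_top.ne
  have h := NagyProof.cplx_main M hM hc ε δ hε hεδ
  rw [hvol δ hδ.le, hvol ε hε.le]
  set A := volume.real (cthickening δ M) - volume.real M
  set B := volume.real (cthickening ε M) - volume.real M
  have e1 : A / δ - Real.pi * δ = (A - Real.pi * δ ^ 2) / δ := by field_simp
  have e2 : B / ε - Real.pi * ε = (δ / ε * (B - Real.pi * ε ^ 2)) / δ := by field_simp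
  rw [e1, e2]
  gcongr
end

section
/- Let K be a compact connected subset of ℝ² with finite outer Minkowski content. Then SM¹(K) ≥ liminf_{ε→0⁺} H¹({x : dist(x,K) = ε}), where H¹ is one-dimensional Hausdorff measure. -/
open Metric MeasureTheory Set Filter Topology ENNReal

/-- The outer Minkowski content `SM¹(K) = lim_{ε→0⁺} L(K^ε \ K)/ε`
(the limit exists in `[0,∞]` for continua, so it coincides with the `limsup`). -/
noncomputable def SM1 (K : Set Plane) : ℝ≥0∞ :=
  limsup (fun ε : ℝ => volume (cthickening ε K \ K) / ENNReal.ofReal ε) (𝓝[>] (0 : ℝ))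

theorem psi_mp (b : OrthonormalBasis (Fin 2) ℝ Plane) :
    MeasurePreserving (fun q : ℝ × ℝ => q.1 • b 0 + q.2 • b 1) volume volume := by
  have h1 := (volume_preserving_finTwoArrow ℝ).symm
  have h2 := (PiLp.volume_preserving_toLp (Fin 2))
  have h3 := b.measurePreserving_repr_symm
  have := h3.comp (h2.comp h1)
  convert this using 1
  ext1 q
  simp [← OrthonormalBasis.sum_repr_symm, Fin.sum_univ_two]

theorem strip_lemma (b : OrthonormalBasis (Fin 2) ℝ Plane) (A T : Set Plane) (hA : IsCompact A)
    (hT : MeasurableSet T) (h : ℝ)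
    (hs : ∀ x ∈ A, ∀ s, 0 < s → s ≤ h → x - s • b 0 ∈ T) :
    ENNReal.ofReal h * volume ((fun x => b.repr x 1) '' A) ≤ volume T := by
  have hp := psi_mp b
  rw [← hp.measure_preimage hT.nullMeasurableSet, Measure.volume_eq_prod,
    Measure.prod_apply_symm (hp.measurable hT)]
  have hmeas : MeasurableSet ((fun x => b.repr x 1) '' A) :=
    (hA.image (by fun_prop)).measurableSet
  calc _ = ∫⁻ v in (fun x => b.repr x 1) '' A, ENNReal.ofReal h := by
        rw [setLIntegral_const]
    _ ≤ ∫⁻ v in (fun x => b.repr x 1) '' A, volume ((fun x => (x, v)) ⁻¹' ((fun q : ℝ × ℝ => q.1 • b 0 + q.2 • b 1) ⁻¹' T)) := by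
        apply setLIntegral_mono' hmeas
        rintro v ⟨x, hx, rfl⟩
        have : Ico (b.repr x 0 - h) (b.repr x 0) ⊆ ((fun u => (u, b.repr x 1)) ⁻¹' ((fun q : ℝ × ℝ => q.1 • b 0 + q.2 • b 1) ⁻¹' T)) := by
          intro u hu
          have h1 := hs x hx (b.repr x 0 - u) (by linarith [hu.2]) (by linarith [hu.1])
          have h2 : x - (b.repr x 0 - u) • b 0 = u • b 0 + b.repr x 1 • b 1 := by
            have h3 := b.sum_repr x
            rw [Fin.sum_univ_two] at h3
            nth_rewrite 1 [← h3]
            module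
          rw [h2] at h1
          exact h1
        refine le_trans ?_ (measure_mono this)
        simp
    _ ≤ _ := setLIntegral_le_lintegral _ _

theorem haus_lemma (b : OrthonormalBasis (Fin 2) ℝ Plane) (A : Set Plane) (κ : NNReal) (η : ℝ)
    (hη : 0 ≤ η) (hκ : 1 ≤ κ ^ 2 * (1 - η ^ 2))
    (hs : ∀ x ∈ A, ∀ y ∈ A, |inner ℝ (b 0) (x - y)| ≤ η * ‖x - y‖) :
    μH[1] A ≤ κ * volume ((fun x => b.repr x 1) '' A) := by
  have key : ∀ x ∈ A, ∀ y ∈ A, dist x y ≤ κ * dist (b.repr x 1) (b.repr y 1) := by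
    intro x hx y hy
    have h1 := hs x hx y hy
    have h2 : ‖x - y‖ ^ 2 = (inner ℝ (b 0) (x - y)) ^ 2 + (b.repr x 1 - b.repr y 1) ^ 2 := by
      rw [← b.sum_sq_norm_inner_right (x - y), Fin.sum_univ_two]
      simp [b.repr_apply_apply, inner_sub_right]
    rw [dist_eq_norm, Real.dist_eq]
    have h3 : (inner ℝ (b 0) (x - y)) ^ 2 ≤ η ^ 2 * ‖x - y‖ ^ 2 := by
      rw [← mul_pow, ← sq_abs]
      exact pow_le_pow_left₀ (abs_nonneg _) h1 2
    have h4 : (1 - η ^ 2) * ‖x - y‖ ^ 2 ≤ (b.repr x 1 - b.repr y 1) ^ 2 := by linarith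
    have h5 : ‖x - y‖ ^ 2 ≤ κ ^ 2 * (b.repr x 1 - b.repr y 1) ^ 2 := by
      calc ‖x - y‖ ^ 2 ≤ (κ ^ 2 * (1 - η ^ 2)) * ‖x - y‖ ^ 2 :=
            le_mul_of_one_le_left (sq_nonneg _) hκ
        _ = κ ^ 2 * ((1 - η ^ 2) * ‖x - y‖ ^ 2) := by ring
        _ ≤ _ := by gcongr
    refine abs_le_of_sq_le_sq' ?_ (by positivity) |>.2
    rw [mul_pow, sq_abs]
    exact h5
  have hanti : AntilipschitzWith κ (fun x : A => b.repr x.1 1) :=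
    AntilipschitzWith.of_le_mul_dist fun x y => key x x.2 y y.2
  have h := hanti.le_hausdorffMeasure_image (d := 1) zero_le_one univ
  rw [hausdorffMeasure_real] at h
  have e1 : μH[1] A = μH[1] (univ : Set A) := by
    have := (isometry_subtype_coe (s := A)).hausdorffMeasure_image (d := 1) (Or.inl zero_le_one) univ
    rw [← this]; simp
  rw [e1]
  refine h.trans (le_of_eq ?_)
  congr 1
  · simp
  · congr 1; ext; simp

theorem exists_basis (e : Plane) (he : ‖e‖ = 1) :
    ∃ b : OrthonormalBasis (Fin 2) ℝ Plane, b 0 = e := by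
  have h : Orthonormal ℝ (({0} : Set (Fin 2)).domRestrict (fun _ : Fin 2 => e)) := by
    constructor
    · intro i; simpa using he
    · intro i j hij
      exact absurd (Subsingleton.elim i j) hij
  obtain ⟨b, hb⟩ := h.exists_orthonormalBasis_extension_of_card_eq (by simp)
  exact ⟨b, hb 0 rfl⟩

/-- The exterior ball condition. -/
theorem ball_cond (K : Set Plane) (t : ℝ) (ht : 0 < t) (x x' y : Plane) (hy : y ∈ K)
    (hxy : dist x y = t) (hx' : infDist x' K = t) :
    -(‖x' - x‖ ^ 2) ≤ 2 * inner ℝ (x - y) (x' - x) := by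
  have h1 : t ≤ ‖x' - y‖ := by
    rw [← dist_eq_norm, ← hx']; exact infDist_le_dist_of_mem hy
  have h2 : ‖x' - y‖ ^ 2 = ‖x - y‖ ^ 2 + 2 * inner ℝ (x - y) (x' - x) + ‖x' - x‖ ^ 2 := by
    rw [← norm_add_sq_real]; congr 2; abel
  rw [dist_eq_norm] at hxy
  rw [hxy] at h2
  nlinarith

theorem local_lemma (K : Set Plane) (hK : IsCompact K) (hne : K.Nonempty) (t : ℝ) (ht : 0 < t)
    (c : NNReal) (hc : (c : ℝ≥0∞) < μH[1] {x : Plane | infDist x K = t}) :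
    ∃ h, 0 < h ∧ h < t ∧
      c * ENNReal.ofReal h ≤ volume {x : Plane | t - h ≤ infDist x K ∧ infDist x K < t} := by
  -- constants
  obtain ⟨κ, hκc, hκ1⟩ : ∃ κ : NNReal, ((κ * c : NNReal) : ℝ≥0∞) < μH[1] {x : Plane | infDist x K = t}
      ∧ 1 < κ := by
    have h1 : Tendsto (fun κ : NNReal => ((κ * c : NNReal) : ℝ≥0∞)) (𝓝[>] 1)
        (𝓝 (((1 * c : NNReal)) : ℝ≥0∞)) := by
      apply tendsto_nhdsWithin_of_tendsto_nhds
      apply Continuous.tendsto (f := fun κ : NNReal => ((κ * c : NNReal) : ℝ≥0∞))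
      fun_prop
    rw [one_mul] at h1
    exact ((h1.eventually_lt_const hc).and self_mem_nhdsWithin).exists
  obtain ⟨η, hηκ, hη1, hη0⟩ : ∃ η : ℝ, 1 < (κ : ℝ) ^ 2 * (1 - η ^ 2) ∧ η < 1 ∧ 0 < η := by
    have h1 : Tendsto (fun η : ℝ => (κ : ℝ) ^ 2 * (1 - η ^ 2)) (𝓝[>] 0)
        (𝓝 ((κ : ℝ) ^ 2 * (1 - 0 ^ 2))) := by
      apply tendsto_nhdsWithin_of_tendsto_nhds
      apply Continuous.tendsto (f := fun η : ℝ => (κ : ℝ) ^ 2 * (1 - η ^ 2))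
      fun_prop
    have h2 : (1 : ℝ) < (κ : ℝ) ^ 2 * (1 - 0 ^ 2) := by
      have : (1 : ℝ) < κ := by exact_mod_cast hκ1
      nlinarith
    have h3 : ∀ᶠ η : ℝ in 𝓝[>] 0, η < 1 :=
      mem_nhdsWithin_of_mem_nhds (Iio_mem_nhds zero_lt_one)
    exact ((h1.eventually_const_lt h2).and (h3.and self_mem_nhdsWithin)).exists
  set L : Set Plane := {x : Plane | infDist x K = t} with hL
  have hdc : Continuous (fun x : Plane => infDist x K) := continuous_infDist_pt K
  have hLclosed : IsClosed L := isClosed_singleton.preimage hdc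
  have hLcomp : IsCompact L := by
    refine hK.cthickening (r := t) |>.of_isClosed_subset hLclosed ?_
    intro x hx
    obtain ⟨y, hy, hxy⟩ := hK.exists_infDist_eq_dist hne x
    exact mem_cthickening_of_dist_le x y t K hy (by rw [← hxy]; exact le_of_eq hx)
  set P : Set (Plane × Plane) := (L ×ˢ K) ∩ {p | dist p.1 p.2 = t} with hP
  have hPcomp : IsCompact P :=
    (hLcomp.prod hK).inter_right (isClosed_eq (by fun_prop) (by fun_prop))
  set r := η * t / 3 with hr
  have hr0 : 0 < r := by positivity
  obtain ⟨F, hFP, hFfin, hFcov⟩ := hPcomp.finite_cover_balls hr0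
  obtain ⟨n, f, hfF⟩ : ∃ (n : ℕ) (f : Fin n → Plane × Plane), range f = F := by
    obtain ⟨n, f, hf⟩ := hFfin.fin_embedding
    exact ⟨n, f, hf⟩
  let A : Fin n → Set Plane := fun i => Prod.fst '' (P ∩ closedBall (f i) r)
  have hAcomp : ∀ i, IsCompact (A i) := fun i =>
    (hPcomp.inter_right isClosed_closedBall).image continuous_fst
  have hAcov : L ⊆ ⋃ i, A i := by
    intro x hx
    obtain ⟨y, hy, hxy⟩ := hK.exists_infDist_eq_dist hne x
    have hp : (x, y) ∈ P := ⟨⟨hx, hy⟩, by rw [mem_setOf_eq, ← hxy]; exact hx⟩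
    have := hFcov hp
    simp only [mem_iUnion] at this
    obtain ⟨q, hq, hq2⟩ := this
    rw [← hfF] at hq
    obtain ⟨i, rfl⟩ := hq
    exact mem_iUnion.2 ⟨i, (x, y), ⟨hp, ball_subset_closedBall hq2⟩, rfl⟩
  have hfP : ∀ i, f i ∈ P := fun i => hFP (hfF ▸ mem_range_self i)
  -- unit vectors
  let e : Fin n → Plane := fun i => t⁻¹ • ((f i).1 - (f i).2)
  have he : ∀ i, ‖e i‖ = 1 := by
    intro i
    have := (hfP i).2
    simp only [mem_setOf_eq, dist_eq_norm] at this
    simp only [e, norm_smul, this, norm_inv, Real.norm_eq_abs, abs_of_pos ht]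
    field_simp
  have hAdata : ∀ i, ∀ x ∈ A i, infDist x K = t ∧ dist x (f i).1 ≤ r ∧
      ∃ y ∈ K, dist x y = t ∧ ‖(x - y) - t • e i‖ ≤ 2 * r := by
    rintro i x ⟨⟨x', y⟩, ⟨hp, hb⟩, rfl⟩
    rw [mem_closedBall, Prod.dist_eq, max_le_iff] at hb
    refine ⟨hp.1.1, hb.1, y, hp.1.2, hp.2, ?_⟩
    have h1 : (x' - y) - t • e i = (x' - (f i).1) - (y - (f i).2) := by
      simp only [e, smul_smul, mul_inv_cancel₀ ht.ne', one_smul]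
      abel
    rw [h1]
    refine (norm_sub_le _ _).trans ?_
    rw [← dist_eq_norm, ← dist_eq_norm]
    linarith [hb.1, hb.2]
  choose b hb using fun i => exists_basis (e i) (he i)
  -- half cone estimate
  have hhalf : ∀ i, ∀ x ∈ A i, ∀ x' ∈ A i, -(η * ‖x' - x‖) ≤ inner ℝ (e i) (x' - x) := by
    intro i x hx x' hx'
    obtain ⟨-, hx2, y, hy, hxy, hn⟩ := hAdata i x hx
    obtain ⟨hx1', hx2', -⟩ := hAdata i x' hx'
    have h1 := ball_cond K t ht x x' y hy hxy hx1'
    have h2 : ‖x' - x‖ ≤ 2 * r := by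
      rw [← dist_eq_norm]
      linarith [dist_triangle_right x' x (f i).1]
    have h3 := (abs_le.1 (abs_real_inner_le_norm ((x - y) - t • e i) (x' - x))).2
    rw [inner_sub_left, real_inner_smul_left] at h3
    have h4 : ‖(x - y) - t • e i‖ * ‖x' - x‖ ≤ 2 * r * ‖x' - x‖ := by gcongr
    have h5 : ‖x' - x‖ ^ 2 ≤ 2 * r * ‖x' - x‖ := by rw [sq]; gcongr
    have h6 : t * (-(η * ‖x' - x‖)) ≤ t * inner ℝ (e i) (x' - x) := by
      have : t * (-(η * ‖x' - x‖)) = -(3 * r * ‖x' - x‖) := by rw [hr]; ring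
      rw [this]
      linarith
    exact le_of_mul_le_mul_left h6 ht
  have hcone : ∀ i, ∀ x ∈ A i, ∀ y ∈ A i, |inner ℝ (b i 0) (x - y)| ≤ η * ‖x - y‖ := by
    intro i x hx y hy
    rw [hb, abs_le]
    refine ⟨hhalf i y hy x hx, ?_⟩
    have := hhalf i x hx y hy
    rw [← neg_sub x y, inner_neg_right, norm_neg] at this
    linarith
  have hHaus : ∀ i, ∀ C ⊆ A i, μH[1] C ≤ κ * volume ((fun x => (b i).repr x 1) '' C) :=
    fun i C hC => haus_lemma (b i) C κ η hη0.le hηκ.le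
      fun x hx y hy => hcone i x (hC hx) y (hC hy)
  have hAfin : ∀ i, μH[1] (A i) < ⊤ := fun i =>
    (hHaus i (A i) subset_rfl).trans_lt
      (ENNReal.mul_lt_top coe_lt_top ((hAcomp i).image (by fun_prop)).measure_lt_top)
  -- disjointification
  have hDm : ∀ i, MeasurableSet (disjointed A i) := by
    intro i
    rw [disjointed_apply]
    refine (hAcomp i).measurableSet.diff ?_
    rw [Finset.sup_eq_iSup]
    exact Finset.measurableSet_biUnion _ fun j _ => (hAcomp j).measurableSet
  have hDA : ∀ i, disjointed A i ⊆ A i := fun i => disjointed_le A i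
  obtain ⟨ε0, hε0, hε⟩ := ENNReal.lt_iff_exists_add_pos_lt.1 hκc
  have hCex : ∀ i, ∃ C ⊆ disjointed A i, IsCompact C ∧
      μH[1] (disjointed A i) ≤ μH[1] C + (ε0 / n : NNReal) := by
    intro i
    have hn : (n : NNReal) ≠ 0 := by
      have := i.pos
      exact_mod_cast this.ne'
    haveI : IsFiniteMeasure ((μH[1] : Measure Plane).restrict (A i)) :=
      ⟨by simpa using hAfin i⟩
    have hpos : ((ε0 / n : NNReal) : ℝ≥0∞) ≠ 0 := by
      simpa using ⟨hε0.ne', by exact_mod_cast hn⟩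
    obtain ⟨C, hC, hCc, hlt⟩ := (hDm i).exists_isCompact_lt_add
      (μ := (μH[1] : Measure Plane).restrict (A i)) (measure_ne_top _ _) hpos
    refine ⟨C, hC, hCc, ?_⟩
    rw [Measure.restrict_apply (hDm i), Measure.restrict_apply hCc.measurableSet,
      inter_eq_left.2 (hDA i), inter_eq_left.2 (hC.trans (hDA i))] at hlt
    exact hlt.le
  choose C hCD hCcomp hCle using hCex
  have hsum : ((κ * c : NNReal) : ℝ≥0∞) ≤ ∑ i, μH[1] (C i) := by
    have h1 : μH[1] L ≤ ∑ i, μH[1] (C i) + ε0 := by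
      calc μH[1] L ≤ μH[1] (⋃ i, disjointed A i) := by
            rw [iUnion_disjointed]; exact measure_mono hAcov
        _ ≤ ∑ i, μH[1] (disjointed A i) := measure_iUnion_fintype_le _ _
        _ ≤ ∑ i, (μH[1] (C i) + (ε0 / n : NNReal)) := Finset.sum_le_sum fun i _ => hCle i
        _ = ∑ i, μH[1] (C i) + ((n * (ε0 / n) : NNReal) : ℝ≥0∞) := by
            rw [Finset.sum_add_distrib]; simp
        _ ≤ _ := by
            gcongr
            rcases eq_or_ne (n : NNReal) 0 with h0 | h0
            · simp [h0]
            · rw [mul_div_cancel₀ _ h0]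
    have h2 := hε.trans_le h1
    exact (ENNReal.add_lt_add_iff_right coe_ne_top).1 h2 |>.le
  have hproj : (c : ℝ≥0∞) ≤ ∑ i, volume ((fun x => (b i).repr x 1) '' C i) := by
    have h1 : (κ : ℝ≥0∞) * c ≤ κ * ∑ i, volume ((fun x => (b i).repr x 1) '' C i) := by
      rw [← coe_mul, Finset.mul_sum]
      exact hsum.trans (Finset.sum_le_sum fun i _ => hHaus i _ ((hCD i).trans (hDA i)))
    have hk : (κ : ℝ≥0∞) ≠ 0 := by
      have := (zero_lt_one.trans hκ1).ne'
      exact_mod_cast this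
    exact (ENNReal.mul_le_mul_iff_right hk coe_ne_top).1 h1
  -- choose h
  obtain ⟨h, hdis, hht, hh0⟩ : ∃ h : ℝ, (∀ i j, i ≠ j →
      Disjoint (cthickening h (C i)) (cthickening h (C j))) ∧ h < t ∧ 0 < h := by
    have h1 : ∀ᶠ h : ℝ in 𝓝[>] 0, ∀ i j, i ≠ j →
        Disjoint (cthickening h (C i)) (cthickening h (C j)) := by
      simp only [eventually_all]
      intro i j hij
      have hd : Disjoint (C i) (C j) := (disjoint_disjointed A hij).mono (hCD i) (hCD j)
      obtain ⟨δ, hδ, hd⟩ := hd.exists_cthickenings (hCcomp i) (hCcomp j).isClosed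
      filter_upwards [mem_nhdsWithin_of_mem_nhds (Iio_mem_nhds hδ)] with h hh
      exact hd.mono (cthickening_mono (le_of_lt hh) _) (cthickening_mono (le_of_lt hh) _)
    have h3 : ∀ᶠ h : ℝ in 𝓝[>] 0, h < t := mem_nhdsWithin_of_mem_nhds (Iio_mem_nhds ht)
    exact (h1.and (h3.and self_mem_nhdsWithin)).exists
  refine ⟨h, hh0, hht, ?_⟩
  set U : Set Plane := {x : Plane | t - h ≤ infDist x K ∧ infDist x K < t} with hU
  have hUm : MeasurableSet U :=
    (measurableSet_le measurable_const hdc.measurable).inter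
      (measurableSet_lt hdc.measurable measurable_const)
  have hTm : ∀ i, MeasurableSet (U ∩ cthickening h (C i)) := fun i =>
    hUm.inter isClosed_cthickening.measurableSet
  have hstrip : ∀ i, ENNReal.ofReal h * volume ((fun x => (b i).repr x 1) '' C i) ≤
      volume (U ∩ cthickening h (C i)) := by
    intro i
    refine strip_lemma (b i) (C i) _ (hCcomp i) (hTm i) h ?_
    intro x hx s hs hsh
    rw [hb]
    obtain ⟨hxt, -, y, hy, hxy, hn⟩ := hAdata i x (hDA i (hCD i hx))
    have hd : dist (x - s • e i) x = s := by
      rw [dist_eq_norm]; simp [norm_smul, he, abs_of_pos hs]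
    refine ⟨⟨?_, ?_⟩, mem_cthickening_of_dist_le _ x h _ hx (hd.trans_le hsh)⟩
    · have := infDist_le_infDist_add_dist (s := K) (x := x) (y := x - s • e i)
      rw [dist_comm, hd, hxt] at this
      linarith
    · refine (infDist_le_dist_of_mem hy).trans_lt ?_
      rw [dist_eq_norm] at hxy ⊢
      have h1 : x - s • e i - y = (1 - s / t) • (x - y) + (s / t) • ((x - y) - t • e i) := by
        have : (s / t) * t = s := by field_simp
        generalize e i = w
        have h2 : s • w = (s / t) • (t • w) := by rw [smul_smul, this]
        rw [h2]
        module
      rw [h1]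
      refine (norm_add_le _ _).trans_lt ?_
      have hst : s / t ≤ 1 := by rw [div_le_one ht]; linarith
      have hst0 : 0 < s / t := by positivity
      rw [norm_smul, norm_smul, hxy, Real.norm_eq_abs, Real.norm_eq_abs, abs_of_pos hst0,
        abs_of_nonneg (by linarith)]
      have h2 : s / t * ‖(x - y) - t • e i‖ < s / t * t := by
        apply mul_lt_mul_of_pos_left _ hst0
        refine hn.trans_lt ?_
        rw [hr]
        nlinarith
      linarith
  calc (c : ℝ≥0∞) * ENNReal.ofReal h
      ≤ (∑ i, volume ((fun x => (b i).repr x 1) '' C i)) * ENNReal.ofReal h := by gcongr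
    _ = ∑ i, ENNReal.ofReal h * volume ((fun x => (b i).repr x 1) '' C i) := by
        rw [mul_comm, Finset.mul_sum]
    _ ≤ ∑ i, volume (U ∩ cthickening h (C i)) := Finset.sum_le_sum fun i _ => hstrip i
    _ = volume (⋃ i, U ∩ cthickening h (C i)) := by
        rw [measure_iUnion _ hTm, tsum_fintype]
        intro i j hij
        exact (hdis i j hij).mono inter_subset_right inter_subset_right
    _ ≤ volume U := measure_mono (iUnion_subset fun i => inter_subset_left)

theorem global_lemma (K : Set Plane) (hK : IsCompact K) (hne : K.Nonempty) (ε : ℝ) (hε : 0 < ε)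
    (c : NNReal)
    (hc : ∀ t, 0 < t → t ≤ ε → (c : ℝ≥0∞) < μH[1] {x : Plane | infDist x K = t}) :
    c * ENNReal.ofReal ε ≤ volume {x : Plane | 0 < infDist x K ∧ infDist x K < ε} := by
  have hdc : Continuous (fun x : Plane => infDist x K) := continuous_infDist_pt K
  let G : ℝ → ℝ≥0∞ := fun s => volume {x : Plane | s ≤ infDist x K ∧ infDist x K < ε}
  have hGanti : ∀ s s', s ≤ s' → G s' ≤ G s := fun s s' hss =>
    measure_mono fun x hx => ⟨hss.trans hx.1, hx.2⟩
  let S : Set ℝ := {s | 0 < s ∧ s ≤ ε ∧ c * ENNReal.ofReal (ε - s) ≤ G s}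
  have hSε : ε ∈ S := ⟨hε, le_rfl, by simp⟩
  have hbdd : BddBelow S := ⟨0, fun s hs => hs.1.le⟩
  have hlim : ∀ a, (∀ δ > a, ∃ s ∈ S, s < δ) → ∀ X : ℝ≥0∞, (∀ s ∈ S, G s ≤ X) →
      c * ENNReal.ofReal (ε - a) ≤ X := by
    intro a ha X hX
    have h1 : Tendsto (fun δ : ℝ => (c : ℝ≥0∞) * ENNReal.ofReal (ε - δ)) (𝓝[>] a)
        (𝓝 (c * ENNReal.ofReal (ε - a))) := by
      apply tendsto_nhdsWithin_of_tendsto_nhds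
      apply ENNReal.Tendsto.const_mul _ (Or.inr coe_ne_top)
      exact (ENNReal.continuous_ofReal.comp (continuous_const.sub continuous_id)).tendsto a
    refine le_of_tendsto h1 ?_
    filter_upwards [self_mem_nhdsWithin] with δ hδ
    obtain ⟨s, hs, hsδ⟩ := ha δ hδ
    refine le_trans ?_ (hs.2.2.trans (hX s hs))
    gcongr
  have hinf : ∀ δ > sInf S, ∃ s ∈ S, s < δ := fun δ hδ => exists_lt_of_csInf_lt ⟨ε, hSε⟩ hδ
  have hge : 0 ≤ sInf S := le_csInf ⟨ε, hSε⟩ fun s hs => hs.1.le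
  have hzero : sInf S = 0 := by
    by_contra hne0
    have hpos : 0 < sInf S := lt_of_le_of_ne hge (Ne.symm hne0)
    have hle : sInf S ≤ ε := csInf_le hbdd hSε
    have hmem : c * ENNReal.ofReal (ε - sInf S) ≤ G (sInf S) :=
      hlim _ hinf _ fun s hs => hGanti _ _ (csInf_le hbdd hs)
    obtain ⟨h, hh0, hht, hh⟩ := local_lemma K hK hne _ hpos c (hc _ hpos hle)
    have : sInf S - h ∈ S := by
      refine ⟨by linarith, by linarith, ?_⟩
      have h1 : ENNReal.ofReal (ε - (sInf S - h)) =
          ENNReal.ofReal h + ENNReal.ofReal (ε - sInf S) := by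
        rw [← ENNReal.ofReal_add hh0.le (by linarith)]; congr 1; ring
      rw [h1, mul_add]
      refine (add_le_add hh hmem).trans ?_
      rw [← measure_union]
      · refine measure_mono ?_
        rintro x (hx | hx)
        · exact ⟨hx.1, hx.2.trans_le hle⟩
        · exact ⟨by linarith [hx.1], hx.2⟩
      · rw [Set.disjoint_left]
        intro x hx hx'
        exact absurd hx.2 (not_lt.2 hx'.1)
      · exact (measurableSet_le measurable_const hdc.measurable).inter
          (measurableSet_lt hdc.measurable measurable_const)
    have := csInf_le hbdd this
    linarith
  have := hlim 0 (by rw [← hzero]; exact hinf) (volume {x : Plane | 0 < infDist x K ∧ infDist x K < ε})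
    (fun s hs => measure_mono fun x hx => ⟨hs.1.trans_le hx.1, hx.2⟩)
  simpa using this

/-- For a compact connected `K ⊆ ℝ²` of finite outer Minkowski content,
`SM¹(K) ≥ liminf_{ε→0⁺} H¹({dist(·,K) = ε})`. -/
theorem stmt_6 (K : Set Plane) (hK : IsCompact K) (hKconn : IsConnected K)
    (hfin : SM1 K ≠ ⊤) :
    liminf (fun ε : ℝ => μH[1] {x : Plane | infDist x K = ε}) (𝓝[>] (0 : ℝ)) ≤ SM1 K := by
  refine le_of_forall_lt fun a ha => ?_
  obtain ⟨c, hac, hc⟩ := ENNReal.lt_iff_exists_nnreal_btwn.1 ha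
  refine hac.trans_le ?_
  have hev := eventually_lt_of_lt_liminf hc
  obtain ⟨δ, hδ, hsub⟩ := mem_nhdsGT_iff_exists_Ioc_subset.1 hev
  have hδ0 : 0 < δ := hδ
  refine le_limsup_of_frequently_le (Eventually.frequently ?_)
  have h3 : ∀ᶠ h : ℝ in 𝓝[>] 0, h < δ := mem_nhdsWithin_of_mem_nhds (Iio_mem_nhds hδ0)
  filter_upwards [h3, self_mem_nhdsWithin] with ε hεδ hε
  have hε0 : 0 < ε := hε
  have hg := global_lemma K hK hKconn.nonempty ε hε0 c fun t ht htε =>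
    hsub ⟨ht, htε.trans hεδ.le⟩
  rw [ENNReal.le_div_iff_mul_le (Or.inl (by simpa using hε0)) (Or.inl ofReal_ne_top)]
  refine hg.trans (measure_mono ?_)
  intro x hx
  constructor
  · obtain ⟨y, hy, hxy⟩ := hK.exists_infDist_eq_dist hKconn.nonempty x
    exact mem_cthickening_of_dist_le x y ε K hy (by rw [← hxy]; exact hx.2.le)
  · intro hxK
    have := infDist_zero_of_mem hxK
    linarith [hx.1]
end

section
/- Let K be a compact convex subset of the plane with nonempty interior that is not a disk. Then H¹(∂K)² > 4π·L(K), i.e., the isoperimetric inequality is strict for non-circular convex bodies. -/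
open Metric Set MeasureTheory

/-- Rotation by a right angle. -/
noncomputable def rotJ (u : Plane) : Plane := !₂[-u 1, u 0]

lemma inner_plane (x y : Plane) : inner ℝ x y = x 0 * y 0 + x 1 * y 1 := by
  simp [PiLp.inner_apply, Fin.sum_univ_two, mul_comm]

lemma rotJ_zero (u : Plane) : rotJ u 0 = - u 1 := rfl
lemma rotJ_one (u : Plane) : rotJ u 1 = u 0 := rfl

lemma unit_sq {u : Plane} (hu : ‖u‖ = 1) : u 0 * u 0 + u 1 * u 1 = 1 := by
  rw [← inner_plane, real_inner_self_eq_norm_sq, hu]; norm_num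

lemma inner_rotJ (u : Plane) : inner ℝ (rotJ u) u = 0 := by
  rw [inner_plane, rotJ_zero, rotJ_one]; ring

lemma inner_rotJ' (u : Plane) : inner ℝ u (rotJ u) = 0 := by
  rw [inner_plane, rotJ_zero, rotJ_one]; ring

lemma norm_rotJ {u : Plane} (hu : ‖u‖ = 1) : ‖rotJ u‖ = 1 := by
  have h : ‖rotJ u‖ ^ 2 = 1 := by
    rw [← real_inner_self_eq_norm_sq, inner_plane, rotJ_zero, rotJ_one]
    linarith [unit_sq hu]
  nlinarith [norm_nonneg (rotJ u)]

lemma decomp {u : Plane} (hu : ‖u‖ = 1) (x : Plane) :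
    x = (inner ℝ u x : ℝ) • u + (inner ℝ (rotJ u) x : ℝ) • rotJ u := by
  have h := unit_sq hu
  ext i
  fin_cases i
  · simp [inner_plane, rotJ_zero, rotJ_one]; linear_combination (-(x 0)) * h
  · simp [inner_plane, rotJ_zero, rotJ_one]; linear_combination (-(x 1)) * h

lemma dist_sq_decomp {u : Plane} (hu : ‖u‖ = 1) (x : Plane) :
    ‖x‖ ^ 2 = (inner ℝ u x : ℝ) ^ 2 + (inner ℝ (rotJ u) x : ℝ) ^ 2 := by
  have h := unit_sq hu
  rw [← real_inner_self_eq_norm_sq, inner_plane, inner_plane, inner_plane, rotJ_zero, rotJ_one]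
  linear_combination (-(x 0 ^ 2 + x 1 ^ 2)) * h

lemma mp_coords {u : Plane} (hu : ‖u‖ = 1) :
    MeasurePreserving (fun x : Plane => ((inner ℝ u x : ℝ), (inner ℝ (rotJ u) x : ℝ)))
      volume (volume : Measure (ℝ × ℝ)) := by
  have hon : Orthonormal ℝ ![u, rotJ u] := by
    rw [orthonormal_iff_ite]
    intro i j
    fin_cases i <;> fin_cases j <;>
      simp [inner_rotJ, inner_rotJ', hu, norm_rotJ hu]
  let b := basisOfOrthonormalOfCardEqFinrank hon (by simp)
  have hb : ⇑b = ![u, rotJ u] := coe_basisOfOrthonormalOfCardEqFinrank hon _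
  let B := b.toOrthonormalBasis (by rw [hb]; exact hon)
  have hB : ⇑B = ![u, rotJ u] := by simp [B, hb]
  have h1 := B.measurePreserving_repr
  have h2 := PiLp.volume_preserving_ofLp (Fin 2)
  have h3 := volume_preserving_finTwoArrow ℝ
  have h := h3.comp (h2.comp h1)
  convert h using 1
  funext x
  simp [MeasurableEquiv.finTwoArrow, B.repr_apply_apply, hB]

lemma strip_measurable {u : Plane} (g : ℝ → ℝ) (hg : Measurable g)
    {S T : Set ℝ} (hS : MeasurableSet S) (hT : MeasurableSet T) :
    MeasurableSet {x : Plane | (inner ℝ u x : ℝ) ∈ S ∧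
      (inner ℝ (rotJ u) x : ℝ) + g (inner ℝ u x) ∈ T} := by
  have h1 : Measurable (fun x : Plane => (inner ℝ u x : ℝ)) := by fun_prop
  have h2 : Measurable (fun x : Plane => (inner ℝ (rotJ u) x : ℝ)) := by fun_prop
  exact (h1 hS).inter ((h2.add (hg.comp h1)) hT)

lemma strip_volume {u : Plane} (hu : ‖u‖ = 1) (g : ℝ → ℝ) (hg : Measurable g)
    {S T : Set ℝ} (hS : MeasurableSet S) (hT : MeasurableSet T) :
    volume {x : Plane | (inner ℝ u x : ℝ) ∈ S ∧
      (inner ℝ (rotJ u) x : ℝ) + g (inner ℝ u x) ∈ T} = volume S * volume T := by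
  let A : Set (ℝ × ℝ) := {p | p.1 ∈ S ∧ p.2 + g p.1 ∈ T}
  have hA : MeasurableSet A :=
    (measurable_fst hS).inter ((measurable_snd.add (hg.comp measurable_fst)) hT)
  have h := (mp_coords hu).measure_preimage hA.nullMeasurableSet
  have e : (fun x : Plane => ((inner ℝ u x : ℝ), (inner ℝ (rotJ u) x : ℝ))) ⁻¹' A =
    {x : Plane | (inner ℝ u x : ℝ) ∈ S ∧
      (inner ℝ (rotJ u) x : ℝ) + g (inner ℝ u x) ∈ T} := rfl
  rw [← e, h, Measure.volume_eq_prod, Measure.prod_apply hA]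
  have : ∀ s, volume (Prod.mk s ⁻¹' A) = S.indicator (fun _ => volume T) s := by
    intro s
    by_cases hs : s ∈ S
    · have : Prod.mk s ⁻¹' A = (fun t => t + g s) ⁻¹' T := by
        ext t; simp [A, hs]
      rw [this, measure_preimage_add_right]; simp [hs]
    · have : Prod.mk s ⁻¹' A = ∅ := by
        ext t; simp [A, hs]
      rw [this]; simp [hs]
  simp_rw [this]
  rw [lintegral_indicator hS]; simp [mul_comm]

/-- the nearest point map relation -/
lemma nearest_unique {Q : Set Plane} {x y p q : Plane} (hp : p ∈ Q) (hq : q ∈ Q)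
    (h1 : ∀ z ∈ Q, (inner ℝ (x - p) (z - p) : ℝ) ≤ 0)
    (h2 : ∀ z ∈ Q, (inner ℝ (y - q) (z - q) : ℝ) ≤ 0) : dist p q ≤ dist x y := by
  have a := h1 q hq
  have b := h2 p hp
  have c : ‖p - q‖ ^ 2 ≤ ‖x - y‖ * ‖p - q‖ := by
    refine le_trans ?_ (real_inner_le_norm (x - y) (p - q))
    rw [← real_inner_self_eq_norm_sq]
    rw [inner_plane] at *
    rw [inner_plane]
    simp only [PiLp.sub_apply] at *
    nlinarith
  rw [dist_eq_norm, dist_eq_norm]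
  by_contra! hlt
  nlinarith [norm_nonneg (x - y), norm_nonneg (p - q)]

lemma meets_frontier {K s : Set Plane} (hK : IsClosed K) (hs : IsPreconnected s)
    (h1 : (s ∩ K).Nonempty) (h2 : (s ∩ Kᶜ).Nonempty) : (s ∩ frontier K).Nonempty := by
  by_contra! hne
  have hcov : s ⊆ interior K ∪ Kᶜ := by
    intro x hx
    by_cases hxK : x ∈ K
    · left
      by_contra hxi
      have : x ∈ s ∩ frontier K := ⟨hx, by rw [hK.frontier_eq]; exact ⟨hxK, hxi⟩⟩
      rw [hne] at this; exact this
    · right; exact hxK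
  obtain ⟨x, hxs, hxK⟩ := h1
  have hx : (s ∩ interior K).Nonempty := ⟨x, hxs, (hcov hxs).resolve_right (fun h => h hxK)⟩
  obtain ⟨y, hy, hy1, hy2⟩ := hs _ _ isOpen_interior hK.isOpen_compl hcov hx h2
  exact hy2 (interior_subset hy1)

lemma hausdorff_mono {Q K : Set Plane} (hQ : IsCompact Q) (hQc : Convex ℝ Q)
    (hQi : (interior Q).Nonempty) (hK : IsCompact K) (hQK : Q ⊆ K) :
    μH[1] (frontier Q) ≤ μH[1] (frontier K) := by
  have hQne : Q.Nonempty := hQi.mono interior_subset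
  have hex : ∀ x : Plane, ∃ p ∈ Q, ∀ z ∈ Q, (inner ℝ (x - p) (z - p) : ℝ) ≤ 0 := by
    intro x
    obtain ⟨p, hp, h⟩ := exists_norm_eq_iInf_of_complete_convex hQne hQ.isComplete hQc x
    exact ⟨p, hp, (norm_eq_iInf_iff_real_inner_le_zero hQc hp).1 h⟩
  choose f hf1 hf2 using hex
  have hlip : LipschitzWith 1 f := LipschitzWith.of_dist_le_mul fun x y => by
    simpa using nearest_unique (hf1 x) (hf1 y) (hf2 x) (hf2 y)
  have hsub : frontier Q ⊆ f '' frontier K := by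
    intro y hy
    have hyQ : y ∈ Q := hQ.isClosed.frontier_subset hy
    have hyi : y ∉ interior Q := by rw [hQ.isClosed.frontier_eq] at hy; exact hy.2
    obtain ⟨F, hF⟩ := geometric_hahn_banach_open_point hQc.interior isOpen_interior hyi
    have hF' : ∀ q ∈ Q, F q ≤ F y := by
      have : Q ⊆ closure (interior Q) := by
        rw [hQc.closure_interior_eq_closure_of_nonempty_interior hQi]; exact subset_closure
      intro q hq
      have hcl : IsClosed {q | F q ≤ F y} := isClosed_le F.continuous continuous_const
      exact closure_minimal (fun a ha => (hF a ha).le) hcl (this hq)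
    let u := (InnerProductSpace.toDual ℝ Plane).symm F
    have hu : ∀ z, (inner ℝ u z : ℝ) = F z := fun z => by simp [u]
    have hu0 : u ≠ 0 := by
      intro h0
      obtain ⟨a, ha⟩ := hQi
      have := hF a ha
      rw [← hu, ← hu, h0] at this
      simp at this
    let s : Set Plane := (fun t : ℝ => y + t • u) '' Ici 0
    have hs : IsPreconnected s := isPreconnected_Ici.image _ (by fun_prop)
    obtain ⟨R, hR⟩ := hK.isBounded.subset_closedBall y
    have hout : (s ∩ Kᶜ).Nonempty := by
      have hn : 0 < ‖u‖ := norm_pos_iff.2 hu0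
      refine ⟨_, ⟨(|R| + 1) / ‖u‖, by simp only [mem_Ici]; positivity, rfl⟩, fun hm => ?_⟩
      have := hR hm
      simp only [mem_closedBall, dist_self_add_left, norm_smul, norm_div, norm_norm] at this
      rw [div_mul_cancel₀ _ hn.ne', Real.norm_eq_abs, abs_of_pos (by positivity)] at this
      linarith [le_abs_self R]
    obtain ⟨z, ⟨t, ht, rfl⟩, hz⟩ := meets_frontier hK.isClosed hs
      ⟨y, ⟨0, by simp, by simp⟩, hQK hyQ⟩ hout
    refine ⟨_, hz, ?_⟩
    have key : ∀ q ∈ Q, (inner ℝ (y + t • u - y) (q - y) : ℝ) ≤ 0 := by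
      intro q hq
      rw [add_sub_cancel_left, inner_smul_left, inner_sub_right, hu, hu]
      have := hF' q hq
      simp only [mem_Ici] at ht
      simpa using mul_nonpos_of_nonneg_of_nonpos ht (sub_nonpos.2 this)
    have := nearest_unique (hf1 (y + t • u)) hyQ (hf2 (y + t • u)) key
    simpa using this
  calc μH[1] (frontier Q) ≤ μH[1] (f '' frontier K) := measure_mono hsub
    _ ≤ _ := by simpa using hlip.hausdorffMeasure_image_le zero_le_one (frontier K)

lemma hausdorff_finite {K : Set Plane} (hK : IsCompact K) (hKc : Convex ℝ K)
    (hint : (interior K).Nonempty) : μH[1] (frontier K) < ⊤ := by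
  obtain ⟨R, hR⟩ := hK.isBounded.subset_closedBall 0
  have hR0 : |R| + 1 ≠ 0 := by positivity
  refine (hausdorff_mono hK hKc hint (isCompact_closedBall 0 (|R| + 1))
    (hR.trans (closedBall_subset_closedBall (by linarith [le_abs_self R])))).trans_lt ?_
  rw [frontier_closedBall _ hR0]
  let e := Complex.orthonormalBasisOneI.repr
  have : sphere (0 : Plane) (|R| + 1) = e '' (circleMap 0 (|R| + 1) '' Ioc 0 (2 * Real.pi)) := by
    rw [image_circleMap_Ioc, LinearIsometryEquiv.image_sphere]
    rw [map_zero, abs_of_pos (show 0 < |R| + 1 by positivity)]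
  rw [this, e.isometry.hausdorffMeasure_image (Or.inl zero_le_one)]
  refine ((lipschitzWith_circleMap 0 (|R| + 1)).hausdorffMeasure_image_le zero_le_one _).trans_lt ?_
  rw [hausdorffMeasure_real]
  exact ENNReal.mul_lt_top (by simp) (by rw [Real.volume_Ioc]; exact ENNReal.ofReal_lt_top)

/-- The polygon cut out by finitely many half-planes. -/
def poly (I : Finset (Plane × ℝ)) : Set Plane := {x | ∀ i ∈ I, (inner ℝ i.1 x : ℝ) ≤ i.2}

/-- The parameter set of a face. -/
def faceT (I : Finset (Plane × ℝ)) (i : Plane × ℝ) : Set ℝ :=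
  {t | i.2 • i.1 + t • rotJ i.1 ∈ poly I}

lemma poly_closed (I : Finset (Plane × ℝ)) : IsClosed (poly I) := by
  have : poly I = ⋂ i ∈ I, {x | (inner ℝ i.1 x : ℝ) ≤ i.2} := by ext; simp [poly]
  rw [this]
  exact isClosed_biInter fun i _ => isClosed_le (by fun_prop) (by fun_prop)

lemma poly_convex (I : Finset (Plane × ℝ)) : Convex ℝ (poly I) := by
  intro x hx y hy a b ha hb hab i hi
  rw [inner_add_right, inner_smul_right, inner_smul_right]
  have h1 := mul_le_mul_of_nonneg_left (hx i hi) ha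
  have h2 := mul_le_mul_of_nonneg_left (hy i hi) hb
  have : a * i.2 + b * i.2 = i.2 := by rw [← add_mul, hab, one_mul]
  linarith

lemma faceT_closed (I : Finset (Plane × ℝ)) (i : Plane × ℝ) : IsClosed (faceT I i) :=
  (poly_closed I).preimage (f := fun t : ℝ => i.2 • i.1 + t • rotJ i.1) (by fun_prop)

lemma inner_face {i : Plane × ℝ} (hi : ‖i.1‖ = 1) (t : ℝ) :
    (inner ℝ i.1 (i.2 • i.1 + t • rotJ i.1) : ℝ) = i.2 := by
  rw [inner_add_right, inner_smul_right, inner_smul_right, inner_rotJ', real_inner_self_eq_norm_sq,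
    hi]; ring

lemma face_decomp {i : Plane × ℝ} (hi : ‖i.1‖ = 1) {x : Plane} (hx : (inner ℝ i.1 x : ℝ) = i.2) :
    x = i.2 • i.1 + (inner ℝ (rotJ i.1) x : ℝ) • rotJ i.1 := by
  conv_lhs => rw [decomp hi x, hx]

/-- Moving a little from a point in an admissible direction. -/
lemma perturb {I : Finset (Plane × ℝ)} {q d : Plane} (hq : q ∈ poly I)
    (hd : ∀ i ∈ I, (inner ℝ i.1 q : ℝ) = i.2 → (inner ℝ i.1 d : ℝ) ≤ 0) :
    ∃ ε : ℝ, 0 < ε ∧ q + ε • d ∈ poly I := by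
  have h : ∀ᶠ ε : ℝ in nhdsWithin 0 (Ioi 0), ∀ i ∈ I, (inner ℝ i.1 (q + ε • d) : ℝ) ≤ i.2 := by
    rw [Filter.eventually_all_finset]
    intro i hi
    rcases (hq i hi).lt_or_eq with h | h
    · have hc : Continuous fun ε : ℝ => (inner ℝ i.1 (q + ε • d) : ℝ) := by fun_prop
      have : ∀ᶠ ε : ℝ in nhds 0, (inner ℝ i.1 (q + ε • d) : ℝ) < i.2 :=
        hc.continuousAt.eventually_lt continuousAt_const (by simpa using h)
      exact (this.filter_mono nhdsWithin_le_nhds).mono fun _ h => h.le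
    · filter_upwards [self_mem_nhdsWithin] with ε hε
      rw [inner_add_right, inner_smul_right, h]
      have := mul_nonpos_of_nonneg_of_nonpos (le_of_lt (mem_Ioi.1 hε)) (hd i hi h)
      linarith
  obtain ⟨ε, h1, h2⟩ := (h.and self_mem_nhdsWithin).exists
  exact ⟨ε, h2, h1⟩

lemma poly_frontier {I : Finset (Plane × ℝ)} {x : Plane} (hx : x ∈ frontier (poly I)) :
    ∃ i ∈ I, (inner ℝ i.1 x : ℝ) = i.2 := by
  by_contra! hne
  have hxQ := (poly_closed I).frontier_subset hx
  rw [(poly_closed I).frontier_eq] at hx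
  apply hx.2
  rw [mem_interior_iff_mem_nhds]
  have : ∀ᶠ y in nhds x, ∀ i ∈ I, (inner ℝ i.1 y : ℝ) ≤ i.2 := by
    rw [Filter.eventually_all_finset]
    intro i hi
    have hc : Continuous fun y : Plane => (inner ℝ i.1 y : ℝ) := by fun_prop
    exact (hc.continuousAt.eventually_lt continuousAt_const
      (lt_of_le_of_ne (hxQ i hi) (hne i hi))).mono fun _ h => h.le
  exact this

lemma poly_interior {I : Finset (Plane × ℝ)} (hI : ∀ i ∈ I, ‖i.1‖ = 1) {x : Plane}
    (hx : x ∈ interior (poly I)) : ∀ i ∈ I, (inner ℝ i.1 x : ℝ) < i.2 := by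
  intro i hi
  have hc : Continuous fun ε : ℝ => x + ε • i.1 := by fun_prop
  have h : ∀ᶠ ε : ℝ in nhds 0, x + ε • i.1 ∈ interior (poly I) :=
    hc.continuousAt.eventually (isOpen_interior.mem_nhds (by simpa using hx))
  obtain ⟨ε, h1, h2⟩ := ((h.filter_mono nhdsWithin_le_nhds).and
    (self_mem_nhdsWithin : Ioi (0:ℝ) ∈ nhdsWithin 0 (Ioi 0))).exists
  have := interior_subset h1 i hi
  rw [inner_add_right, inner_smul_right, real_inner_self_eq_norm_sq, hI i hi] at this
  have h2' : 0 < ε := h2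
  linarith

lemma face_frontier {I : Finset (Plane × ℝ)} (hI : ∀ i ∈ I, ‖i.1‖ = 1) {x : Plane}
    (hx : x ∈ poly I) {i : Plane × ℝ} (hi : i ∈ I) (h : (inner ℝ i.1 x : ℝ) = i.2) :
    x ∈ frontier (poly I) := by
  rw [(poly_closed I).frontier_eq]
  exact ⟨hx, fun hx' => (poly_interior hI hx' i hi).ne h⟩

lemma face_inter {I : Finset (Plane × ℝ)} (hI : ∀ i ∈ I, ‖i.1‖ = 1)
    (hint : (interior (poly I)).Nonempty) {i j : Plane × ℝ} (hi : i ∈ I) (hj : j ∈ I)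
    (hij : i ≠ j) {x y : Plane}
    (hxi : (inner ℝ i.1 x : ℝ) = i.2) (hxj : (inner ℝ j.1 x : ℝ) = j.2)
    (hyi : (inner ℝ i.1 y : ℝ) = i.2) (hyj : (inner ℝ j.1 y : ℝ) = j.2) : x = y := by
  by_contra hxy
  have ex := face_decomp (hI i hi) hxi
  have ey := face_decomp (hI i hi) hyi
  set a : ℝ := inner ℝ (rotJ i.1) x
  set b : ℝ := inner ℝ (rotJ i.1) y
  have hab : a ≠ b := by
    intro h; apply hxy; rw [ex, ey, h]
  have h0 : (inner ℝ (rotJ i.1) j.1 : ℝ) = 0 := by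
    rw [ex, inner_add_right, inner_smul_right, inner_smul_right] at hxj
    rw [ey, inner_add_right, inner_smul_right, inner_smul_right] at hyj
    rw [real_inner_comm]
    have : (a - b) * (inner ℝ j.1 (rotJ i.1) : ℝ) = 0 := by linarith
    exact (mul_eq_zero.1 this).resolve_left (sub_ne_zero.2 hab)
  have hd := decomp (hI i hi) j.1
  have hn := dist_sq_decomp (hI i hi) j.1
  rw [h0, zero_smul, add_zero] at hd
  rw [h0, hI j hj] at hn
  set c : ℝ := inner ℝ i.1 j.1
  have hc : c = 1 ∨ c = -1 := by
    exact sq_eq_one_iff.1 (by linarith)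
  rcases hc with hc | hc
  · rw [hc, one_smul] at hd
    apply hij
    refine Prod.ext hd.symm ?_
    rw [← hxi, ← hxj, hd]
  · rw [hc, neg_one_smul] at hd
    obtain ⟨z, hz⟩ := hint
    have h1 := poly_interior hI hz i hi
    have h2 := poly_interior hI hz j hj
    rw [hd, inner_neg_left] at h2
    rw [hd, inner_neg_left] at hxj
    linarith

/-- the perimeter -/
noncomputable def per (I : Finset (Plane × ℝ)) : ENNReal := ∑ i ∈ I, volume (faceT I i)

lemma per_le {I : Finset (Plane × ℝ)} (hI : ∀ i ∈ I, ‖i.1‖ = 1)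
    (hint : (interior (poly I)).Nonempty) : per I ≤ μH[1] (frontier (poly I)) := by
  let F : Plane × ℝ → Set Plane := fun i => (fun t : ℝ => i.2 • i.1 + t • rotJ i.1) '' faceT I i
  have hiso : ∀ i ∈ I, Isometry (fun t : ℝ => i.2 • i.1 + t • rotJ i.1) := by
    intro i hi
    apply Isometry.of_dist_eq
    intro s t
    rw [dist_add_left, dist_eq_norm, ← sub_smul, norm_smul, norm_rotJ (hI i hi), mul_one,
      dist_eq_norm]
  have h1 : per I = ∑ i ∈ I, μH[1] (F i) := by
    refine Finset.sum_congr rfl fun i hi => ?_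
    rw [(hiso i hi).hausdorffMeasure_image (Or.inl zero_le_one), hausdorffMeasure_real]
  have hF : ∀ i ∈ I, ∀ x ∈ F i, x ∈ poly I ∧ (inner ℝ i.1 x : ℝ) = i.2 := by
    rintro i hi _ ⟨t, ht, rfl⟩
    exact ⟨ht, inner_face (hI i hi) t⟩
  rw [h1, ← measure_biUnion_finset₀]
  · apply measure_mono
    simp only [iUnion_subset_iff]
    intro i hi x hx
    exact face_frontier hI (hF i hi x hx).1 hi (hF i hi x hx).2
  · intro i hi j hj hij
    have hsub : (F i ∩ F j).Subsingleton := by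
      intro x hx y hy
      exact face_inter hI hint hi hj hij (hF i hi x hx.1).2
        (hF j hj x hx.2).2 (hF i hi y hy.1).2 (hF j hj y hy.2).2
    have := Measure.nullSingletonClass_hausdorff Plane (zero_lt_one' ℝ)
    exact hsub.measure_zero _
  · intro i hi
    exact ((hiso i hi).isClosedEmbedding.isClosedMap _ (faceT_closed I i)).measurableSet.nullMeasurableSet

/-- nearest point relation -/
def NP (Q : Set Plane) (x p : Plane) : Prop :=
  p ∈ Q ∧ ∀ z ∈ Q, (inner ℝ (x - p) (z - p) : ℝ) ≤ 0

lemma NP.unique {Q : Set Plane} {x p q : Plane} (h1 : NP Q x p) (h2 : NP Q x q) : p = q := by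
  simpa using nearest_unique h1.1 h2.1 h1.2 h2.2

lemma NP.self {Q : Set Plane} {x : Plane} (h : x ∈ Q) : NP Q x x := ⟨h, by simp⟩

/-- vertices -/
def verts (I : Finset (Plane × ℝ)) : Set Plane :=
  {v | v ∈ poly I ∧ ∃ i ∈ I, ∃ j ∈ I, i ≠ j ∧ (inner ℝ i.1 v : ℝ) = i.2 ∧ (inner ℝ j.1 v : ℝ) = j.2}

lemma verts_finite {I : Finset (Plane × ℝ)} (hI : ∀ i ∈ I, ‖i.1‖ = 1)
    (hint : (interior (poly I)).Nonempty) : (verts I).Finite := by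
  have : verts I ⊆ ⋃ i ∈ I, ⋃ j ∈ I, {v | v ∈ poly I ∧ i ≠ j ∧ (inner ℝ i.1 v : ℝ) = i.2 ∧
      (inner ℝ j.1 v : ℝ) = j.2} := by
    rintro v ⟨hv, i, hi, j, hj, h⟩
    simp only [mem_iUnion]
    exact ⟨i, hi, j, hj, hv, h⟩
  refine Set.Finite.subset (I.finite_toSet.biUnion fun i hi => I.finite_toSet.biUnion fun j hj => ?_) this
  apply Set.Subsingleton.finite
  rintro x ⟨_, hij, h1, h2⟩ y ⟨_, _, h3, h4⟩
  exact face_inter hI hint hi hj hij h1 h2 h3 h4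

lemma exists_vert {I : Finset (Plane × ℝ)} (hQ : IsCompact (poly I))
    (hint : (interior (poly I)).Nonempty) {w : Plane} (hw0 : w ≠ 0)
    (hw : ∀ i ∈ I, (inner ℝ (rotJ i.1) w : ℝ) ≠ 0) :
    ∃ v ∈ verts I, ∀ q ∈ poly I, (inner ℝ w (q - v) : ℝ) ≤ 0 := by
  obtain ⟨v, hv, hmax⟩ := hQ.exists_isMaxOn (hint.mono interior_subset)
    (f := fun q => (inner ℝ w q : ℝ)) (by fun_prop)
  have hmax' : ∀ q ∈ poly I, (inner ℝ w q : ℝ) ≤ inner ℝ w v := fun q hq => hmax hq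
  refine ⟨v, ⟨hv, ?_⟩, fun q hq => by rw [inner_sub_right]; linarith [hmax' q hq]⟩
  have hno : ∀ d, (∀ i ∈ I, (inner ℝ i.1 v : ℝ) = i.2 → (inner ℝ i.1 d : ℝ) ≤ 0) →
      (inner ℝ w d : ℝ) ≤ 0 := by
    intro d hd
    obtain ⟨ε, hε, h⟩ := perturb hv hd
    have := hmax' _ h
    rw [inner_add_right, inner_smul_right] at this
    by_contra! hpos
    have := mul_pos hε hpos
    linarith
  by_contra! hne
  by_cases hact : ∃ i ∈ I, (inner ℝ i.1 v : ℝ) = i.2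
  · obtain ⟨i, hi, hiv⟩ := hact
    have := hno ((inner ℝ (rotJ i.1) w : ℝ) • rotJ i.1) (by
      intro j hj hjv
      have : i = j := by
        by_contra hij
        exact hne i hi j hj hij hiv hjv
      subst this
      rw [inner_smul_right, inner_rotJ', mul_zero])
    rw [inner_smul_right, real_inner_comm (rotJ i.1) w] at this
    have h2 := hw i hi
    have : 0 < (inner ℝ (rotJ i.1) w : ℝ) * inner ℝ (rotJ i.1) w := mul_self_pos.2 h2
    linarith
  · push Not at hact
    have := hno w (fun i hi h => absurd h (hact i hi))
    rw [real_inner_self_eq_norm_sq] at this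
    have := norm_pos_iff.2 hw0
    nlinarith

lemma sphere_minus_connected (x : Plane) {r : ℝ} (hr : 0 < r) {p : Plane} (hp : p ∈ sphere x r) :
    IsPreconnected (sphere x r \ {p}) := by
  let v : Plane := r⁻¹ • (p - x)
  have hpn : ‖p - x‖ = r := by rw [← dist_eq_norm]; exact hp
  have hv : ‖v‖ = 1 := by
    simp only [v, norm_smul, norm_inv, Real.norm_eq_abs, abs_of_pos hr, hpn]
    exact inv_mul_cancel₀ hr.ne'
  have h : IsPreconnected (range fun w => x + r • ((stereoInvFun hv w : sphere (0 : Plane) 1) : Plane)) := by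
    apply isPreconnected_range
    exact continuous_const.add
      ((continuous_subtype_val.comp (continuous_stereoInvFun hv)).const_smul r)
  convert h using 1
  ext y
  constructor
  · rintro ⟨hy, hyp⟩
    have hyn : ‖y - x‖ = r := by rw [← dist_eq_norm]; exact hy
    let z : sphere (0 : Plane) 1 := ⟨r⁻¹ • (y - x), by
      simp only [mem_sphere, dist_zero_right, norm_smul, norm_inv, Real.norm_eq_abs, abs_of_pos hr, hyn]
      exact inv_mul_cancel₀ hr.ne'⟩
    have hz : (z : Plane) ≠ v := by
      intro h
      apply hyp
      have h2 : r⁻¹ • (y - x) = r⁻¹ • (p - x) := h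
      have := smul_right_injective Plane (inv_ne_zero hr.ne') h2
      simpa using this
    refine ⟨stereoToFun v z, ?_⟩
    have := stereo_left_inv hv hz
    simp only [this]
    simp [z, smul_smul, mul_inv_cancel₀ hr.ne']
  · rintro ⟨w, rfl⟩
    have h1 := (stereoInvFun hv w).2
    have h2 := stereoInvFun_ne_north_pole hv w
    refine ⟨?_, ?_⟩
    · simp only [mem_sphere, dist_zero_right] at h1
      rw [mem_sphere, dist_eq_norm, add_sub_cancel_left, norm_smul, h1, Real.norm_eq_abs,
        abs_of_pos hr, mul_one]
    · intro h
      apply h2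
      have h3 : x + r • ((stereoInvFun hv w : sphere (0 : Plane) 1) : Plane) = p := h
      apply Subtype.ext
      simp only [v, ← h3, add_sub_cancel_left, smul_smul, inv_mul_cancel₀ hr.ne', one_smul]

lemma two_points {Q : Set Plane} (hQ : IsCompact Q) (hQc : Convex ℝ Q)
    (hint : (interior Q).Nonempty) {r : ℝ} (hr : 0 < r) (x : Plane)
    (h1 : ¬ closedBall x r ⊆ Q) (h2 : ¬ Q ⊆ closedBall x r) (h3 : x ∈ thickening r Q) :
    ∃ p ∈ frontier Q ∩ sphere x r, ∃ p' ∈ frontier Q ∩ sphere x r, p ≠ p' := by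
  have hQcl : Q ⊆ closure (interior Q) := by
    rw [hQc.closure_interior_eq_closure_of_nonempty_interior hint]; exact subset_closure
  -- a point of the circle inside
  obtain ⟨a, ha, hai⟩ : (sphere x r ∩ interior Q).Nonempty := by
    obtain ⟨q, hq, hxq⟩ := mem_thickening_iff.1 h3
    obtain ⟨b, hb1, hb2⟩ := mem_closure_iff.1 (hQcl hq) (ball x r) isOpen_ball
      (by rw [mem_ball, dist_comm]; exact hxq)
    obtain ⟨q', hq', hxq'⟩ := not_subset.1 h2
    obtain ⟨c, hc1, hc2⟩ := mem_closure_iff.1 (hQcl hq') (closedBall x r)ᶜ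
      isClosed_closedBall.isOpen_compl hxq'
    have := meets_frontier (K := closedBall x r) isClosed_closedBall
      hQc.interior.isPreconnected ⟨b, hb2, ball_subset_closedBall hb1⟩ ⟨c, hc2, hc1⟩
    rw [frontier_closedBall _ hr.ne', inter_comm] at this
    exact this
  -- a point of the circle outside
  obtain ⟨b, hb, hbo⟩ : (sphere x r ∩ Qᶜ).Nonempty := by
    by_contra! hne
    have hs : sphere x r ⊆ Q := by
      intro y hy
      by_contra hyQ
      have : y ∈ sphere x r ∩ Qᶜ := ⟨hy, hyQ⟩
      rw [hne] at this; exact this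
    apply h1
    rw [← convexHull_sphere_eq_closedBall x hr.le]
    exact convexHull_min hs hQc
  have hfr : ∀ s, IsPreconnected s → a ∈ s → b ∈ s → (s ∩ frontier Q).Nonempty := fun s hs h h' =>
    meets_frontier hQ.isClosed hs ⟨a, h, interior_subset hai⟩ ⟨b, h', hbo⟩
  have hrk : 1 < Module.rank ℝ Plane := by
    rw [← Module.finrank_eq_rank]; simp
  obtain ⟨p, hps, hpf⟩ := hfr _ (isConnected_sphere hrk x hr.le).isPreconnected ha hb
  have hpa : a ≠ p := by
    rintro rfl
    rw [hQ.isClosed.frontier_eq] at hpf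
    exact hpf.2 hai
  have hpb : b ≠ p := by
    rintro rfl
    exact hbo (hQ.isClosed.frontier_subset hpf)
  obtain ⟨p', hps', hpf'⟩ := hfr _ (sphere_minus_connected x hr hps) ⟨ha, hpa⟩ ⟨hb, hpb⟩
  exact ⟨p, ⟨hpf, hps⟩, p', ⟨hpf', hps'.1⟩, fun h => hps'.2 h.symm⟩

/-- sign of a Boolean -/
def sgnB (b : Bool) : ℝ := if b then 1 else -1

/-- half chord length, with sign -/
noncomputable def arcG (r h : ℝ) (b : Bool) (s : ℝ) : ℝ :=
  sgnB b * Real.sqrt (r ^ 2 - (s - h) ^ 2)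

lemma arcG_meas (r h : ℝ) (b : Bool) : Measurable (arcG r h b) := by
  unfold arcG; fun_prop

/-- positions of centres of circles meeting the face `i` -/
noncomputable def hitSet (I : Finset (Plane × ℝ)) (r : ℝ) (k : (Plane × ℝ) × Bool) : Set Plane :=
  {x : Plane | (inner ℝ k.1.1 x : ℝ) ∈ Icc (k.1.2 - r) (k.1.2 + r) ∧
      (inner ℝ (rotJ k.1.1) x : ℝ) + arcG r k.1.2 k.2 (inner ℝ k.1.1 x) ∈ faceT I k.1}

lemma hitSet_meas (I : Finset (Plane × ℝ)) (r : ℝ) (k : (Plane × ℝ) × Bool) :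
    MeasurableSet (hitSet I r k) :=
  strip_measurable (arcG r k.1.2 k.2) (arcG_meas _ _ _) measurableSet_Icc (faceT_closed I k.1).measurableSet

lemma hitSet_vol {I : Finset (Plane × ℝ)} (r : ℝ) {k : (Plane × ℝ) × Bool} (hk : ‖k.1.1‖ = 1) :
    volume (hitSet I r k) = ENNReal.ofReal (2 * r) * volume (faceT I k.1) := by
  rw [hitSet, strip_volume hk (arcG r k.1.2 k.2) (arcG_meas _ _ _) measurableSet_Icc (faceT_closed I k.1).measurableSet,
    Real.volume_Icc]
  congr 2; ring

lemma hit_point {I : Finset (Plane × ℝ)} {r : ℝ} (hr : 0 < r) {i : Plane × ℝ} (hi : ‖i.1‖ = 1)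
    {x p : Plane} (hp : p ∈ poly I) (hpi : (inner ℝ i.1 p : ℝ) = i.2) (hps : p ∈ sphere x r) :
    ∃ b : Bool, x ∈ hitSet I r (i, b) ∧ p = i.2 • i.1 + ((inner ℝ (rotJ i.1) x : ℝ) +
        sgnB b * Real.sqrt (r ^ 2 - ((inner ℝ i.1 x : ℝ) - i.2) ^ 2)) • rotJ i.1 := by
  have hd := dist_sq_decomp hi (p - x)
  rw [← dist_eq_norm, mem_sphere.1 hps, inner_sub_right, inner_sub_right, hpi] at hd
  have hdec := face_decomp hi hpi
  set t : ℝ := inner ℝ (rotJ i.1) p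
  set a : ℝ := inner ℝ (rotJ i.1) x
  set c : ℝ := inner ℝ i.1 x
  have hsq : r ^ 2 - (c - i.2) ^ 2 = (t - a) ^ 2 := by linarith
  have hc : c ∈ Icc (i.2 - r) (i.2 + r) := by
    have := abs_le_of_sq_le_sq' (show (c - i.2) ^ 2 ≤ r ^ 2 by nlinarith [sq_nonneg (t - a)]) hr.le
    constructor <;> linarith [this.1, this.2]
  have hb : ∃ b : Bool, a + sgnB b * Real.sqrt (r ^ 2 - (c - i.2) ^ 2) = t := by
    rw [hsq, Real.sqrt_sq_eq_abs]
    rcases le_total 0 (t - a) with h | h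
    · exact ⟨true, by rw [abs_of_nonneg h]; simp [sgnB]⟩
    · exact ⟨false, by rw [abs_of_nonpos h]; simp [sgnB]⟩
  obtain ⟨b, hb⟩ := hb
  refine ⟨b, ⟨hc, ?_⟩, ?_⟩
  · change a + sgnB b * Real.sqrt (r ^ 2 - (c - i.2) ^ 2) ∈ faceT I i
    rw [hb]
    change i.2 • i.1 + t • rotJ i.1 ∈ poly I
    rw [← hdec]; exact hp
  · rw [hb]; exact hdec

lemma poincare {I : Finset (Plane × ℝ)} (hI : ∀ i ∈ I, ‖i.1‖ = 1) (hQ : IsCompact (poly I))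
    (hint : (interior (poly I)).Nonempty) {r : ℝ} (hr : 0 < r)
    (h1 : ∀ x, ¬ closedBall x r ⊆ poly I) (h2 : ∀ x, ¬ poly I ⊆ closedBall x r) :
    2 * volume (thickening r (poly I)) ≤ 2 * (ENNReal.ofReal (2 * r) * per I) := by
  classical
  let S := I ×ˢ (Finset.univ : Finset Bool)
  have hpt : ∀ x, (thickening r (poly I)).indicator (fun _ => (2 : ENNReal)) x ≤
      ∑ k ∈ S, (hitSet I r k).indicator (fun _ => (1 : ENNReal)) x := by
    intro x
    by_cases hx : x ∈ thickening r (poly I)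
    swap
    · simp [hx]
    rw [indicator_of_mem hx]
    obtain ⟨p, hp, p', hp', hne⟩ := two_points hQ (poly_convex I) hint hr x (h1 x) (h2 x) hx
    obtain ⟨i, hi, hip⟩ := poly_frontier hp.1
    obtain ⟨j, hj, hjp⟩ := poly_frontier hp'.1
    obtain ⟨b, hb, hpb⟩ := hit_point hr (hI i hi) ((poly_closed I).frontier_subset hp.1) hip hp.2
    obtain ⟨b', hb', hpb'⟩ := hit_point hr (hI j hj) ((poly_closed I).frontier_subset hp'.1) hjp hp'.2
    have hkne : ((i, b) : (Plane × ℝ) × Bool) ≠ (j, b') := by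
      intro h
      obtain ⟨rfl, rfl⟩ := Prod.mk.inj h
      exact hne (hpb.trans hpb'.symm)
    have hsub : ({(i, b), (j, b')} : Finset ((Plane × ℝ) × Bool)) ⊆ S := by
      intro k hk
      simp only [Finset.mem_insert, Finset.mem_singleton] at hk
      rcases hk with rfl | rfl <;> simp [S, hi, hj]
    refine le_trans ?_ (Finset.sum_le_sum_of_subset hsub)
    rw [Finset.sum_pair hkne, indicator_of_mem hb, indicator_of_mem hb']
    norm_num
  calc 2 * volume (thickening r (poly I))
      = ∫⁻ x, (thickening r (poly I)).indicator (fun _ => (2 : ENNReal)) x := by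
        rw [lintegral_indicator isOpen_thickening.measurableSet]; simp
    _ ≤ ∫⁻ x, ∑ k ∈ S, (hitSet I r k).indicator (fun _ => (1 : ENNReal)) x := lintegral_mono hpt
    _ = ∑ k ∈ S, volume (hitSet I r k) := by
        rw [lintegral_finsetSum]
        · refine Finset.sum_congr rfl fun k _ => ?_
          rw [lintegral_indicator (hitSet_meas I r k)]; simp
        · intro k _
          exact measurable_const.indicator (hitSet_meas I r k)
    _ = ∑ i ∈ I, ∑ b : Bool, ENNReal.ofReal (2 * r) * volume (faceT I i) := by
        rw [Finset.sum_product]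
        refine Finset.sum_congr rfl fun i hi => Finset.sum_congr rfl fun b _ => ?_
        exact hitSet_vol r (k := (i, b)) (hI i hi)
    _ = _ := by
        simp only [Finset.sum_const, Finset.card_univ, Fintype.card_bool, nsmul_eq_mul]
        rw [per, Finset.mul_sum, Finset.mul_sum]; simp

/-- outer strip over the face `i` -/
def outR (I : Finset (Plane × ℝ)) (r : ℝ) (i : Plane × ℝ) : Set Plane :=
  {x : Plane | (inner ℝ i.1 x : ℝ) ∈ Ioo i.2 (i.2 + r) ∧
      (inner ℝ (rotJ i.1) x : ℝ) + (fun _ : ℝ => (0 : ℝ)) (inner ℝ i.1 x) ∈ faceT I i}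

/-- normal cone part at `v` -/
def coneC (I : Finset (Plane × ℝ)) (r : ℝ) (v : Plane) : Set Plane :=
  {w : Plane | (w ∈ ball 0 r ∧ w ≠ 0) ∧ (∀ i ∈ I, (inner ℝ (rotJ i.1) w : ℝ) ≠ 0) ∧
    ∀ q ∈ poly I, (inner ℝ w (q - v) : ℝ) ≤ 0}

lemma outR_meas (I : Finset (Plane × ℝ)) (r : ℝ) (i : Plane × ℝ) : MeasurableSet (outR I r i) :=
  strip_measurable (fun _ => 0) measurable_const measurableSet_Ioo (faceT_closed I i).measurableSet

lemma outR_vol {I : Finset (Plane × ℝ)} (r : ℝ) {i : Plane × ℝ} (hi : ‖i.1‖ = 1) :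
    volume (outR I r i) = ENNReal.ofReal r * volume (faceT I i) := by
  rw [outR, strip_volume hi (fun _ => 0) measurable_const measurableSet_Ioo
    (faceT_closed I i).measurableSet, Real.volume_Ioo]
  congr 2; ring

lemma coneC_meas (I : Finset (Plane × ℝ)) (r : ℝ) (v : Plane) : MeasurableSet (coneC I r v) := by
  have h1 : MeasurableSet {w : Plane | w ∈ ball 0 r ∧ w ≠ 0} :=
    measurableSet_ball.inter (measurableSet_singleton 0).compl
  have h2 : MeasurableSet {w : Plane | ∀ i ∈ I, (inner ℝ (rotJ i.1) w : ℝ) ≠ 0} := by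
    have : {w : Plane | ∀ i ∈ I, (inner ℝ (rotJ i.1) w : ℝ) ≠ 0} =
        ⋂ i ∈ I, {w : Plane | (inner ℝ (rotJ i.1) w : ℝ) ≠ 0} := by ext; simp
    rw [this]
    refine Finset.measurableSet_biInter I fun i _ => ?_
    have hc : Continuous fun w : Plane => (inner ℝ (rotJ i.1) w : ℝ) := by fun_prop
    exact (isOpen_compl_singleton.preimage hc).measurableSet
  have h3 : MeasurableSet {w : Plane | ∀ q ∈ poly I, (inner ℝ w (q - v) : ℝ) ≤ 0} := by
    have : {w : Plane | ∀ q ∈ poly I, (inner ℝ w (q - v) : ℝ) ≤ 0} =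
        ⋂ q ∈ poly I, {w : Plane | (inner ℝ w (q - v) : ℝ) ≤ 0} := by ext; simp
    rw [this]
    exact (isClosed_biInter fun q _ => isClosed_le (by fun_prop) continuous_const).measurableSet
  exact h1.inter (h2.inter h3)

lemma line_null {u : Plane} (hu : ‖u‖ = 1) : volume {w : Plane | (inner ℝ (rotJ u) w : ℝ) = 0} = 0 := by
  have := strip_volume hu (fun _ => 0) measurable_const MeasurableSet.univ
    (measurableSet_singleton (0 : ℝ))
  simpa using this

lemma cones_vol {I : Finset (Plane × ℝ)} (hI : ∀ i ∈ I, ‖i.1‖ = 1) (hQ : IsCompact (poly I))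
    (hint : (interior (poly I)).Nonempty) (r : ℝ) (V : Finset Plane) (hV : ∀ v, v ∈ V ↔ v ∈ verts I) :
    volume (ball (0 : Plane) r) ≤ ∑ v ∈ V, volume (coneC I r v) := by
  let N : Set Plane := {0} ∪ ⋃ i ∈ I, {w : Plane | (inner ℝ (rotJ i.1) w : ℝ) = 0}
  have hN : volume N = 0 := by
    refine measure_union_null (by simp) ?_
    exact (measure_biUnion_null_iff I.countable_toSet).2 fun i hi => line_null (hI i hi)
  have hsub : ball (0 : Plane) r ⊆ (⋃ v ∈ V, coneC I r v) ∪ N := by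
    intro w hw
    by_cases hwN : w ∈ N
    · right; exact hwN
    · left
      simp only [N, mem_union, mem_singleton_iff, mem_iUnion, not_or, not_exists, mem_ofPred_eq] at hwN
      obtain ⟨v, hv, h⟩ := exists_vert hQ hint hwN.1 (fun i hi => hwN.2 i hi)
      simp only [mem_iUnion]
      exact ⟨v, (hV v).2 hv, ⟨hw, hwN.1⟩, fun i hi => hwN.2 i hi, h⟩
  calc volume (ball (0 : Plane) r) ≤ volume ((⋃ v ∈ V, coneC I r v) ∪ N) := measure_mono hsub
    _ ≤ volume (⋃ v ∈ V, coneC I r v) + volume N := measure_union_le _ _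
    _ = volume (⋃ v ∈ V, coneC I r v) := by rw [hN, add_zero]
    _ ≤ _ := measure_biUnion_finset_le _ _

lemma outR_spec {I : Finset (Plane × ℝ)} (hI : ∀ i ∈ I, ‖i.1‖ = 1) {r : ℝ} {i : Plane × ℝ}
    (hi : i ∈ I) {x : Plane} (hx : x ∈ outR I r i) :
    ∃ p s, NP (poly I) x p ∧ (inner ℝ i.1 p : ℝ) = i.2 ∧ 0 < s ∧ s < r ∧ x - p = s • i.1 := by
  obtain ⟨h1, h2⟩ := hx
  simp only [add_zero] at h2
  set t : ℝ := inner ℝ (rotJ i.1) x with ht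
  have hxp : x - (i.2 • i.1 + t • rotJ i.1) = ((inner ℝ i.1 x : ℝ) - i.2) • i.1 := by
    conv_lhs => rw [decomp (hI i hi) x, ← ht]
    rw [sub_smul]; abel
  refine ⟨i.2 • i.1 + t • rotJ i.1, (inner ℝ i.1 x : ℝ) - i.2, ⟨h2, ?_⟩, inner_face (hI i hi) t,
    by linarith [h1.1], by linarith [h1.2], hxp⟩
  intro z hz
  rw [hxp, real_inner_smul_left, inner_sub_right, inner_face (hI i hi)]
  exact mul_nonpos_of_nonneg_of_nonpos (by linarith [h1.1]) (by linarith [hz i hi])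

lemma steiner {I : Finset (Plane × ℝ)} (hI : ∀ i ∈ I, ‖i.1‖ = 1) (hQ : IsCompact (poly I))
    (hint : (interior (poly I)).Nonempty) {r : ℝ} (hr : 0 < r) :
    volume (poly I) + ENNReal.ofReal r * per I + volume (ball (0 : Plane) r) ≤
      volume (thickening r (poly I)) := by
  classical
  let V := (verts_finite hI hint).toFinset
  have hV : ∀ v, v ∈ V ↔ v ∈ verts I := fun v => by simp [V]
  let D : Plane → Set Plane := fun v => (fun x => x - v) ⁻¹' coneC I r v
  have hDm : ∀ v, MeasurableSet (D v) := fun v =>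
    (measurable_id.sub_const v) (coneC_meas I r v)
  have hDv : ∀ v, volume (D v) = volume (coneC I r v) := fun v => by
    simp only [D, sub_eq_add_neg]
    exact measure_preimage_add_right volume (-v) _
  have hD : ∀ v ∈ V, ∀ x ∈ D v, NP (poly I) x v := fun v hv x hx =>
    ⟨((hV v).1 hv).1, fun z hz => hx.2.2 z hz⟩
  have hRR : (I : Set (Plane × ℝ)).PairwiseDisjoint (outR I r) := by
    intro i hi j hj hij
    rw [Function.onFun, Set.disjoint_left]
    intro x hx hx'
    obtain ⟨p, s, h1, h2, h3, h4, h5⟩ := outR_spec hI hi hx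
    obtain ⟨p', s', h1', h2', h3', h4', h5'⟩ := outR_spec hI hj hx'
    obtain rfl := h1.unique h1'
    have e : s • i.1 = s' • j.1 := h5.symm.trans h5'
    have en := congrArg norm e
    rw [norm_smul, norm_smul, hI i hi, hI j hj, Real.norm_of_nonneg h3.le,
      Real.norm_of_nonneg h3'.le, mul_one, mul_one] at en
    subst en
    have e1 : i.1 = j.1 := smul_right_injective Plane h3.ne' e
    apply hij
    refine Prod.ext e1 ?_
    rw [← h2, ← h2', e1]
  have hDD : (V : Set Plane).PairwiseDisjoint D := by
    intro v hv w hw hvw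
    rw [Function.onFun, Set.disjoint_left]
    intro x hx hx'
    exact hvw ((hD v hv x hx).unique (hD w hw x hx'))
  have hQR : Disjoint (poly I) (⋃ i ∈ I, outR I r i) := by
    rw [Set.disjoint_left]
    intro x hx hx'
    simp only [mem_iUnion] at hx'
    obtain ⟨i, hi, hx'⟩ := hx'
    linarith [hx'.1.1, hx i hi]
  have hQD : Disjoint (poly I ∪ (⋃ i ∈ I, outR I r i)) (⋃ v ∈ V, D v) := by
    rw [Set.disjoint_left]
    intro x hx hx'
    simp only [mem_iUnion] at hx'
    obtain ⟨v, hv, hx'⟩ := hx'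
    have hnp := hD v hv x hx'
    rcases hx with hx | hx
    · have := (NP.self hx).unique hnp
      exact hx'.1.2 (by simp [this])
    · simp only [mem_iUnion] at hx
      obtain ⟨i, hi, hx⟩ := hx
      obtain ⟨p, s, h1, h2, h3, h4, h5⟩ := outR_spec hI hi hx
      obtain rfl := h1.unique hnp
      apply hx'.2.1 i hi
      simp only [h5]
      rw [inner_smul_right, inner_rotJ, mul_zero]
  have hRm : MeasurableSet (⋃ i ∈ I, outR I r i) :=
    Finset.measurableSet_biUnion I fun i _ => outR_meas I r i
  have hDm' : MeasurableSet (⋃ v ∈ V, D v) := Finset.measurableSet_biUnion V fun v _ => hDm v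
  have hsub : (poly I ∪ (⋃ i ∈ I, outR I r i)) ∪ (⋃ v ∈ V, D v) ⊆ thickening r (poly I) := by
    rintro x ((hx | hx) | hx)
    · exact self_subset_thickening hr _ hx
    · simp only [mem_iUnion] at hx
      obtain ⟨i, hi, hx⟩ := hx
      obtain ⟨p, s, h1, h2, h3, h4, h5⟩ := outR_spec hI hi hx
      refine mem_thickening_iff.2 ⟨p, h1.1, ?_⟩
      rw [dist_eq_norm, h5, norm_smul, hI i hi, mul_one, Real.norm_of_nonneg h3.le]
      exact h4
    · simp only [mem_iUnion] at hx
      obtain ⟨v, hv, hx⟩ := hx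
      refine mem_thickening_iff.2 ⟨v, ((hV v).1 hv).1, ?_⟩
      rw [dist_eq_norm]
      simpa using hx.1.1
  refine le_trans ?_ (measure_mono hsub)
  rw [measure_union hQD hDm', measure_union hQR hRm,
    measure_biUnion_finset hRR fun i _ => outR_meas I r i,
    measure_biUnion_finset hDD fun v _ => hDm v]
  have e1 : ∑ i ∈ I, volume (outR I r i) = ENNReal.ofReal r * per I := by
    rw [per, Finset.mul_sum]
    exact Finset.sum_congr rfl fun i hi => outR_vol r (hI i hi)
  rw [e1]
  gcongr
  simp_rw [hDv]
  exact cones_vol hI hQ hint r V hV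

lemma bonnesen_poly {I : Finset (Plane × ℝ)} (hI : ∀ i ∈ I, ‖i.1‖ = 1) (hQ : IsCompact (poly I))
    (hint : (interior (poly I)).Nonempty) {r : ℝ} (hr : 0 < r)
    (h1 : ∀ x, ¬ closedBall x r ⊆ poly I) (h2 : ∀ x, ¬ poly I ⊆ closedBall x r) :
    (volume (poly I)).toReal + Real.pi * r ^ 2 ≤ r * (μH[1] (frontier (poly I))).toReal := by
  have a := steiner hI hQ hint hr
  have b := poincare hI hQ hint hr h1 h2
  have c := per_le hI hint
  have hfin := hausdorff_finite hQ (poly_convex I) hint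
  have hper : per I ≠ ⊤ := (c.trans_lt hfin).ne
  have b' := (ENNReal.mul_le_mul_iff_right (by norm_num) (by norm_num)).1 b
  have hab := a.trans b'
  have hQf : volume (poly I) ≠ ⊤ := hQ.measure_lt_top.ne
  have hm : ENNReal.ofReal r * per I ≠ ⊤ := ENNReal.mul_ne_top (by simp) hper
  have hB : volume (ball (0 : Plane) r) ≠ ⊤ := measure_ball_lt_top.ne
  have hreal := ENNReal.toReal_mono (ENNReal.mul_ne_top ENNReal.ofReal_ne_top hper) hab
  rw [ENNReal.toReal_add (ENNReal.add_ne_top.2 ⟨hQf, hm⟩) hB, ENNReal.toReal_add hQf hm,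
    ENNReal.toReal_mul, ENNReal.toReal_mul, ENNReal.toReal_ofReal hr.le,
    ENNReal.toReal_ofReal (by positivity), EuclideanSpace.volume_ball_fin_two, ENNReal.toReal_mul,
    ENNReal.toReal_pow, ENNReal.toReal_ofReal hr.le, ENNReal.toReal_ofReal Real.pi_pos.le] at hreal
  have hc := ENNReal.toReal_mono hfin.ne c
  nlinarith [mul_le_mul_of_nonneg_left hc hr.le]

lemma sep_unit {C : Set Plane} (hC : IsCompact C) (hCc : Convex ℝ C) (hne : C.Nonempty)
    {y : Plane} (hy : y ∉ C) : ∃ i : Plane × ℝ, ‖i.1‖ = 1 ∧ (∀ a ∈ C, (inner ℝ i.1 a : ℝ) ≤ i.2) ∧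
      i.2 < (inner ℝ i.1 y : ℝ) := by
  obtain ⟨F, s, hF, hs⟩ := geometric_hahn_banach_closed_point hCc hC.isClosed hy
  let u := (InnerProductSpace.toDual ℝ Plane).symm F
  have hu : ∀ z, (inner ℝ u z : ℝ) = F z := fun z => by simp [u]
  have hu0 : u ≠ 0 := by
    intro h0
    obtain ⟨a, ha⟩ := hne
    have h1 := hF a ha
    rw [← hu, h0, inner_zero_left] at h1
    rw [← hu, h0, inner_zero_left] at hs
    linarith
  have hn : 0 < ‖u‖ := norm_pos_iff.2 hu0
  refine ⟨(‖u‖⁻¹ • u, ‖u‖⁻¹ * s), ?_, ?_, ?_⟩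
  · simp [norm_smul, hn.ne']
  · intro a ha
    simp only [real_inner_smul_left, hu]
    exact mul_le_mul_of_nonneg_left (hF a ha).le (by positivity)
  · simp only [real_inner_smul_left, hu]
    exact mul_lt_mul_of_pos_left hs (by positivity)

lemma approx {C K : Set Plane} (hC : IsCompact C) (hCc : Convex ℝ C) (hne : C.Nonempty)
    (hK : IsCompact K) (hCK : C ⊆ interior K) :
    ∃ I : Finset (Plane × ℝ), (∀ i ∈ I, ‖i.1‖ = 1) ∧ C ⊆ poly I ∧ poly I ⊆ K := by
  classical
  have hfc : IsCompact (frontier K) := hK.of_isClosed_subset isClosed_frontier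
    hK.isClosed.frontier_subset
  have hex : ∀ y ∈ frontier K, ∃ i : Plane × ℝ, ‖i.1‖ = 1 ∧ (∀ a ∈ C, (inner ℝ i.1 a : ℝ) ≤ i.2) ∧
      i.2 < (inner ℝ i.1 y : ℝ) := by
    intro y hy
    apply sep_unit hC hCc hne
    intro hyC
    rw [hK.isClosed.frontier_eq] at hy
    exact hy.2 (hCK hyC)
  choose! f hf1 hf2 hf3 using hex
  obtain ⟨t, ht, hcov⟩ := hfc.elim_nhds_subcover
    (fun y => {z : Plane | (f y).2 < (inner ℝ (f y).1 z : ℝ)}) (by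
      intro y hy
      have hc : Continuous fun z : Plane => (inner ℝ (f y).1 z : ℝ) := by fun_prop
      exact (isOpen_lt continuous_const hc).mem_nhds (hf3 y hy))
  refine ⟨t.image f, ?_, ?_, ?_⟩
  · intro i hi
    obtain ⟨y, hy, rfl⟩ := Finset.mem_image.1 hi
    exact hf1 y (ht y hy)
  · intro a ha i hi
    obtain ⟨y, hy, rfl⟩ := Finset.mem_image.1 hi
    exact hf2 y (ht y hy) a ha
  · by_contra hns
    obtain ⟨z, hz, hzK⟩ := not_subset.1 hns
    obtain ⟨c, hc⟩ := hne
    have hcp : c ∈ poly (t.image f) := by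
      intro i hi
      obtain ⟨y, hy, rfl⟩ := Finset.mem_image.1 hi
      exact hf2 y (ht y hy) c hc
    obtain ⟨w, hw, hwf⟩ := meets_frontier hK.isClosed (poly_convex (t.image f)).isPreconnected
      ⟨c, hcp, interior_subset (hCK hc)⟩ ⟨z, hz, hzK⟩
    have := hcov hwf
    simp only [mem_iUnion] at this
    obtain ⟨y, hy, hlt⟩ := this
    have h1 : (f y).2 < (inner ℝ (f y).1 w : ℝ) := hlt
    have h2 := hw (f y) (Finset.mem_image_of_mem f hy)
    linarith

lemma bonnesen {K : Set Plane} (hK : IsCompact K) (hKc : Convex ℝ K)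
    (hint : (interior K).Nonempty) {r : ℝ} (hr : 0 < r)
    (h1 : ∀ x, ¬ closedBall x r ⊆ K) {y z : Plane} (hy : y ∈ K) (hz : z ∈ K)
    (hyz : 2 * r < dist y z) :
    (volume K).toReal + Real.pi * r ^ 2 ≤ r * (μH[1] (frontier K)).toReal := by
  obtain ⟨c, hc⟩ := hint
  have hfin := hausdorff_finite hK hKc ⟨c, hc⟩
  have hev : ∀ᶠ l : ℝ in nhdsWithin 1 (Iio 1),
      l ^ 2 * (volume K).toReal + Real.pi * r ^ 2 ≤ r * (μH[1] (frontier K)).toReal := by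
    have e1 : ∀ᶠ l : ℝ in nhds 1, 2 * r < l * dist y z := by
      have hcont : Continuous fun l : ℝ => l * dist y z := by fun_prop
      exact continuousAt_const.eventually_lt hcont.continuousAt (by simpa using hyz)
    have e2 : ∀ᶠ l : ℝ in nhds 1, 0 < l := lt_mem_nhds one_pos
    filter_upwards [self_mem_nhdsWithin, e1.filter_mono nhdsWithin_le_nhds,
      e2.filter_mono nhdsWithin_le_nhds] with l hl1 hl2 hl0
    have hl1 : l < 1 := hl1
    let H := AffineMap.homothety c l
    have hHap : ∀ a, H a = l • (a - c) + c := fun a => by simp [H, AffineMap.homothety_apply]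
    have hHc : Continuous H := by
      have : ⇑H = fun a => l • (a - c) + c := funext hHap
      rw [this]; fun_prop
    have hC : IsCompact (H '' K) := hK.image hHc
    have hCc : Convex ℝ (H '' K) := hKc.affine_image H
    have hCK : H '' K ⊆ interior K := by
      rintro _ ⟨a, ha, rfl⟩
      apply hKc.openSegment_interior_closure_subset_interior hc (subset_closure ha)
      refine ⟨1 - l, l, by linarith, hl0, by ring, ?_⟩
      rw [hHap, sub_smul, smul_sub, one_smul]; abel
    obtain ⟨I, hI, hCI, hIK⟩ := approx hC hCc ⟨_, mem_image_of_mem H (interior_subset hc)⟩ hK hCK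
    have hQ : IsCompact (poly I) := hK.of_isClosed_subset (poly_closed I) hIK
    have hQi : (interior (poly I)).Nonempty := by
      refine ⟨H c, mem_interior.2 ⟨H '' interior K, (image_mono interior_subset).trans hCI, ?_,
        mem_image_of_mem H hc⟩⟩
      exact AffineMap.homothety_isOpenMap c l hl0.ne' _ isOpen_interior
    have hb := bonnesen_poly hI hQ hQi hr (fun x hx => h1 x (hx.trans hIK)) (by
      intro x hx
      have hy' := hx (hCI (mem_image_of_mem H hy))
      have hz' := hx (hCI (mem_image_of_mem H hz))
      have hd : dist (H y) (H z) = l * dist y z := by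
        rw [hHap, hHap, dist_add_right, dist_eq_norm, ← smul_sub, sub_sub_sub_cancel_right,
          norm_smul, Real.norm_of_nonneg hl0.le, dist_eq_norm]
      have := dist_triangle_right (H y) (H z) x
      rw [mem_closedBall] at hy' hz'
      linarith)
    have hv : l ^ 2 * (volume K).toReal ≤ (volume (poly I)).toReal := by
      have := ENNReal.toReal_mono (hQ.measure_lt_top (μ := (volume : Measure Plane))).ne (measure_mono hCI)
      rw [Measure.addHaar_image_homothety, ENNReal.toReal_mul, ENNReal.toReal_ofReal (abs_nonneg _),
        abs_of_nonneg (by positivity)] at this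
      simpa using this
    have hm := ENNReal.toReal_mono hfin.ne (hausdorff_mono hQ (poly_convex I) hQi hK hIK)
    nlinarith [mul_le_mul_of_nonneg_left hm hr.le]
  have hlim : Filter.Tendsto (fun l : ℝ => l ^ 2 * (volume K).toReal + Real.pi * r ^ 2)
      (nhdsWithin 1 (Iio 1)) (nhds ((volume K).toReal + Real.pi * r ^ 2)) := by
    have hcont : Continuous fun l : ℝ => l ^ 2 * (volume K).toReal + Real.pi * r ^ 2 := by fun_prop
    have := hcont.tendsto 1
    simp only [one_pow, one_mul] at this
    exact this.mono_left nhdsWithin_le_nhds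
  exact le_of_tendsto hlim hev

lemma exists_incircle {K : Set Plane} (hK : IsCompact K) (hint : (interior K).Nonempty) :
    ∃ (c : Plane) (ρ : ℝ), 0 < ρ ∧ closedBall c ρ ⊆ K ∧ ∀ x s, ρ < s → ¬ closedBall x s ⊆ K := by
  obtain ⟨R, hR⟩ := hK.isBounded.subset_closedBall 0
  obtain ⟨a, ha⟩ := hint
  obtain ⟨ε, hε, hεK⟩ := nhds_basis_closedBall.mem_iff.1 (mem_interior_iff_mem_nhds.1 ha)
  have hiff : ∀ (x : Plane) (s : ℝ), 0 ≤ s →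
      (closedBall x s ⊆ K ↔ ∀ w ∈ closedBall (0 : Plane) 1, x + s • w ∈ K) := by
    intro x s hs
    constructor
    · intro h w hw
      apply h
      rw [mem_closedBall, dist_self_add_left, norm_smul, Real.norm_of_nonneg hs]
      rw [mem_closedBall_zero_iff] at hw
      nlinarith
    · intro h y hy
      rw [mem_closedBall, dist_eq_norm] at hy
      rcases hs.eq_or_lt with rfl | hs
      · have : y = x := by simpa [sub_eq_zero] using hy
        have h0 := h 0 (by simp)
        simpa [this] using h0
      · have := h (s⁻¹ • (y - x)) (by
          rw [mem_closedBall_zero_iff, norm_smul, norm_inv, Real.norm_of_nonneg hs.le]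
          rw [inv_mul_le_iff₀ hs]; linarith)
        rwa [smul_smul, mul_inv_cancel₀ hs.ne', one_smul, add_sub_cancel] at this
  have hbd : ∀ (x : Plane) (s : ℝ), 0 ≤ s → closedBall x s ⊆ K → s ≤ 2 * R := by
    intro x s hs h
    let e : Plane := EuclideanSpace.single 0 1
    have he : ‖e‖ = 1 := by simp [e]
    have h1 := hR (h (mem_closedBall_self hs))
    have h2 := hR (h (show x + s • e ∈ closedBall x s by
      simp [norm_smul, he, abs_of_nonneg hs]))
    have := dist_triangle_right (x + s • e) x 0
    rw [mem_closedBall] at h1 h2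
    rw [dist_self_add_left, norm_smul, he, Real.norm_of_nonneg hs] at this
    linarith
  let S : Set (Plane × ℝ) := {p | p ∈ K ×ˢ Icc 0 (2 * R) ∧ ∀ w ∈ closedBall (0 : Plane) 1, p.1 + p.2 • w ∈ K}
  have hS : IsCompact S := by
    refine (hK.prod isCompact_Icc).of_isClosed_subset ?_ (fun p hp => hp.1)
    have : S = (K ×ˢ Icc 0 (2 * R)) ∩ ⋂ w ∈ closedBall (0 : Plane) 1,
        (fun p : Plane × ℝ => p.1 + p.2 • w) ⁻¹' K := by
      ext p; simp [S]
    rw [this]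
    refine (hK.isClosed.prod isClosed_Icc).inter (isClosed_biInter fun w _ => ?_)
    exact hK.isClosed.preimage (by fun_prop)
  have hmem : ∀ (x : Plane) (s : ℝ), 0 ≤ s → closedBall x s ⊆ K → (x, s) ∈ S := fun x s hs h =>
    ⟨⟨h (mem_closedBall_self hs), hs, hbd x s hs h⟩, (hiff x s hs).1 h⟩
  obtain ⟨p, hp, hmax⟩ := hS.exists_isMaxOn ⟨_, hmem a ε hε.le hεK⟩ continuousOn_snd
  have hmax' : ∀ q ∈ S, q.2 ≤ p.2 := fun q hq => hmax hq
  have hpos : 0 < p.2 := lt_of_lt_of_le hε (hmax' _ (hmem a ε hε.le hεK))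
  refine ⟨p.1, p.2, hpos, (hiff p.1 p.2 hpos.le).2 hp.2, fun x s hs h => ?_⟩
  exact absurd (hmax' _ (hmem x s (hpos.trans hs).le h)) (not_le.2 hs)

/-- Strict isoperimetric inequality for non-circular planar convex bodies:
if `K` is compact convex with nonempty interior and is not a closed disk, then
`H¹(∂K)² > 4π·L(K)`. -/
theorem stmt_12 (K : Set Plane) (hK : IsCompact K) (hKc : Convex ℝ K)
    (hint : (interior K).Nonempty)
    (hnotdisk : ¬ ∃ (c : Plane) (r : ℝ), 0 < r ∧ K = closedBall c r) :
    4 * Real.pi * (volume K).toReal < (μH[1] (frontier K)).toReal ^ 2 := by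
  obtain ⟨c, ρ, hρ, hcK, hmax⟩ := exists_incircle hK hint
  have hns : ¬ K ⊆ closedBall c ρ := fun h => hnotdisk ⟨c, ρ, hρ, h.antisymm hcK⟩
  obtain ⟨y, hy, hyc⟩ := not_subset.1 hns
  have hd : ρ < ‖y - c‖ := by
    rw [mem_closedBall, dist_eq_norm] at hyc; linarith
  set D : ℝ := ‖y - c‖
  have hD : 0 < D := hρ.trans hd
  let z : Plane := c - (ρ / D) • (y - c)
  have hz : z ∈ K := by
    apply hcK
    rw [mem_closedBall, dist_eq_norm, sub_sub_cancel_left, norm_neg, norm_smul,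
      Real.norm_of_nonneg (by positivity)]
    exact (div_mul_cancel₀ ρ hD.ne').le
  have hyz : dist y z = D + ρ := by
    have : y - z = (1 + ρ / D) • (y - c) := by
      simp only [z, add_smul, one_smul]; abel
    rw [dist_eq_norm, this, norm_smul, Real.norm_of_nonneg (by positivity)]
    change (1 + ρ / D) * D = D + ρ
    rw [add_mul, one_mul, div_mul_cancel₀ ρ hD.ne']
  have key : ∀ r, ρ < r → 2 * r < D + ρ →
      (volume K).toReal + Real.pi * r ^ 2 ≤ r * (μH[1] (frontier K)).toReal := fun r h1 h2 =>
    bonnesen hK hKc hint (hρ.trans h1) (fun x => hmax x r h1) hy hz (by rw [hyz]; exact h2)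
  set A := (volume K).toReal
  set P := (μH[1] (frontier K)).toReal
  have k1 := key (ρ + (D - ρ) / 4) (by linarith) (by linarith)
  have k2 := key (ρ + (D - ρ) / 3) (by linarith) (by linarith)
  have hpi := Real.pi_pos
  have main : ∀ r, A + Real.pi * r ^ 2 ≤ r * P →
      4 * Real.pi * A ≤ P ^ 2 - (P - 2 * Real.pi * r) ^ 2 := by
    intro r h
    nlinarith [mul_le_mul_of_nonneg_left h hpi.le]
  have m1 := main _ k1
  have m2 := main _ k2
  by_contra! hcon
  have z1 : P - 2 * Real.pi * (ρ + (D - ρ) / 4) = 0 := by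
    apply pow_eq_zero_iff (two_ne_zero) |>.1
    apply le_antisymm (by linarith) (sq_nonneg _)
  have z2 : P - 2 * Real.pi * (ρ + (D - ρ) / 3) = 0 := by
    apply pow_eq_zero_iff (two_ne_zero) |>.1
    apply le_antisymm (by linarith) (sq_nonneg _)
  have : Real.pi * (D - ρ) = 0 := by linarith
  rcases mul_eq_zero.1 this with h | h <;> linarith
end

section
/- Let B(r₀) be the open disk of radius r₀ in ℝ² and let K ⊂ B(r₀) be a compact convex set with nonempty interior, not a disk, with H¹(∂K) = L. Then (2πr₀)² − L² < 4π·L₂(B(r₀) \ K), where L₂ is Lebesgue measure. -/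
open Metric Set MeasureTheory

open scoped ComplexConjugate NNReal

lemma ftc_lip {f : ℝ → ℝ} {a b : ℝ} (f' : ℝ → ℝ) (hf : AbsolutelyContinuousOnInterval f a b)
    (hf' : ∀ᵐ x, HasDerivAt f (f' x) x) : ∫ x in a..b, f' x = f b - f a := by
  rw [← hf.integral_deriv_eq_sub]
  apply intervalIntegral.integral_congr_ae
  filter_upwards [hf'] with x hx _
  exact hx.deriv.symm

lemma ac_of_lip {E : Type*} [PseudoMetricSpace E] {C : ℝ≥0} {f : ℝ → E} (hf : LipschitzWith C f) (a b : ℝ) :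
    AbsolutelyContinuousOnInterval f a b := by
  exact (hf.lipschitzOnWith (s := uIcc a b)).absolutelyContinuousOnInterval

lemma ac_comp {E F : Type*} [PseudoMetricSpace E] [PseudoMetricSpace F] {C : ℝ≥0} {f : ℝ → E} {g : E → F} {a b : ℝ}
    (hf : AbsolutelyContinuousOnInterval f a b) (hg : LipschitzWith C g) :
    AbsolutelyContinuousOnInterval (fun x => g (f x)) a b := by
  unfold AbsolutelyContinuousOnInterval at hf
  have h := Filter.Tendsto.const_mul (C : ℝ) hf
  apply squeeze_zero (fun t ↦ ?_) (fun t ↦ ?_) (by simpa using h)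
  · exact Finset.sum_nonneg (fun i hi ↦ by positivity)
  · simp only [Finset.mul_sum]
    exact Finset.sum_le_sum fun i _ => hg.dist_le_mul _ _

lemma ftcC {f : ℝ → ℂ} {a b : ℝ} (f' : ℝ → ℂ) (hf : AbsolutelyContinuousOnInterval f a b)
    (hf' : ∀ᵐ x, HasDerivAt f (f' x) x) (hi : IntervalIntegrable f' volume a b) : 
    ∫ x in a..b, f' x = f b - f a := by
  apply Complex.ext
  · have h1 := ftc_lip (fun x => (f' x).re) (ac_comp hf Complex.reCLM.lipschitz)
      (by filter_upwards [hf'] with x hx; exact Complex.reCLM.hasFDerivAt.comp_hasDerivAt x hx)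
    have h2 := Complex.reCLM.intervalIntegral_comp_comm hi
    simp at h1 h2 ⊢
    rw [← h2, h1]
  · have h1 := ftc_lip (fun x => (f' x).im) (ac_comp hf Complex.imCLM.lipschitz)
      (by filter_upwards [hf'] with x hx; exact Complex.imCLM.hasFDerivAt.comp_hasDerivAt x hx)
    have h2 := Complex.imCLM.intervalIntegral_comp_comm hi
    simp at h1 h2 ⊢
    rw [← h2, h1]

lemma memLp_bdd {g : ℝ → ℂ} {M : ℝ} (hg : Measurable g) (hb : ∀ x, ‖g x‖ ≤ M) (a b : ℝ) :
    MemLp g 2 (volume.restrict (Ioc a b)) :=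
  MemLp.of_bound hg.aestronglyMeasurable M (Filter.Eventually.of_forall hb)

lemma ii_of_bdd {g : ℝ → ℂ} {M : ℝ} (hg : Measurable g) (hb : ∀ x, ‖g x‖ ≤ M) (a b : ℝ) :
    IntervalIntegrable g volume a b := by
  have h := (intervalIntegrable_const (a := a) (b := b) (μ := volume) (c := M))
  refine h.mono_fun hg.aestronglyMeasurable (Filter.Eventually.of_forall fun x => ?_)
  simpa using (hb x).trans (le_abs_self M)

lemma fourier_deriv {f : ℝ → ℂ} (hf : LipschitzWith 1 f) {L : ℝ} (hL : 0 < L) (h0 : f 0 = f L) (n : ℤ) :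
    fourierCoeffOn hL (deriv f) n = (2 * Real.pi * Complex.I * n / L) * fourierCoeffOn hL f n := by
  have hb : ∀ x, ‖deriv f x‖ ≤ 1 := fun x => by simpa using norm_deriv_le_of_lipschitz (x₀ := x) hf
  have hmeas : Measurable (deriv f) := measurable_deriv f
  set e : ℝ → ℂ := fun x => fourier (-n) (x : AddCircle (L - 0)) with he
  have hde : ∀ x, HasDerivAt e (2 * Real.pi * Complex.I * (-n : ℤ) / (L - 0 : ℝ) * e x) x :=
    fun x => hasDerivAt_fourier (L - 0) (-n) x
  have hec : Continuous e := continuous_iff_continuousAt.2 fun x => (hde x).continuousAt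
  have hne : ∀ x, ‖e x‖ = 1 := fun x => by simp only [he, fourier_apply, Circle.norm_coe]
  have helip : LipschitzWith (‖(2 * Real.pi * Complex.I * (-n : ℤ) / (L - 0 : ℝ) : ℂ)‖₊) e := by
    apply lipschitzWith_of_nnnorm_deriv_le (fun x => (hde x).differentiableAt)
    intro x
    rw [(hde x).deriv, nnnorm_mul]
    have : ‖e x‖₊ = 1 := by ext; simpa using hne x
    rw [this, mul_one]
  have hac := (ac_of_lip helip 0 L).smul (ac_of_lip hf 0 L)
  have h1 : IntervalIntegrable (fun x => e x * deriv f x) volume 0 L :=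
    (ii_of_bdd hmeas hb 0 L).continuousOn_mul hec.continuousOn
  have h2 : IntervalIntegrable (fun x => (2 * Real.pi * Complex.I * (-n : ℤ) / (L - 0 : ℝ) * e x) * f x) volume 0 L :=
    ((continuous_const.mul hec).mul hf.continuous).intervalIntegrable _ _
  have hft := ftcC (fun x => (2 * Real.pi * Complex.I * (-n : ℤ) / (L - 0 : ℝ) * e x) * f x + e x * deriv f x)
    hac (by
      filter_upwards [hf.ae_differentiableAt_real] with x hx
      exact (hde x).mul hx.hasDerivAt) (h2.add h1)
  have heL : e L = e 0 := by
    simp only [he]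
    congr 1
    have := AddCircle.coe_period (L - 0)
    simp only [sub_zero] at this ⊢
    simp [this]
  rw [intervalIntegral.integral_add h2 h1] at hft
  simp only [Pi.smul_apply', smul_eq_mul, heL, h0, sub_self] at hft
  rw [fourierCoeffOn_eq_integral, fourierCoeffOn_eq_integral]
  simp only [smul_eq_mul]
  change _ • (∫ x in (0:ℝ)..L, e x * deriv f x) = _ * (_ • ∫ x in (0:ℝ)..L, e x * f x)
  rw [eq_neg_of_add_eq_zero_right hft]
  simp_rw [mul_assoc, intervalIntegral.integral_const_mul]
  push_cast
  simp only [Complex.real_smul]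
  rw [← intervalIntegral.integral_const_mul, ← intervalIntegral.integral_const_mul]
  simp only [mul_div_assoc, mul_assoc, intervalIntegral.integral_const_mul, sub_zero]
  ring

lemma wirtinger {f : ℝ → ℂ} (hf : LipschitzWith 1 f) {L : ℝ} (hL : 0 < L) (h0 : f 0 = f L)
    (hm : ∫ x in (0:ℝ)..L, f x = 0) :
    (2 * Real.pi / L) ^ 2 * ∫ x in (0:ℝ)..L, ‖f x‖ ^ 2 ≤ ∫ x in (0:ℝ)..L, ‖deriv f x‖ ^ 2 := by
  have hb : ∀ x, ‖deriv f x‖ ≤ 1 := fun x => by simpa using norm_deriv_le_of_lipschitz (x₀ := x) hf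
  have hmeas : Measurable (deriv f) := measurable_deriv f
  have hfL2 : MemLp f 2 (volume.restrict (Ioc 0 L)) := by
    obtain ⟨M, hM⟩ := (isCompact_Icc (a := (0:ℝ)) (b := L)).exists_bound_of_continuousOn hf.continuous.continuousOn
    refine MemLp.of_bound hf.continuous.aestronglyMeasurable M ?_
    filter_upwards [ae_restrict_mem measurableSet_Ioc] with x hx
    exact hM x (Ioc_subset_Icc_self hx)
  have s1 := hasSum_sq_fourierCoeffOn hL hfL2
  have s2 := hasSum_sq_fourierCoeffOn hL (memLp_bdd hmeas hb 0 L)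
  have s3 := s1.mul_left ((2 * Real.pi / L) ^ 2)
  have := hasSum_le (fun n => ?_) s3 s2
  · simp only [smul_eq_mul, sub_zero] at this
    have h4 : L * ((2 * Real.pi / L) ^ 2 * (L⁻¹ * ∫ x in (0:ℝ)..L, ‖f x‖ ^ 2)) ≤ L * (L⁻¹ * ∫ x in (0:ℝ)..L, ‖deriv f x‖ ^ 2) := by gcongr
    rw [mul_inv_cancel_left₀ hL.ne'] at h4
    convert h4 using 1
    field_simp
  · rw [fourier_deriv hf hL h0]
    by_cases hn : n = 0
    · subst hn
      have : fourierCoeffOn hL f 0 = 0 := by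
        rw [fourierCoeffOn_eq_integral]; simp [hm]
      simp [this]
    · rw [norm_mul, mul_pow]
      gcongr
      have h1 : ‖(2 * Real.pi * Complex.I * n / L : ℂ)‖ = 2 * Real.pi / L * |(n:ℝ)| := by
        simp [abs_of_pos hL, abs_of_pos Real.pi_pos]; ring
      rw [h1]
      have : (1:ℝ) ≤ |(n:ℝ)| := by exact_mod_cast Int.one_le_abs hn
      have : 0 < 2 * Real.pi / L := by positivity
      nlinarith

lemma hurwitz {f : ℝ → ℂ} (hf : LipschitzWith 1 f) {L : ℝ} (hL : 0 < L) (h0 : f 0 = f L) {A : ℝ}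
    (hA : A = (1 / 2) * ∫ x in (0:ℝ)..L, (conj (f x) * deriv f x).im) :
    4 * Real.pi * A ≤ L ^ 2 ∧ (4 * Real.pi * A = L ^ 2 → ∃ m : ℂ, ∃ R : ℝ, ∀ x ∈ Icc 0 L, ‖f x - m‖ = R) := by
  have hb : ∀ x, ‖deriv f x‖ ≤ 1 := fun x => by simpa using norm_deriv_le_of_lipschitz (x₀ := x) hf
  have hmeas : Measurable (deriv f) := measurable_deriv f
  set m : ℂ := (L:ℂ)⁻¹ * ∫ x in (0:ℝ)..L, f x with hm
  set g : ℝ → ℂ := fun x => f x - m with hg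
  have hLc : (L:ℂ) ≠ 0 := by exact_mod_cast hL.ne'
  have hgl : LipschitzWith 1 g := by
    have := hf.sub (LipschitzWith.const m)
    simpa using this
  have hdg : deriv g = deriv f := by ext x; simp [hg]
  have hgm : ∫ x in (0:ℝ)..L, g x = 0 := by
    simp only [hg]
    rw [intervalIntegral.integral_sub (hf.continuous.intervalIntegrable _ _) (by simp)]
    simp [hm, inv_mul_cancel_left₀ hLc]
  have hW := wirtinger hgl hL (by simp [hg, h0]) hgm
  rw [hdg] at hW
  set w : ℝ := 2 * Real.pi / L with hw
  have hwpos : 0 < w := by positivity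
  have hfi : IntervalIntegrable (deriv f) volume 0 L := ii_of_bdd hmeas hb 0 L
  -- integral of the derivative is zero
  have hd0 : ∫ x in (0:ℝ)..L, deriv f x = 0 := by
    rw [ftcC (deriv f) (ac_of_lip hf 0 L) (by
      filter_upwards [hf.ae_differentiableAt_real] with x hx using hx.hasDerivAt) hfi, h0, sub_self]
  have hcf : IntervalIntegrable (fun x => conj (f x) * deriv f x) volume 0 L :=
    hfi.continuousOn_mul (Complex.continuous_conj.comp hf.continuous).continuousOn
  have hcg : IntervalIntegrable (fun x => conj (g x) * deriv f x) volume 0 L :=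
    hfi.continuousOn_mul (Complex.continuous_conj.comp hgl.continuous).continuousOn
  have hI : ∫ x in (0:ℝ)..L, (conj (g x) * deriv f x).im = 2 * A := by
    rw [hA]
    have e1 := Complex.imCLM.intervalIntegral_comp_comm hcf
    have e2 := Complex.imCLM.intervalIntegral_comp_comm hcg
    simp only [Complex.imCLM_apply] at e1 e2
    rw [e1, e2]
    have : ∫ x in (0:ℝ)..L, conj (g x) * deriv f x = ∫ x in (0:ℝ)..L, conj (f x) * deriv f x := by
      simp only [hg, map_sub, sub_mul]
      rw [intervalIntegral.integral_sub hcf (hfi.const_mul _), intervalIntegral.integral_const_mul, hd0]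
      simp
    rw [this]; ring
  have hi1 : IntervalIntegrable (fun x => ‖deriv f x‖ ^ 2) volume 0 L := by
    refine (intervalIntegrable_const (c := (1:ℝ))).mono_fun (hmeas.norm.pow_const 2).aestronglyMeasurable
      (Filter.Eventually.of_forall fun x => ?_)
    have := hb x
    have h3 : ‖deriv f x‖ ^ 2 ≤ 1 := by nlinarith [norm_nonneg (deriv f x)]
    simpa using h3
  have hi2 : IntervalIntegrable (fun x => ‖g x‖ ^ 2) volume 0 L :=
    (hgl.continuous.norm.pow 2).intervalIntegrable _ _
  have hi3 : IntervalIntegrable (fun x => (conj (g x) * deriv f x).im) volume 0 L :=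
    ⟨Complex.imCLM.integrable_comp hcg.1, Complex.imCLM.integrable_comp hcg.2⟩
  have hpt : ∀ x, ‖deriv f x - Complex.I * w * g x‖ ^ 2 =
      ‖deriv f x‖ ^ 2 + w ^ 2 * ‖g x‖ ^ 2 - 2 * w * (conj (g x) * deriv f x).im := by
    intro x
    rw [← Complex.normSq_eq_norm_sq, ← Complex.normSq_eq_norm_sq, ← Complex.normSq_eq_norm_sq]
    simp [Complex.normSq_apply]
    ring
  have hi4 : IntervalIntegrable (fun x => ‖deriv f x - Complex.I * w * g x‖ ^ 2) volume 0 L := by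
    simp_rw [hpt]
    exact (hi1.add (hi2.const_mul _)).sub (hi3.const_mul _)
  have hJ : ∫ x in (0:ℝ)..L, ‖deriv f x - Complex.I * w * g x‖ ^ 2 =
      (∫ x in (0:ℝ)..L, ‖deriv f x‖ ^ 2) + w ^ 2 * (∫ x in (0:ℝ)..L, ‖g x‖ ^ 2) - 2 * w * (2 * A) := by
    simp_rw [hpt]
    rw [intervalIntegral.integral_sub (hi1.add (hi2.const_mul _)) (hi3.const_mul _),
      intervalIntegral.integral_add hi1 (hi2.const_mul _), intervalIntegral.integral_const_mul,
      intervalIntegral.integral_const_mul, hI]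
  have hJ0 : 0 ≤ ∫ x in (0:ℝ)..L, ‖deriv f x - Complex.I * w * g x‖ ^ 2 :=
    intervalIntegral.integral_nonneg hL.le fun x _ => by positivity
  have hD : ∫ x in (0:ℝ)..L, ‖deriv f x‖ ^ 2 ≤ L := by
    have := intervalIntegral.integral_mono_on hL.le hi1 (intervalIntegrable_const (c := (1:ℝ)))
      (fun x _ => by have := hb x; nlinarith [norm_nonneg (deriv f x)])
    simpa using this
  have hwL : w * L = 2 * Real.pi := by rw [hw]; field_simp
  have key : 2 * w * (2 * A) + ∫ x in (0:ℝ)..L, ‖deriv f x - Complex.I * w * g x‖ ^ 2 ≤ 2 * L := by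
    linarith
  have key2 : 2 * (4 * Real.pi * A) + L * ∫ x in (0:ℝ)..L, ‖deriv f x - Complex.I * w * g x‖ ^ 2 ≤ 2 * L ^ 2 := by
    have := mul_le_mul_of_nonneg_left key hL.le
    have h5 : L * (2 * w * (2 * A)) = 2 * (4 * Real.pi * A) := by
      calc L * (2 * w * (2 * A)) = 4 * (w * L) * A := by ring
        _ = _ := by rw [hwL]; ring
    rw [mul_add, h5] at this
    linarith
  refine ⟨by nlinarith [mul_nonneg hL.le hJ0], fun heq => ⟨m, ?_⟩⟩
  have hJz : ∫ x in (0:ℝ)..L, ‖deriv f x - Complex.I * w * g x‖ ^ 2 = 0 := by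
    rw [heq] at key2
    have : L * ∫ x in (0:ℝ)..L, ‖deriv f x - Complex.I * w * g x‖ ^ 2 ≤ 0 := by linarith
    exact le_antisymm (nonpos_of_mul_nonpos_right this hL) hJ0
  rw [intervalIntegral.integral_eq_zero_iff_of_nonneg_ae (Filter.Eventually.of_forall fun x => by positivity) hi4] at hJz
  rw [Ioc_eq_empty (by linarith : ¬ L < 0), union_empty, 
    restrict_Ioc_eq_restrict_Icc, Filter.EventuallyEq, ae_restrict_iff' measurableSet_Icc] at hJz
  have hac : AbsolutelyContinuousOnInterval (fun x => ‖g x‖ ^ 2) 0 L := by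
    have h1 := ac_comp (ac_of_lip hgl 0 L) lipschitzWith_one_norm
    have := h1.smul h1
    have e : (fun x => ‖g x‖ ^ 2) = (fun x => ‖g x‖) • fun x => ‖g x‖ := by
      funext x; simp only [Pi.smul_apply', smul_eq_mul, sq]
    rw [e]; exact this
  obtain ⟨c, hc⟩ := hac.const_of_ae_hasDerivAt_zero (by
    rw [uIcc_of_le hL.le]
    filter_upwards [hJz, hgl.ae_differentiableAt_real] with x hx hd hxm
    have h1 := hd.hasDerivAt.norm_sq
    have h2 := hx hxm
    simp at h2
    have h3 : 2 * inner ℝ (g x) (deriv g x) = 0 := by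
      rw [hdg, Complex.inner, sub_eq_zero.1 h2]
      simp
      ring
    rwa [h3] at h1)
  rw [uIcc_of_le hL.le] at hc
  refine ⟨√c, fun x hx => ?_⟩
  rw [← hc x hx, Real.sqrt_sq (norm_nonneg _)]

lemma disk_of_frontier {K : Set ℂ} (hK : IsCompact K) (hint : (interior K).Nonempty) {m : ℂ} {R : ℝ}
    (hfr : ∀ z ∈ frontier K, ‖z - m‖ = R) : ∃ (c : ℂ) (r : ℝ), 0 < r ∧ K = closedBall c r := by
  obtain ⟨p, hp⟩ := hint
  have hsub : K ⊆ closedBall m R := by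
    obtain ⟨q, hq, hmax⟩ := hK.exists_isMaxOn ⟨p, interior_subset hp⟩
      (f := fun z => ‖z - m‖) (by fun_prop)
    have hqf : q ∈ frontier K := by
      refine ⟨subset_closure hq, fun hqi => ?_⟩
      obtain ⟨ε, hε, hball⟩ := Metric.mem_nhds_iff.1 (mem_interior_iff_mem_nhds.1 hqi)
      by_cases hqm : q = m
      · have h1 : q + (ε / 2 : ℝ) ∈ K := hball (by simp [abs_of_pos hε]; linarith)
        have h2 := hmax h1
        simp [hqm, abs_of_pos hε] at h2
        linarith
      · have hn : 0 < ‖q - m‖ := norm_pos_iff.2 (sub_ne_zero.2 hqm)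
        set t : ℝ := ε / 2 / ‖q - m‖ with ht
        have htp : 0 < t := by positivity
        have h1 : q + t • (q - m) ∈ K := hball (by
          simp only [mem_ball, dist_self_add_left, norm_smul, Real.norm_eq_abs, abs_of_pos htp]
          rw [ht, div_mul_cancel₀ _ hn.ne']; linarith)
        have h2 := hmax h1
        have h3 : q + t • (q - m) - m = (1 + t) • (q - m) := by
          rw [add_smul, one_smul]; ring
        simp only [mem_ofPred_eq, h3, norm_smul, Real.norm_eq_abs] at h2
        rw [abs_of_pos (by linarith)] at h2
        nlinarith
    intro z hz
    have h1 := hmax hz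
    simp only [mem_ofPred_eq] at h1
    rw [mem_closedBall, dist_eq_norm, ← hfr q hqf]
    exact h1
  have hR : 0 < R := by
    by_contra hR
    have h1 : (interior (closedBall m R)).Nonempty := ⟨p, interior_mono hsub hp⟩
    rcases (not_lt.1 hR).lt_or_eq with h | h
    · simp [closedBall_eq_empty.2 h] at h1
    · simp [h] at h1
  refine ⟨m, R, hR, hsub.antisymm ?_⟩
  have hpb : p ∈ ball m R := by
    have := interior_mono hsub hp
    rwa [interior_closedBall _ hR.ne'] at this
  have hb : ball m R ⊆ K := by
    by_contra hcon
    obtain ⟨z, hz, hzK⟩ := not_subset.1 hcon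
    obtain ⟨y, -, hy1, hy2⟩ := (convex_ball m R).isPreconnected (interior K) Kᶜ isOpen_interior
      hK.isClosed.isOpen_compl (fun y hy => by
        by_cases hyK : y ∈ K
        · left
          by_contra hyi
          have := hfr y ⟨subset_closure hyK, hyi⟩
          rw [mem_ball, dist_eq_norm] at hy
          linarith
        · exact Or.inr hyK) ⟨p, hpb, hp⟩ ⟨z, hz, hzK⟩
    exact hy2 (interior_subset hy1)
  rw [← closure_ball m hR.ne']
  exact hK.isClosed.closure_subset_iff.2 hb

noncomputable def rad (K : Set ℂ) (t : ℝ) : ℝ := (gauge K (Complex.exp (t * Complex.I)))⁻¹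
noncomputable def gam (K : Set ℂ) (t : ℝ) : ℂ := rad K t * Complex.exp (t * Complex.I)

lemma exp_lip (a b : ℝ) : ‖Complex.exp (a * Complex.I) - Complex.exp (b * Complex.I)‖ ≤ |a - b| := by
  have h : Complex.exp (a * Complex.I) - Complex.exp (b * Complex.I) =
      Complex.exp (b * Complex.I) * (Complex.exp (Complex.I * ((a - b : ℝ) : ℂ)) - 1) := by
    rw [mul_sub, ← Complex.exp_add]
    push_cast
    ring_nf
  rw [h, norm_mul, Complex.norm_exp_ofReal_mul_I, one_mul]
  exact Real.norm_exp_I_mul_ofReal_sub_one_le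

/-- basic facts -/
lemma rad_facts {K : Set ℂ} (hK : IsCompact K) (hKc : Convex ℝ K) (h0 : K ∈ nhds (0:ℂ)) :
    ∃ r R : ℝ, ∃ C : ℝ≥0, 0 < r ∧ (∀ t, r ≤ rad K t) ∧ (∀ t, rad K t ≤ R) ∧ Continuous (rad K) ∧
      LipschitzWith C (gam K) := by
  obtain ⟨r, hr, hrK⟩ := Metric.mem_nhds_iff.1 h0
  obtain ⟨R, hR, hRK⟩ := hK.isBounded.subset_closedBall_lt 0 0
  obtain ⟨C, hC⟩ := hKc.lipschitz_gauge h0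
  have hab : Absorbent ℝ K := absorbent_nhds_zero h0
  have hn : ∀ t : ℝ, ‖Complex.exp (t * Complex.I)‖ = 1 := Complex.norm_exp_ofReal_mul_I
  have h1 : ∀ t : ℝ, r * gauge K (Complex.exp (t * Complex.I)) ≤ 1 := fun t => by
    have := mul_gauge_le_norm hrK (x := Complex.exp (t * Complex.I))
    rwa [hn] at this
  have h2 : ∀ t : ℝ, 1 / R ≤ gauge K (Complex.exp (t * Complex.I)) := fun t => by
    have := le_gauge_of_subset_closedBall hab hR.le hRK (x := Complex.exp (t * Complex.I))
    rwa [hn] at this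
  have hg : ∀ t : ℝ, 0 < gauge K (Complex.exp (t * Complex.I)) := fun t =>
    lt_of_lt_of_le (by positivity) (h2 t)
  have hub : ∀ t, rad K t ≤ R := fun t => by
    unfold rad
    have := inv_anti₀ (by positivity) (h2 t)
    simpa using this
  have hrp : ∀ t, 0 < rad K t := fun t => inv_pos.2 (hg t)
  have hcont : Continuous (rad K) := by
    unfold rad
    exact Continuous.inv₀ (hC.continuous.comp (by fun_prop)) fun t => (hg t).ne'
  refine ⟨r, R, ⟨R * R * C + R, by positivity⟩, hr, fun t => ?_, hub, hcont, ?_⟩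
  · unfold rad
    rw [le_inv_comm₀ hr (hg t), ← one_div, le_div_iff₀ hr, mul_comm]
    exact h1 t
  · refine LipschitzWith.of_dist_le_mul fun a b => ?_
    rw [dist_eq_norm, Real.dist_eq]
    have e : gam K a - gam K b = ((rad K a - rad K b : ℝ) : ℂ) * Complex.exp (a * Complex.I) +
      rad K b * (Complex.exp (a * Complex.I) - Complex.exp (b * Complex.I)) := by
      unfold gam; push_cast; ring
    have e1 : |rad K a - rad K b| ≤ R * R * C * |a - b| := by
      have : rad K a - rad K b = rad K a * rad K b *
        (gauge K (Complex.exp (b * Complex.I)) - gauge K (Complex.exp (a * Complex.I))) := by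
        have aux : ∀ u v : ℝ, u ≠ 0 → v ≠ 0 → u⁻¹ - v⁻¹ = u⁻¹ * v⁻¹ * (v - u) := by
          intro u v hu hv; field_simp
        exact aux _ _ (hg a).ne' (hg b).ne'
      rw [this, abs_mul, abs_mul, abs_of_pos (hrp a), abs_of_pos (hrp b), mul_assoc (R * R)]
      have hh : |gauge K (Complex.exp (b * Complex.I)) - gauge K (Complex.exp (a * Complex.I))| ≤ C * |a - b| := by
        have := hC.dist_le_mul (Complex.exp (b * Complex.I)) (Complex.exp (a * Complex.I))
        rw [Real.dist_eq, dist_eq_norm] at this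
        refine this.trans ?_
        have := exp_lip b a
        rw [abs_sub_comm] at this
        gcongr
      have := hub a
      have := hub b
      have := (hrp a).le
      have := (hrp b).le
      gcongr
    calc ‖gam K a - gam K b‖ ≤ |rad K a - rad K b| + rad K b * ‖Complex.exp (a * Complex.I) - Complex.exp (b * Complex.I)‖ := by
          rw [e]
          refine (norm_add_le _ _).trans ?_
          rw [norm_mul, norm_mul, hn, mul_one, Complex.norm_real, Complex.norm_real, Real.norm_eq_abs, Real.norm_eq_abs, abs_of_pos (hrp b)]
      _ ≤ R * R * C * |a - b| + R * |a - b| := by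
          have := hub b
          have := exp_lip a b
          gcongr
      _ = _ := by change _ = (R * R * C + R) * |a - b|; ring

lemma frontier_eq {K : Set ℂ} (hK : IsCompact K) (hKc : Convex ℝ K) (h0 : K ∈ nhds (0:ℂ)) :
    frontier K = gam K '' Icc (-Real.pi) Real.pi := by
  obtain ⟨r, R, C, hr, hlb, hub, hcont, hlip⟩ := rad_facts hK hKc h0
  ext z
  rw [← gauge_eq_one_iff_mem_frontier hKc h0]
  have key : ∀ (s t : ℝ), 0 ≤ s → gauge K (s * Complex.exp (t * Complex.I)) = s * (rad K t)⁻¹ := by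
    intro s t hs
    rw [← Complex.real_smul, gauge_smul_of_nonneg hs]
    simp [rad]
  constructor
  · intro hz
    refine ⟨z.arg, ⟨(Complex.neg_pi_lt_arg z).le, Complex.arg_le_pi z⟩, ?_⟩
    rw [← Complex.norm_mul_exp_arg_mul_I z, key _ _ (norm_nonneg z)] at hz
    have hp := hr.trans_le (hlb z.arg)
    have : ‖z‖ = rad K z.arg := by field_simp at hz; exact hz
    rw [gam, ← this, Complex.norm_mul_exp_arg_mul_I]
  · rintro ⟨t, -, rfl⟩
    have hp := hr.trans_le (hlb t)
    rw [gam, key _ _ hp.le, mul_inv_cancel₀ hp.ne']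

lemma gam_inj {K : Set ℂ} (hp : ∀ t, 0 < rad K t) {s t : ℝ} (hs : s ∈ Icc (-Real.pi) Real.pi)
    (ht : t ∈ Icc (-Real.pi) Real.pi) (hst : s < t) (h : gam K s = gam K t) : s = -Real.pi ∧ t = Real.pi := by
  have hn : ∀ t : ℝ, ‖Complex.exp (t * Complex.I)‖ = 1 := Complex.norm_exp_ofReal_mul_I
  have h1 : rad K s = rad K t := by
    have := congrArg norm h
    simpa [gam, hn, abs_of_pos (hp _)] using this
  have h2 : Complex.exp (s * Complex.I) = Complex.exp (t * Complex.I) := by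
    unfold gam at h
    rw [h1] at h
    exact mul_left_cancel₀ (by exact_mod_cast (hp t).ne') h
  rw [Complex.exp_eq_exp_iff_exists_int] at h2
  obtain ⟨n, hn⟩ := h2
  have h3 : (s : ℂ) = ((t + n * (2 * Real.pi) : ℝ) : ℂ) := by
    apply mul_right_cancel₀ Complex.I_ne_zero
    rw [hn]; push_cast; ring
  have h4 : s = t + n * (2 * Real.pi) := by exact_mod_cast h3
  have hpi := Real.pi_pos
  have hn1 : n ≤ -1 := by
    by_contra hcon
    have : (0:ℝ) ≤ n := by exact_mod_cast (by omega : 0 ≤ n)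
    nlinarith
  have hn2 : (n:ℝ) ≤ -1 := by exact_mod_cast hn1
  have := hs.1
  have := ht.2
  constructor <;> nlinarith

lemma gam_pi {K : Set ℂ} : gam K (-Real.pi) = gam K Real.pi := by
  have : Complex.exp ((-Real.pi : ℝ) * Complex.I) = Complex.exp ((Real.pi : ℝ) * Complex.I) := by
    rw [Complex.exp_pi_mul_I]
    push_cast
    rw [neg_mul, Complex.exp_neg, Complex.exp_pi_mul_I]; norm_num
  unfold gam rad
  rw [this]

lemma polar_area {K : Set ℂ} (hK : IsCompact K) (hKc : Convex ℝ K) (h0 : K ∈ nhds (0:ℂ)) :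
    (volume K).toReal = ∫ t in (-Real.pi)..Real.pi, rad K t ^ 2 / 2 := by
  obtain ⟨r, R, C, hr, hlb, hub, hcont, hlip⟩ := rad_facts hK hKc h0
  have hpos : ∀ t, 0 < rad K t := fun t => hr.trans_le (hlb t)
  have key : ∀ (s t : ℝ), 0 < s → (Complex.polarCoord.symm (s, t) ∈ K ↔ s ≤ rad K t) := by
    intro s t hs
    have h1 : Complex.polarCoord.symm (s, t) = s • Complex.exp (t * Complex.I) := by
      rw [Complex.polarCoord_symm_apply, Complex.exp_mul_I, Complex.real_smul]
      simp
    rw [h1, ← hK.isClosed.closure_eq, ← gauge_le_one_iff_mem_closure hKc h0, gauge_smul_of_nonneg hs.le,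
      smul_eq_mul, hK.isClosed.closure_eq]
    have hp := inv_pos.1 (hpos t)
    unfold rad
    rw [← one_div, le_div_iff₀ hp]
  have hmeas : MeasurableSet K := hK.isClosed.measurableSet
  have hsym : Measurable (Complex.polarCoord.symm : ℝ × ℝ → ℂ) := by
    have : (Complex.polarCoord.symm : ℝ × ℝ → ℂ) = fun p => p.1 * (Real.cos p.2 + Real.sin p.2 * Complex.I) := by
      funext p; exact Complex.polarCoord_symm_apply p
    rw [this]
    exact Continuous.measurable (by fun_prop)
  have hv : volume K = ∫⁻ t in Ioo (-Real.pi) Real.pi, ENNReal.ofReal (rad K t ^ 2 / 2) := by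
    rw [← lintegral_indicator_one hmeas, ← Complex.lintegral_comp_polarCoord_symm, polarCoord_target,
      Measure.volume_eq_prod, ← Measure.prod_restrict, lintegral_prod_symm]
    · refine lintegral_congr fun t => ?_
      have h2 : ∫⁻ x in Ioi (0:ℝ), ENNReal.ofReal x • K.indicator (1 : ℂ → ENNReal) (Complex.polarCoord.symm (x, t))
          = ∫⁻ x in Ioi (0:ℝ), (Ioc 0 (rad K t)).indicator (fun x => ENNReal.ofReal x) x := by
        refine setLIntegral_congr_fun measurableSet_Ioi fun x hx => ?_
        have hx0 : (0:ℝ) < x := hx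
        by_cases hm : x ≤ rad K t
        · rw [indicator_of_mem ((key x t hx0).2 hm), indicator_of_mem (show x ∈ Ioc 0 (rad K t) from ⟨hx0, hm⟩)]
          simp
        · rw [indicator_of_notMem (fun h => hm ((key x t hx0).1 h)), indicator_of_notMem (fun h => hm h.2)]
          simp
      rw [h2, lintegral_indicator measurableSet_Ioc, Measure.restrict_restrict measurableSet_Ioc,
        inter_eq_left.2 Ioc_subset_Ioi_self, ← ofReal_integral_eq_lintegral_ofReal,
        ← intervalIntegral.integral_of_le (hpos t).le, integral_id]
      · simp
      · exact (continuous_id.intervalIntegrable 0 (rad K t)).1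
      · filter_upwards [ae_restrict_mem measurableSet_Ioc] with x hx using hx.1.le
    · refine Measurable.aemeasurable ?_
      exact (ENNReal.measurable_ofReal.comp measurable_fst).smul
        ((measurable_one.indicator hmeas).comp hsym)
  rw [hv, ← ofReal_integral_eq_lintegral_ofReal, ENNReal.toReal_ofReal,
    intervalIntegral.integral_of_le (by linarith [Real.pi_pos]), integral_Ioc_eq_integral_Ioo]
  · exact integral_nonneg fun t => by positivity
  · have : Continuous fun t => rad K t ^ 2 / 2 := by fun_prop
    exact (this.intervalIntegrable (-Real.pi) Real.pi).1.mono_set Ioo_subset_Ioc_self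
  · exact Filter.Eventually.of_forall fun t => by positivity

lemma chord_le {g : ℝ → ℂ} {a b : ℝ} (hab : a ≤ b) (hg : Continuous g) :
    ENNReal.ofReal ‖g b - g a‖ ≤ μH[1] (g '' Icc a b) := by
  have hl : LipschitzWith 1 (fun z : ℂ => dist z (g a)) := LipschitzWith.dist_left _
  have h1 := hl.hausdorffMeasure_image_le (d := 1) zero_le_one (g '' Icc a b)
  simp only [ENNReal.coe_one, ENNReal.one_rpow, one_mul] at h1
  refine le_trans ?_ h1
  rw [hausdorffMeasure_real]
  have h2 : Icc 0 ‖g b - g a‖ ⊆ (fun z : ℂ => dist z (g a)) '' (g '' Icc a b) := by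
    rw [image_image]
    have := intermediate_value_Icc hab (f := fun x => dist (g x) (g a)) (by fun_prop)
    simpa [dist_eq_norm] using this
  refine le_trans (by simp) (measure_mono h2)

/-- arclength function -/
lemma arclength {K : Set ℂ} (hK : IsCompact K) (hKc : Convex ℝ K) (h0 : K ∈ nhds (0:ℂ)) :
    ∃ F : ℝ → ℝ, ContinuousOn F (Icc (-Real.pi) Real.pi) ∧ F (-Real.pi) = 0 ∧
      F Real.pi = (μH[1] (frontier K)).toReal ∧
      ∀ a b, -Real.pi ≤ a → a ≤ b → b ≤ Real.pi → ‖gam K b - gam K a‖ ≤ F b - F a := by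
  obtain ⟨r, R, C, hr, hlb, hub, hcont, hlip⟩ := rad_facts hK hKc h0
  have hpos : ∀ t, 0 < rad K t := fun t => hr.trans_le (hlb t)
  have hpi := Real.pi_pos
  have hns : NullSingletonClass (μH[1] : Measure ℂ) := Measure.nullSingletonClass_hausdorff ℂ zero_lt_one
  have hbd : ∀ a b : ℝ, μH[1] (gam K '' Icc a b) ≤ C * ENNReal.ofReal (b - a) := fun a b => by
    have := hlip.hausdorffMeasure_image_le (d := 1) zero_le_one (Icc a b)
    rw [hausdorffMeasure_real] at this
    simpa using this
  have hfin : ∀ a b : ℝ, μH[1] (gam K '' Icc a b) ≠ ⊤ := fun a b =>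
    ((hbd a b).trans_lt (ENNReal.mul_lt_top ENNReal.coe_lt_top ENNReal.ofReal_lt_top)).ne
  set F : ℝ → ℝ := fun t => (μH[1] (gam K '' Icc (-Real.pi) t)).toReal with hF
  have hadd : ∀ a b, -Real.pi ≤ a → a ≤ b → b ≤ Real.pi →
      F b = F a + (μH[1] (gam K '' Icc a b)).toReal := by
    intro a b ha hab hb
    simp only [hF]
    rw [← ENNReal.toReal_add (hfin _ _) (hfin _ _)]
    congr 1
    rw [← Icc_union_Icc_eq_Icc ha hab, image_union]
    refine measure_union₀ (isCompact_Icc.image hlip.continuous).isClosed.measurableSet.nullMeasurableSet ?_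
    refine measure_mono_null (t := {gam K a, gam K (-Real.pi)}) ?_ ((Set.toFinite _).measure_zero _)
    rintro z ⟨⟨s, hs, rfl⟩, ⟨t, ht, hst⟩⟩
    rcases (hs.2.trans ht.1).lt_or_eq with h | h
    · have := gam_inj hpos ⟨hs.1, by linarith [hs.2]⟩ ⟨by linarith [ht.1], by linarith [ht.2]⟩ h hst.symm
      right; simp [this.1]
    · left
      have : s = a := le_antisymm hs.2 (by linarith [ht.1])
      rw [this]
  refine ⟨F, ?_, ?_, ?_, ?_⟩
  · have hL : LipschitzOnWith C F (Icc (-Real.pi) Real.pi) := by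
      refine LipschitzOnWith.of_le_add_mul C fun x hx y hy => ?_
      rcases le_total x y with h | h
      · have := hadd x y hx.1 h hy.2
        have : (0:ℝ) ≤ (μH[1] (gam K '' Icc x y)).toReal := ENNReal.toReal_nonneg
        have : 0 ≤ C * dist x y := by positivity
        linarith
      · rw [hadd y x hy.1 h hx.2]
        gcongr
        have := ENNReal.toReal_mono (ENNReal.mul_ne_top ENNReal.coe_ne_top ENNReal.ofReal_ne_top) (hbd y x)
        rw [ENNReal.toReal_mul, ENNReal.toReal_ofReal (by linarith)] at this
        rw [Real.dist_eq, abs_of_nonneg (by linarith)]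
        exact this
    exact hL.continuousOn
  · simp [hF]
  · simp only [hF]; rw [frontier_eq hK hKc h0]
  · intro a b ha hab hb
    rw [hadd a b ha hab hb, add_sub_cancel_left]
    have := ENNReal.toReal_mono (hfin a b) (chord_le hab hlip.continuous)
    rwa [ENNReal.toReal_ofReal (norm_nonneg _)] at this

lemma reparam {K : Set ℂ} (hK : IsCompact K) (hKc : Convex ℝ K) (h0 : K ∈ nhds (0:ℂ)) {L : ℝ}
    (hL : L = (μH[1] (frontier K)).toReal) :
    0 < L ∧ ∃ th : ℝ → ℝ, ∃ C : ℝ≥0, LipschitzWith C th ∧ th 0 = -Real.pi ∧ th L = Real.pi ∧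
      LipschitzWith 1 (fun s => gam K (th s)) := by
  obtain ⟨r, R, C, hr, hlb, hub, hcont, hlip⟩ := rad_facts hK hKc h0
  have hpos : ∀ t, 0 < rad K t := fun t => hr.trans_le (hlb t)
  have hpi := Real.pi_pos
  obtain ⟨F, hFc, hF0, hF1, hF⟩ := arclength hK hKc h0
  rw [← hL] at hF1
  set c : ℝ := r * (2 / Real.pi) with hc
  have hcpos : 0 < c := by positivity
  -- local estimate
  have hloc : ∀ a b, -Real.pi ≤ a → a ≤ b → b ≤ Real.pi → b - a ≤ 1 → c * (b - a) ≤ F b - F a := by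
    intro a b ha hab hb h1
    refine le_trans ?_ (hF a b ha hab hb)
    have e1 : rad K b * Real.sin (b - a) ≤ ‖gam K b - gam K a‖ := by
      have e2 : ‖gam K b - gam K a‖ = ‖(gam K b - gam K a) * Complex.exp ((-a : ℝ) * Complex.I)‖ := by
        rw [norm_mul, Complex.norm_exp_ofReal_mul_I, mul_one]
      rw [e2]
      refine le_trans (le_of_eq ?_) (Complex.im_le_norm _)
      have e3 : (gam K b - gam K a) * Complex.exp ((-a : ℝ) * Complex.I) =
          rad K b * Complex.exp ((b - a : ℝ) * Complex.I) - rad K a := by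
        unfold gam
        rw [sub_mul, mul_assoc, mul_assoc, ← Complex.exp_add, ← Complex.exp_add]
        push_cast
        ring_nf
        simp
      rw [e3, Complex.sub_im, Complex.im_ofReal_mul, Complex.exp_ofReal_mul_I_im]
      simp
    have e4 := Real.mul_le_sin (sub_nonneg.2 hab) (by linarith [Real.pi_gt_three])
    calc c * (b - a) = r * (2 / Real.pi * (b - a)) := by rw [hc]; ring
      _ ≤ rad K b * Real.sin (b - a) := by
        have : 0 ≤ b - a := sub_nonneg.2 hab
        exact mul_le_mul (hlb b) e4 (by positivity) (hpos b).le
      _ ≤ _ := e1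
  have hglob : ∀ k : ℕ, ∀ a b, -Real.pi ≤ a → a ≤ b → b ≤ Real.pi → b - a ≤ 2 ^ k →
      c * (b - a) ≤ F b - F a := by
    intro k
    induction k with
    | zero => intro a b h1 h2 h3 h4; exact hloc a b h1 h2 h3 (by simpa using h4)
    | succ k ih =>
      intro a b h1 h2 h3 h4
      rw [pow_succ] at h4
      have i1 := ih a ((a + b) / 2) h1 (by linarith) (by linarith) (by linarith)
      have i2 := ih ((a + b) / 2) b (by linarith) (by linarith) h3 (by linarith)
      linarith
  have hlow : ∀ a b, -Real.pi ≤ a → a ≤ b → b ≤ Real.pi → c * (b - a) ≤ F b - F a := by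
    intro a b h1 h2 h3
    exact hglob 3 a b h1 h2 h3 (by norm_num; linarith [Real.pi_lt_four])
  have hLpos : 0 < L := by
    have := hlow (-Real.pi) Real.pi le_rfl (by linarith) le_rfl
    rw [hF0, hF1] at this
    have : 0 < c * (Real.pi - -Real.pi) := mul_pos hcpos (by linarith)
    linarith
  refine ⟨hLpos, ?_⟩
  have hsurj : ∀ s ∈ Icc 0 L, ∃ t ∈ Icc (-Real.pi) Real.pi, F t = s := by
    have := intermediate_value_Icc (by linarith : -Real.pi ≤ Real.pi) hFc
    rw [hF0, hF1] at this
    exact this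
  choose! th0 hth0 hFth0 using hsurj
  set th : ℝ → ℝ := fun s => th0 (projIcc 0 L hLpos.le s) with hth
  have hmem : ∀ s, th s ∈ Icc (-Real.pi) Real.pi := fun s => hth0 _ (projIcc 0 L hLpos.le s).2
  have hFth : ∀ s, F (th s) = projIcc 0 L hLpos.le s := fun s => hFth0 _ (projIcc 0 L hLpos.le s).2
  have hproj : ∀ x y, |F (th x) - F (th y)| ≤ |x - y| := by
    intro x y
    rw [hFth, hFth]
    have := (LipschitzWith.projIcc hLpos.le).dist_le_mul x y
    simpa [Subtype.dist_eq, Real.dist_eq] using this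
  have hinj : ∀ a b, a ∈ Icc (-Real.pi) Real.pi → b ∈ Icc (-Real.pi) Real.pi → c * |a - b| ≤ |F a - F b| := by
    intro a b ha hb
    rcases le_total a b with h | h
    · rw [abs_sub_comm, abs_of_nonneg (sub_nonneg.2 h), abs_sub_comm]
      exact (hlow a b ha.1 h hb.2).trans (le_abs_self _)
    · rw [abs_of_nonneg (sub_nonneg.2 h)]
      exact (hlow b a hb.1 h ha.2).trans (le_abs_self _)
  have hend : ∀ s, ∀ t ∈ Icc (-Real.pi) Real.pi, F (th s) = F t → th s = t := by
    intro s t ht h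
    have := hinj _ _ (hmem s) ht
    rw [h, sub_self, abs_zero] at this
    have h3 : |th s - t| ≤ 0 := nonpos_of_mul_nonpos_right this hcpos
    exact sub_eq_zero.1 (abs_nonpos_iff.1 h3)
  refine ⟨th, ⟨c⁻¹, by positivity⟩, ?_, ?_, ?_, ?_⟩
  · refine LipschitzWith.of_dist_le_mul fun x y => ?_
    rw [Real.dist_eq, Real.dist_eq]
    change _ ≤ c⁻¹ * _
    rw [← div_eq_inv_mul, le_div_iff₀ hcpos, mul_comm]
    exact (hinj _ _ (hmem x) (hmem y)).trans (hproj x y)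
  · apply hend _ _ ⟨le_rfl, by linarith⟩
    rw [hFth, hF0]; simp
  · apply hend _ _ ⟨by linarith, le_rfl⟩
    rw [hFth, hF1]; simp
  · refine LipschitzWith.of_dist_le_mul fun x y => ?_
    rw [dist_eq_norm, Real.dist_eq]
    simp only [NNReal.coe_one, one_mul]
    refine le_trans ?_ (hproj x y)
    rcases le_total (th x) (th y) with h | h
    · rw [norm_sub_rev, abs_sub_comm]
      exact (hF _ _ (hmem x).1 h (hmem y).2).trans (le_abs_self _)
    · exact (hF _ _ (hmem y).1 h (hmem x).2).trans (le_abs_self _)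

lemma area_formula {K : Set ℂ} (hK : IsCompact K) (hKc : Convex ℝ K) (h0 : K ∈ nhds (0:ℂ)) {L : ℝ}
    {th : ℝ → ℝ} {C : ℝ≥0} (hth : LipschitzWith C th) (ht0 : th 0 = -Real.pi) (ht1 : th L = Real.pi)
    (hf : LipschitzWith 1 (fun s => gam K (th s))) :
    (volume K).toReal = (1 / 2) * ∫ x in (0:ℝ)..L,
      (conj (gam K (th x)) * deriv (fun s => gam K (th s)) x).im := by
  obtain ⟨r, R, C', hr, hlb, hub, hcont, hlip⟩ := rad_facts hK hKc h0
  have hpos : ∀ t, 0 < rad K t := fun t => hr.trans_le (hlb t)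
  set H : ℝ → ℝ := fun t => ∫ u in (-Real.pi)..t, rad K u ^ 2 / 2 with hH
  have hc2 : Continuous fun t => rad K t ^ 2 / 2 := by fun_prop
  have hHd : ∀ t, HasDerivAt H (rad K t ^ 2 / 2) t := fun t =>
    hc2.integral_hasStrictDerivAt (-Real.pi) t |>.hasDerivAt
  have hR : 0 ≤ R := (hpos 0).le.trans (hub 0)
  have hHl : LipschitzWith (Real.toNNReal (R ^ 2 / 2)) H := by
    apply lipschitzWith_of_nnnorm_deriv_le (fun x => (hHd x).differentiableAt)
    intro x
    rw [(hHd x).deriv, ← NNReal.coe_le_coe, coe_nnnorm, Real.coe_toNNReal _ (by positivity), Real.norm_eq_abs, abs_of_nonneg (by positivity)]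
    have := hub x
    have := (hpos x).le
    gcongr
  have hae : ∀ᵐ x, HasDerivAt (fun s => H (th s))
      ((1 / 2) * (conj (gam K (th x)) * deriv (fun s => gam K (th s)) x).im) x := by
    filter_upwards [hth.ae_differentiableAt_real, hf.ae_differentiableAt_real] with x hx hfx
    have h1 := (hHd (th x)).comp x hx.hasDerivAt
    have hne : gam K (th x) ≠ 0 := by
      unfold gam
      exact mul_ne_zero (by exact_mod_cast (hpos _).ne') (Complex.exp_ne_zero _)
    have hnorm : ∀ s, ‖gam K (th s)‖ = rad K (th s) := by
      intro s
      rw [gam, norm_mul, Complex.norm_exp_ofReal_mul_I, mul_one, Complex.norm_real, Real.norm_eq_abs,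
        abs_of_pos (hpos _)]
    have h2 : DifferentiableAt ℝ (fun s => rad K (th s)) x := by
      have := hfx.norm ℝ hne
      simpa only [hnorm] using this
    have h3 : HasDerivAt (fun s => (rad K (th s) : ℂ)) ((deriv (fun s => rad K (th s)) x : ℝ) : ℂ) x :=
      h2.hasDerivAt.ofReal_comp
    have h4 : HasDerivAt (fun s => Complex.exp ((th s : ℝ) * Complex.I))
        (Complex.exp ((th x : ℝ) * Complex.I) * ((deriv th x : ℝ) * Complex.I)) x :=
      (hx.hasDerivAt.ofReal_comp.mul_const Complex.I).cexp
    have h5 := (h3.mul h4).deriv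
    have h6 : deriv (fun s => gam K (th s)) x = _ := h5
    have h7 : (1 / 2) * (conj (gam K (th x)) * deriv (fun s => gam K (th s)) x).im =
        rad K (th x) ^ 2 / 2 * deriv th x := by
      rw [h6, gam]
      have e1 : conj (Complex.exp ((th x : ℝ) * Complex.I)) * Complex.exp ((th x : ℝ) * Complex.I) = 1 := by
        rw [mul_comm, Complex.mul_conj, Complex.normSq_eq_norm_sq, Complex.norm_exp_ofReal_mul_I]; simp
      have e2 : conj ((rad K (th x) : ℂ) * Complex.exp ((th x : ℝ) * Complex.I)) *
          (((deriv (fun s => rad K (th s)) x : ℝ) : ℂ) * Complex.exp ((th x : ℝ) * Complex.I) +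
            (rad K (th x) : ℂ) * (Complex.exp ((th x : ℝ) * Complex.I) * ((deriv th x : ℝ) * Complex.I)))
          = ((rad K (th x) * deriv (fun s => rad K (th s)) x : ℝ) : ℂ) +
            ((rad K (th x) ^ 2 * deriv th x : ℝ) : ℂ) * Complex.I := by
        rw [map_mul, Complex.conj_ofReal]
        push_cast
        linear_combination ((rad K (th x) : ℂ) * (((deriv (fun s => rad K (th s)) x : ℝ) : ℂ) +
          (rad K (th x) : ℂ) * ((deriv th x : ℝ) * Complex.I))) * e1
      rw [e2]
      simp only [Complex.add_im, Complex.ofReal_im, Complex.im_ofReal_mul, Complex.I_im]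
      ring
    rw [h7]
    exact h1
  have := ftc_lip _ (ac_of_lip (hHl.comp hth) 0 L) hae
  rw [intervalIntegral.integral_const_mul] at this
  rw [this, polar_area hK hKc h0]
  simp [hH, ht0, ht1]

lemma isoperimetric {K : Set ℂ} (hK : IsCompact K) (hKc : Convex ℝ K) (h0 : K ∈ nhds (0:ℂ))
    (hnd : ¬ ∃ (c : ℂ) (r : ℝ), 0 < r ∧ K = closedBall c r) :
    4 * Real.pi * (volume K).toReal < (μH[1] (frontier K)).toReal ^ 2 := by
  obtain ⟨hL, th, C, hth, ht0, ht1, hf⟩ := reparam hK hKc h0 rfl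
  obtain ⟨h1, h2⟩ := hurwitz hf hL (by rw [ht0, ht1]; exact gam_pi) (area_formula hK hKc h0 hth ht0 ht1 hf)
  refine lt_of_le_of_ne h1 fun he => hnd ?_
  obtain ⟨m, R, hmR⟩ := h2 he
  refine disk_of_frontier hK ⟨0, mem_interior_iff_mem_nhds.2 h0⟩ (m := m) (R := R) ?_
  rw [frontier_eq hK hKc h0]
  rintro z ⟨t, ht, rfl⟩
  have hiv := intermediate_value_Icc hL.le hth.continuous.continuousOn
  rw [ht0, ht1] at hiv
  obtain ⟨s, hs, rfl⟩ := hiv ht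
  exact hmR s hs

/-- If `K ⊆ B(r₀)` is compact convex with nonempty interior, not a disk, and has
perimeter `L = H¹(∂K)`, then `(2πr₀)² − L² < 4π·L₂(B(r₀) \ K)`. -/
theorem stmt_13 (r₀ : ℝ) (hr₀ : 0 < r₀) (K : Set Plane)
    (hK : IsCompact K) (hKc : Convex ℝ K) (hint : (interior K).Nonempty)
    (hsub : K ⊆ ball (0 : Plane) r₀)
    (hnotdisk : ¬ ∃ (c : Plane) (r : ℝ), 0 < r ∧ K = closedBall c r)
    (L : ℝ) (hL : L = (μH[1] (frontier K)).toReal) :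
    (2 * Real.pi * r₀) ^ 2 - L ^ 2 < 4 * Real.pi * (volume (ball (0 : Plane) r₀ \ K)).toReal := by
  obtain ⟨p, hp⟩ := hint
  set e0 : ℂ ≃ₗᵢ[ℝ] Plane := Complex.orthonormalBasisOneI.repr with he0
  set e : ℂ ≃ᵢ Plane := e0.toIsometryEquiv.trans (IsometryEquiv.addRight p) with he
  have hea : ∀ z, e z = e0 z + p := fun z => rfl
  set K' : Set ℂ := e ⁻¹' K with hK'
  have hK'c : IsCompact K' := by
    have := e.toHomeomorph.isCompact_preimage (s := K)
    exact this.2 hK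
  have hK'v : Convex ℝ K' := by
    have h1 : Convex ℝ ((fun z => z + p) ⁻¹' K) := hKc.translate_preimage_left p
    exact h1.linear_preimage e0.toLinearEquiv.toLinearMap
  have h0 : K' ∈ nhds (0:ℂ) := by
    apply e.continuous.continuousAt.preimage_mem_nhds
    rw [hea]
    simpa using mem_interior_iff_mem_nhds.1 hp
  have hnd : ¬ ∃ (c : ℂ) (r : ℝ), 0 < r ∧ K' = closedBall c r := by
    rintro ⟨c, r, hr, h⟩
    refine hnotdisk ⟨e c, r, hr, ?_⟩
    rw [← e.image_closedBall, ← h, hK', image_preimage_eq _ e.surjective]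
  have hiso := isoperimetric hK'c hK'v h0 hnd
  have hvol : volume K' = volume K := by
    have h1 : MeasurePreserving e0 := e0.measurePreserving
    have h2 : MeasurePreserving (fun z : Plane => z + p) := measurePreserving_add_right volume p
    exact (h2.comp h1).measure_preimage hK.isClosed.measurableSet.nullMeasurableSet
  have hfr : μH[1] (frontier K') = μH[1] (frontier K) := by
    have : frontier K' = e ⁻¹' (frontier K) := (e.toHomeomorph.preimage_frontier K).symm
    rw [this, e.hausdorffMeasure_preimage]
  rw [hvol, hfr, ← hL] at hiso
  have hfin : volume K ≠ ⊤ := hK.measure_lt_top.ne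
  rw [measure_diff hsub hK.isClosed.measurableSet.nullMeasurableSet hfin,
    ENNReal.toReal_sub_of_le (measure_mono hsub) measure_ball_lt_top.ne]
  have hb : (volume (ball (0 : Plane) r₀)).toReal = Real.pi * r₀ ^ 2 := by
    rw [EuclideanSpace.volume_ball_fin_two]
    simp [hr₀.le, mul_comm, Real.pi_pos.le]
  rw [hb]
  nlinarith
end
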